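/- Let (m_n) be a sequence of positive integers such that m_n is the order of at least one element of S_n for each n, and let P_n be the probability that two independent uniformly random elements of S_n of order m_n generate a subgroup containing A_n. Then liminf_{n→∞} P_n > 0 if and only if there is a constant K > 0 such that for all sufficiently large n, either (1) m_n is odd and there exists at least one element of S_n of order m_n with at most K·n^{1/2} fixed points, or (2) m_n is even and m_n ≠ 2. -/

import Mathlib

open Filter Asymptotics

/-- The number of fixed points of a permutation of `Fin n`. -/
noncomputable def fixedPointCount {n : ℕ} (π : Equiv.Perm (Fin n)) : ℕ :=
  Nat.card (Function.fixedPoints ⇑π)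

/-- The probability that two independent uniformly random elements of `S_n` of order `m`
generate a subgroup containing `A_n`. -/
noncomputable def ordProb (n m : ℕ) : ℝ :=
  (Nat.card {p : Equiv.Perm (Fin n) × Equiv.Perm (Fin n) //
      orderOf p.1 = m ∧ orderOf p.2 = m ∧
      alternatingGroup (Fin n) ≤ Subgroup.closure {p.1, p.2}} : ℝ) /
  ((Nat.card {σ : Equiv.Perm (Fin n) // orderOf σ = m} : ℝ)) ^ 2

set_option linter.unusedSectionVars false

namespace FixedOrder
open Equiv Finset

section Averaging
variable {α : Type*} [Fintype α] [DecidableEq α]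

/-- The average of `F` over all permutations of `α`. -/
noncomputable def Ex (F : Perm α → ℝ) : ℝ := (∑ h, F h) / (Fintype.card (Perm α) : ℝ)

open Classical in
/-- The proportion of permutations of `α` with the property `A`. -/
noncomputable def Pr (A : Perm α → Prop) : ℝ := Ex (fun h => if A h then 1 else 0)

lemma card_perm_pos : (0 : ℝ) < Fintype.card (Perm α) := by exact_mod_cast Fintype.card_pos

lemma Ex_mono {F G : Perm α → ℝ} (h : ∀ σ, F σ ≤ G σ) : Ex F ≤ Ex G := by
  unfold Ex
  have := card_perm_pos (α := α)
  gcongr with i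
  exact h i

lemma Ex_nonneg {F : Perm α → ℝ} (h : ∀ σ, 0 ≤ F σ) : 0 ≤ Ex F :=
  div_nonneg (sum_nonneg fun i _ => h i) (card_perm_pos).le

lemma Ex_const (c : ℝ) : Ex (fun _ : Perm α => c) = c := by
  have := (card_perm_pos (α := α)).ne'
  simp only [Ex, sum_const, card_univ, nsmul_eq_mul]
  field_simp

lemma Ex_add (F G : Perm α → ℝ) : Ex (fun h => F h + G h) = Ex F + Ex G := by
  simp [Ex, sum_add_distrib, add_div]

lemma Ex_mul_left (c : ℝ) (F : Perm α → ℝ) : Ex (fun h => c * F h) = c * Ex F := by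
  simp [Ex, ← mul_sum, mul_div_assoc]

lemma Ex_sum {ι : Type*} (s : Finset ι) (F : ι → Perm α → ℝ) :
    Ex (fun h => ∑ i ∈ s, F i h) = ∑ i ∈ s, Ex (F i) := by
  simp only [Ex, ← sum_div]
  rw [sum_comm]

lemma Ex_comp (e : Perm α ≃ Perm α) (F : Perm α → ℝ) : Ex (fun h => F (e h)) = Ex F := by
  simp only [Ex]
  rw [Equiv.sum_comp e F]

lemma Pr_nonneg (A : Perm α → Prop) : 0 ≤ Pr A :=
  Ex_nonneg fun σ => by split_ifs <;> norm_num

lemma Pr_mono {A B : Perm α → Prop} (h : ∀ σ, A σ → B σ) : Pr A ≤ Pr B :=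
  Ex_mono fun σ => by
    by_cases hA : A σ
    · simp [hA, h σ hA]
    · simp only [hA, if_false]; split_ifs <;> norm_num

lemma Pr_or_le (A B : Perm α → Prop) : Pr (fun h => A h ∨ B h) ≤ Pr A + Pr B := by
  unfold Pr
  rw [← Ex_add]
  refine Ex_mono fun σ => ?_
  by_cases hA : A σ <;> by_cases hB : B σ <;> simp [hA, hB]

lemma Pr_le_Ex {A : Perm α → Prop} {F : Perm α → ℝ} (h0 : ∀ σ, 0 ≤ F σ)
    (h : ∀ σ, A σ → 1 ≤ F σ) : Pr A ≤ Ex F :=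
  Ex_mono fun σ => by
    by_cases hA : A σ
    · simpa [hA] using h σ hA
    · simpa [hA] using h0 σ

open Classical in
lemma Pr_eq_card (A : Perm α → Prop) :
    Pr A = (#{h | A h} : ℝ) / (Fintype.card α).factorial := by
  simp [Pr, Ex, Fintype.card_perm]

lemma Pr_exists_le {ι : Type*} (s : Finset ι) (A : ι → Perm α → Prop) :
    Pr (fun h => ∃ i ∈ s, A i h) ≤ ∑ i ∈ s, Pr (A i) := by
  classical
  unfold Pr
  rw [← Ex_sum]
  refine Ex_mono fun σ => ?_
  split_ifs with h
  · obtain ⟨i, hi, hA⟩ := h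
    refine le_trans ?_ (single_le_sum (fun j _ => ?_) hi)
    · simp [hA]
    · split_ifs <;> norm_num
  · exact sum_nonneg fun j _ => by split_ifs <;> norm_num

end Averaging

section Counting

lemma card_smul_eq_mul_le {G X : Type*} [Group G] [Fintype G] [MulAction G X] [DecidableEq X]
    (a b : X) (O : Finset X) (hO : ∀ c ∈ O, ∃ g : G, g • a = c) :
    #{g : G | g • a = b} * #O ≤ Fintype.card G := by
  have key : ∀ c ∈ O, #{g : G | g • a = b} ≤ #{g : G | g • a = c} := by
    intro c hc
    by_cases hb : ∃ g₀ : G, g₀ • a = b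
    · obtain ⟨g₀, hg₀⟩ := hb
      obtain ⟨g₁, hg₁⟩ := hO c hc
      refine card_le_card_of_injOn (fun g => g₁ * g₀⁻¹ * g) ?_ ?_
      · intro g hg
        simp only [coe_filter, mem_univ, true_and, Set.mem_ofPred_eq] at hg ⊢
        rw [mul_smul, hg, mul_smul, ← hg₀, inv_smul_smul, hg₁]
      · intro g _ g' _ h
        simpa using h
    · have : #{g : G | g • a = b} = 0 := by
        rw [card_eq_zero, filter_eq_empty_iff]
        exact fun g _ hg => hb ⟨g, hg⟩
      omega
  calc #{g : G | g • a = b} * #O = ∑ c ∈ O, #{g : G | g • a = b} := by simp [mul_comm]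
    _ ≤ ∑ c ∈ O, #{g : G | g • a = c} := sum_le_sum key
    _ = #{g : G | g • a ∈ O} := by
        rw [card_eq_sum_card_fiberwise (s := {g : G | g • a ∈ O}) (f := fun g => g • a) (t := O)]
        · refine sum_congr rfl fun c hc => ?_
          congr 1; ext g; simp only [mem_filter, mem_univ, true_and]
          exact ⟨fun h => ⟨h ▸ hc, h⟩, fun h => h.2⟩
        · intro g hg; simpa using hg
    _ ≤ Fintype.card G := card_le_univ _

variable {α : Type*} [Fintype α] [DecidableEq α]

open scoped Pointwise

lemma exists_perm_smul_eq {s t : Finset α} (h : #s = #t) : ∃ σ : Perm α, σ • s = t := by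
  have e : s ≃ t := Finset.equivOfCardEq h
  refine ⟨e.extendSubtype, ?_⟩
  refine eq_of_subset_of_card_le ?_ (by simp [h])
  intro z hz
  obtain ⟨w, hw, rfl⟩ := mem_smul_finset.1 hz
  exact Equiv.extendSubtype_mem e w hw

lemma Pr_smul_eq_le (a b : Finset α) :
    Pr (fun h : Perm α => h • a = b) ≤ 1 / (Fintype.card α).choose #a := by
  classical
  have h1 := card_smul_eq_mul_le (G := Perm α) a b (powersetCard #a univ)
    (fun c hc => exists_perm_smul_eq (mem_powersetCard.1 hc).2.symm)
  rw [card_powersetCard, card_univ, Fintype.card_perm] at h1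
  rw [Pr_eq_card, div_le_div_iff₀ (by exact_mod_cast Nat.factorial_pos _)
    (by exact_mod_cast Nat.choose_pos (card_le_univ a)), one_mul]
  convert (Nat.cast_le (α := ℝ)).2 h1 using 1
  push_cast
  congr!

/-- The expected number of `Y ∈ ℬ` whose image under a random `h` lies in `𝒜`. -/
lemma Ex_card_smul_mem_le (ℓ : ℕ) (𝒜 ℬ : Finset (Finset α)) (hB : ∀ Z ∈ ℬ, #Z = ℓ) :
    Ex (fun h : Perm α => (#{Y ∈ ℬ | h • Y ∈ 𝒜} : ℝ)) ≤
      #𝒜 * #ℬ / (Fintype.card α).choose ℓ := by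
  classical
  have h1 : ∀ h : Perm α, (#{Y ∈ ℬ | h • Y ∈ 𝒜} : ℝ) =
      ∑ Y ∈ ℬ, ∑ Z ∈ 𝒜, if h • Y = Z then 1 else 0 := by
    intro h
    simp
  simp_rw [h1]
  calc Ex (fun h : Perm α => ∑ Y ∈ ℬ, ∑ Z ∈ 𝒜, if h • Y = Z then (1 : ℝ) else 0)
      = ∑ Y ∈ ℬ, ∑ Z ∈ 𝒜, Pr (fun h : Perm α => h • Y = Z) := by
        rw [Ex_sum]
        refine sum_congr rfl fun Y _ => ?_
        rw [Ex_sum]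
        refine sum_congr rfl fun Z _ => ?_
        unfold Pr; congr! 
    _ ≤ ∑ Y ∈ ℬ, ∑ Z ∈ 𝒜, (1 / (Fintype.card α).choose ℓ : ℝ) := by
        refine sum_le_sum fun Y hY => sum_le_sum fun Z _ => ?_
        simpa [hB Y hY] using Pr_smul_eq_le Y Z
    _ = _ := by simp; ring

end Counting
end FixedOrder

namespace FixedOrder
open Equiv Finset

section Jordan
variable {α : Type*} [Fintype α] [DecidableEq α]

open MulAction in
/-- A primitive permutation group containing a prime cycle that moves fewer than a third of the
points contains the alternating group (a case of a theorem of Jordan). -/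
theorem alternatingGroup_le_of_isPreprimitive_of_prime_cycle {G : Subgroup (Perm α)}
    (hG : IsPreprimitive G α) {p : ℕ} (hp : p.Prime) {c : Perm α} (hc : c ∈ G)
    (hcyc : c.IsCycle) (hcard : #c.support = p) (hlt : 3 * p < Fintype.card α) :
    alternatingGroup α ≤ G := by
  have hp2 := hp.two_le
  have hcompl : #(c.supportᶜ) = Fintype.card α - p := by rw [card_compl, hcard]
  have hmult : IsMultiplyPretransitive G α p := by
    obtain ⟨k, hk⟩ : ∃ k, Fintype.card α - p = k + 1 := ⟨Fintype.card α - p - 1, by omega⟩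
    have h1 : IsMultiplyPreprimitive G α (k + 2) := by
      apply hG.isMultiplyPreprimitive (s := (c.supportᶜ : Set α))
      · rw [← coe_compl, Set.ncard_coe_finset, hcompl, hk]
      · rw [Nat.card_eq_fintype_card]; omega
      have := Perm.isPretransitive_of_isCycle_mem hcyc hc
      apply IsPreprimitive.of_prime_card
      convert! hp
      rw [← hcard, ← Fintype.card_coe, ← Nat.card_eq_fintype_card]
      apply Nat.card_congr
      exact Equiv.subtypeEquivRight fun x => by simp [SubMulAction.mem_ofFixingSubgroup_iff]
    have h2 : IsMultiplyPretransitive G α (k + 2) := IsMultiplyPreprimitive.isMultiplyPretransitive ..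
    apply isMultiplyPretransitive_of_le (n := k + 2) (by omega)
    rw [Nat.card_eq_fintype_card]
    omega
  obtain ⟨a, ha⟩ := card_pos.1 (show 0 < #c.support by omega)
  have e : Fin p ≃ c.support := (Finset.equivFinOfCardEq hcard).symm
  obtain ⟨t⟩ : Nonempty (Fin p ↪ (c.supportᶜ : Finset α)) := by
    apply Function.Embedding.nonempty_of_card_le
    simp only [Fintype.card_fin, Fintype.card_coe]
    omega
  let u : Fin p ↪ α := e.toEmbedding.trans (Function.Embedding.subtype _)
  have hu : ∀ i, c (u i) ≠ u i := fun i => Perm.mem_support.1 (e i).2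
  have ht : ∀ i, c (t i) = t i := fun i => by
    have := mem_compl.1 (t i).2
    rwa [Perm.mem_support, not_not] at this
  let v : Fin p ↪ α := ⟨fun i => if u i = a then a else t i, by
    intro i j hij
    have hai := hu i
    have haj := hu j
    dsimp only at hij
    split_ifs at hij with h1 h2 h2
    · exact u.injective (h1.trans h2.symm)
    · have := ht j; rw [← hij, ← h1] at this; exact absurd this hai
    · have := ht i; rw [hij, ← h2] at this; exact absurd this haj
    · exact t.injective (Subtype.ext hij)⟩
  have hv : ∀ i, v i = if u i = a then a else (t i : α) := fun _ => rfl
  obtain ⟨g, hg⟩ := exists_smul_eq G u v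
  have hgu : ∀ i, (g : Perm α) (u i) = v i := fun i => by
    rw [← hg]; rfl
  set c' : Perm α := g * c * (g : Perm α)⁻¹ with hc'
  have hc'G : c' ∈ G := G.mul_mem (G.mul_mem g.2 hc) (G.inv_mem g.2)
  have hfix : ∀ z ∈ c.support, z ≠ a → c' z = z := by
    intro z hz hza
    by_contra hne
    have h1 : (g : Perm α)⁻¹ z ∈ c.support := by
      rw [Perm.mem_support]
      intro h
      apply hne
      simp only [hc', Perm.mul_apply, h]; simp
    obtain ⟨i, hi⟩ := e.surjective ⟨_, h1⟩
    have h2 : u i = (g : Perm α)⁻¹ z := congrArg Subtype.val hi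
    have h3 : v i = z := by rw [← hgu, h2]; simp
    rw [hv] at h3
    split_ifs at h3 with h
    · exact hza h3.symm
    · exact Perm.mem_support.1 hz (h3 ▸ ht i)
  have hmova : c' a ≠ a := by
    obtain ⟨i, hi⟩ := e.surjective ⟨a, ha⟩
    have h2 : u i = a := congrArg Subtype.val hi
    have h3 : (g : Perm α) a = a := by
      rw [← h2, hgu, hv, if_pos h2, h2]
    have h4 : (g : Perm α)⁻¹ a = a := by rw [Perm.inv_eq_iff_eq, h3]
    simp only [hc', Perm.mul_apply, h4]
    intro h
    rw [← h3, (g : Perm α).apply_eq_iff_eq, h3] at h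
    exact Perm.mem_support.1 ha h
  have hc'a : c (c' a) = c' a := by
    by_contra hne
    have hmem : c' a ∈ c.support := Perm.mem_support.2 hne
    exact hmova (c'.injective (hfix _ hmem hmova))
  set τ : Perm α := swap a (c' a) with hτ
  have hdisj : Perm.Disjoint c (τ * c') := by
    intro z
    by_cases hz : c z = z
    · exact Or.inl hz
    · right
      rw [Perm.mul_apply]
      by_cases hza : z = a
      · rw [hza, hτ, swap_apply_right]
      · rw [hfix z (Perm.mem_support.2 hz) hza, hτ, swap_apply_of_ne_of_ne hza]
        rintro rfl
        exact hz hc'a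
  have hcomm : c * c' * c⁻¹ * c'⁻¹ = c * τ * c⁻¹ * τ⁻¹ := by
    have h1 : c * (τ * c') = (τ * c') * c := hdisj.commute.eq
    have h2 : τ * τ = 1 := by simp [hτ]
    have h3 : τ⁻¹ = τ := by simp [hτ]
    have h4 : c' = τ * (τ * c') := by rw [← mul_assoc, h2, one_mul]
    generalize hE : τ * c' = E at *
    rw [h4, mul_inv_rev]
    have h5 : E * c⁻¹ * E⁻¹ = c⁻¹ := by
      have : E * c⁻¹ = c⁻¹ * E := ((show Commute c E from h1).inv_left).eq.symm
      rw [this]; simp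
    calc c * (τ * E) * c⁻¹ * (E⁻¹ * τ⁻¹) = c * τ * (E * c⁻¹ * E⁻¹) * τ⁻¹ := by group
      _ = _ := by rw [h5]
  have hca : c a ≠ a := Perm.mem_support.1 ha
  have hcac' : c a ≠ c' a := fun h => hca (c.injective (by rw [h, hc'a]))
  have h3 : (c * c' * c⁻¹ * c'⁻¹).IsThreeCycle := by
    have : c * τ * c⁻¹ * τ⁻¹ = swap (c' a) (c a) * swap (c' a) a := by
      rw [hτ, swap_comm (c' a) a, swap_inv, ← Equiv.swap_apply_apply, hc'a, swap_comm (c a)]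
    rw [hcomm, this]
    exact Perm.isThreeCycle_swap_mul_swap_same hcac'.symm hmova hca
  exact Perm.alternatingGroup_le_of_isPreprimitive_of_isThreeCycle_mem hG h3
    (G.mul_mem (G.mul_mem (G.mul_mem hc hc'G) (G.inv_mem hc)) (G.inv_mem hc'G))

end Jordan
end FixedOrder

namespace FixedOrder
open Equiv Finset

section Blocks
variable {α : Type*} [Fintype α] [DecidableEq α]

open MulAction Pointwise in
lemma le_ncard_of_isBlock_of_prime_cycle {G : Subgroup (Perm α)} [IsPretransitive G α]
    {p : ℕ} (hp : p.Prime) {c : Perm α} (hc : c ∈ G) (hcyc : c.IsCycle)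
    (hcard : #c.support = p) {B : Set α} (hB : IsBlock G B) (hnt : B.Nontrivial) :
    p ≤ B.ncard := by
  obtain ⟨a, ha⟩ := card_pos.1 (show 0 < #c.support by have := hp.pos; omega)
  obtain ⟨b, hb⟩ := hnt.nonempty
  obtain ⟨g, hg⟩ := exists_smul_eq G b a
  set B' : Set α := g • B with hB'
  have hblock : IsBlock G B' := hB.translate g
  have haB : a ∈ B' := ⟨b, hb, hg⟩
  have hcard' : B'.ncard = B.ncard := Set.ncard_smul_set g B
  obtain ⟨z, hz, hza⟩ : ∃ z ∈ B', z ≠ a := by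
    have : B'.Nontrivial := hnt.image (MulAction.injective g)
    exact this.exists_ne a
  let c' : G := ⟨c, hc⟩
  have hord : orderOf c = p := by rw [hcyc.orderOf, hcard]
  have hcB : c' • B' = B' := by
    by_cases hzs : z ∈ c.support
    · obtain ⟨i, hi⟩ := hcyc.exists_pow_eq (Perm.mem_support.1 ha) (Perm.mem_support.1 hzs)
      have h1 : c' ^ i • B' = B' := by
        apply hblock.smul_eq_of_mem haB
        change ((c' ^ i : G) : Perm α) a ∈ B'
        simpa [c', hi] using hz
      have h2 : i.Coprime p := by
        rw [Nat.coprime_comm, hp.coprime_iff_not_dvd]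
        intro hd
        rw [← hord] at hd
        rw [orderOf_dvd_iff_pow_eq_one.1 hd] at hi
        exact hza hi.symm
      obtain ⟨j, hj⟩ : ∃ j, (c ^ i) ^ j = c := exists_pow_eq_self_of_coprime (by rwa [hord])
      have hj' : (c' ^ i) ^ j = c' := Subtype.ext (by simpa [c'] using hj)
      have h3 : c' ^ i ∈ stabilizer G B' := h1
      rw [← hj']
      exact (stabilizer G B').pow_mem h3 j
    · apply hblock.smul_eq_of_mem hz
      have : c' • z = z := by
        rw [Perm.mem_support, not_not] at hzs
        exact hzs
      rwa [this]
  have hsub : (c.support : Set α) ⊆ B' := by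
    intro w hw
    obtain ⟨i, rfl⟩ := hcyc.exists_pow_eq (Perm.mem_support.1 ha)
      (Perm.mem_support.1 (mem_coe.1 hw))
    have h1 : c' ^ i • B' = B' := (stabilizer G B').pow_mem (show c' ∈ stabilizer G B' from hcB) i
    rw [← h1]
    exact ⟨a, haB, by simp [c', Subgroup.smul_def]⟩
  rw [← hcard', ← hcard, ← Set.ncard_coe_finset]
  exact Set.ncard_le_ncard hsub

open MulAction Pointwise in
lemma exists_labelling_of_isBlock {G : Subgroup (Perm α)} [IsPretransitive G α]
    {B : Set α} (hB : IsBlock G B) (hne : B.Nonempty) :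
    ∃ (r : ℕ) (φ : α → Fin r), r * B.ncard = Fintype.card α ∧
      (∀ j, #{a | φ a = j} = B.ncard) ∧ ∀ g ∈ G, ∃ σ : Perm (Fin r), ∀ a, φ (g a) = σ (φ a) := by
  classical
  have : Finite (orbit G B) := Set.toFinite _
  have hex : ∀ a : α, ∃ q : orbit G B, a ∈ q.1 := by
    intro a
    obtain ⟨b, hb⟩ := hne
    obtain ⟨g, hg⟩ := exists_smul_eq G b a
    exact ⟨⟨g • B, g, rfl⟩, b, hb, hg⟩
  have huniq : ∀ (a : α) (q q' : orbit G B), a ∈ q.1 → a ∈ q'.1 → q = q' := by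
    rintro a ⟨_, g, rfl⟩ ⟨_, g', rfl⟩ h h'
    apply Subtype.ext
    exact hB.smul_eq_smul_of_nonempty ⟨a, h, h'⟩
  choose ψ hψ using hex
  have hiff : ∀ a q, ψ a = q ↔ a ∈ q.1 :=
    fun a q => ⟨fun h => h ▸ hψ a, fun h => huniq a _ _ (hψ a) h⟩
  obtain ⟨e⟩ : Nonempty (orbit G B ≃ Fin (Nat.card (orbit G B))) := ⟨Finite.equivFin _⟩
  refine ⟨Nat.card (orbit G B), fun a => e (ψ a), ?_, ?_, ?_⟩
  · rw [Nat.card_coe_set_eq, mul_comm, hB.ncard_block_mul_ncard_orbit_eq hne,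
      Nat.card_eq_fintype_card]
  · intro j
    obtain ⟨q, rfl⟩ := e.surjective j
    have h1 : q.1.ncard = B.ncard := by
      obtain ⟨_, g, rfl⟩ := q
      exact Set.ncard_smul_set g B
    rw [← h1, ← Set.ncard_coe_finset]
    congr 1
    ext a
    rw [mem_coe, mem_filter, ← hiff]
    exact ⟨fun h => e.injective h.2, fun h => ⟨mem_univ _, congrArg e h⟩⟩
  · intro g hg
    refine ⟨e.symm.trans ((MulAction.toPerm (⟨g, hg⟩ : G)).trans e), fun a => ?_⟩
    simp only [Equiv.trans_apply, e.symm_apply_apply, toPerm_apply]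
    refine congrArg e ?_
    rw [hiff]
    exact ⟨a, hψ a, rfl⟩

end Blocks
end FixedOrder

namespace FixedOrder
open Equiv Finset

section Cycles
variable {α : Type*} [Fintype α] [DecidableEq α]

/-- The length of the cycle of `g` through `a`. -/
noncomputable def per (g : Perm α) (a : α) : ℕ := Function.minimalPeriod g a

open Classical in
/-- The cycle of `g` through `a`. -/
noncomputable def cyc (g : Perm α) (a : α) : Finset α := {b | g.SameCycle a b}

/-- The first `ℓ` points of the `g`-orbit of `a`. -/
def path (g : Perm α) (a : α) (ℓ : ℕ) : Finset α := (range ℓ).image fun i => (g ^ i) a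

lemma pow_apply_eq_iterate (g : Perm α) (i : ℕ) (a : α) : (g ^ i) a = g^[i] a := by
  rw [Perm.iterate_eq_pow]

lemma per_pos (g : Perm α) (a : α) : 0 < per g a :=
  Function.minimalPeriod_pos_of_mem_periodicPts
    (Function.Injective.mem_periodicPts g.injective a)

lemma pow_apply_eq_self_iff {g : Perm α} {a : α} {i : ℕ} : (g ^ i) a = a ↔ per g a ∣ i := by
  rw [pow_apply_eq_iterate]
  exact Function.isPeriodicPt_iff_minimalPeriod_dvd

lemma pow_per (g : Perm α) (a : α) : (g ^ per g a) a = a := pow_apply_eq_self_iff.2 dvd_rfl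

lemma pow_mod_per (g : Perm α) (a : α) (i : ℕ) : (g ^ (i % per g a)) a = (g ^ i) a := by
  rw [pow_apply_eq_iterate, pow_apply_eq_iterate, per, Function.iterate_mod_minimalPeriod_eq]

lemma mem_cyc {g : Perm α} {a b : α} : b ∈ cyc g a ↔ ∃ i : ℕ, (g ^ i) a = b := by
  simp only [cyc, mem_filter, mem_univ, true_and]
  exact ⟨fun h => by obtain ⟨i, -, hi⟩ := h.exists_pow_eq'; exact ⟨i, hi⟩,
    fun ⟨i, hi⟩ => ⟨i, by simpa using hi⟩⟩

lemma cyc_eq_path (g : Perm α) (a : α) : cyc g a = path g a (per g a) := by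
  ext b
  simp only [mem_cyc, path, mem_image, mem_range]
  constructor
  · rintro ⟨i, rfl⟩
    exact ⟨i % per g a, Nat.mod_lt _ (per_pos g a), pow_mod_per g a i⟩
  · rintro ⟨i, -, h⟩
    exact ⟨i, h⟩

lemma pow_injOn_per (g : Perm α) (a : α) :
    Set.InjOn (fun i => (g ^ i) a) (Set.Iio (per g a)) := by
  intro i hi j hj h
  simp only [pow_apply_eq_iterate] at h
  exact Function.iterate_injOn_Iio_minimalPeriod hi hj h

lemma card_cyc (g : Perm α) (a : α) : #(cyc g a) = per g a := by
  rw [cyc_eq_path, path, card_image_of_injOn, card_range]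
  simpa [Set.Iio] using pow_injOn_per g a

lemma self_mem_cyc (g : Perm α) (a : α) : a ∈ cyc g a := mem_cyc.2 ⟨0, rfl⟩

lemma mem_cyc_comm {g : Perm α} {a b : α} : b ∈ cyc g a ↔ a ∈ cyc g b := by
  simp only [cyc, mem_filter, mem_univ, true_and]
  exact Perm.sameCycle_comm

lemma cyc_eq_of_mem {g : Perm α} {a b : α} (h : b ∈ cyc g a) : cyc g b = cyc g a := by
  simp only [cyc, mem_filter, mem_univ, true_and] at h
  ext c
  simp only [cyc, mem_filter, mem_univ, true_and]
  exact ⟨h.trans, h.symm.trans⟩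

lemma per_eq_of_mem {g : Perm α} {a b : α} (h : b ∈ cyc g a) : per g b = per g a := by
  rw [← card_cyc, ← card_cyc, cyc_eq_of_mem h]

lemma apply_mem_cyc_iff {g : Perm α} {a b : α} : g b ∈ cyc g a ↔ b ∈ cyc g a := by
  simp [cyc]

lemma apply_mem_cyc {g : Perm α} {a b : α} (h : b ∈ cyc g a) : g b ∈ cyc g a :=
  apply_mem_cyc_iff.2 h

lemma pow_mem_cyc (g : Perm α) (a : α) (i : ℕ) : (g ^ i) a ∈ cyc g a := mem_cyc.2 ⟨i, rfl⟩

lemma disjoint_cyc {g : Perm α} {a b : α} (h : b ∉ cyc g a) : Disjoint (cyc g a) (cyc g b) := by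
  rw [disjoint_left]
  intro c hc hc'
  exact h (by rw [← cyc_eq_of_mem hc, cyc_eq_of_mem hc']; exact self_mem_cyc g b)

lemma per_le_card (g : Perm α) (a : α) : per g a ≤ Fintype.card α := by
  rw [← card_cyc]; exact card_le_univ _

lemma pow_eq_of_agree {g g' : Perm α} {a : α} {ℓ : ℕ}
    (h : ∀ i, i + 1 < ℓ → g' ((g ^ i) a) = g ((g ^ i) a)) :
    ∀ i, i < ℓ → (g' ^ i) a = (g ^ i) a := by
  intro i
  induction i with
  | zero => intro _; rfl
  | succ i ih =>
    intro hi
    rw [pow_succ', pow_succ', Perm.mul_apply, Perm.mul_apply, ih (by omega), h i hi]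

lemma cyc_eq_of_agree {g g' : Perm α} {a : α} (h : ∀ z ∈ cyc g a, g' z = g z) :
    cyc g' a = cyc g a := by
  have key : ∀ i : ℕ, (g' ^ i) a = (g ^ i) a :=
    fun i => pow_eq_of_agree (ℓ := i + 1) (fun j _ => h _ (pow_mem_cyc g a j)) i (by omega)
  ext b
  simp [mem_cyc, key]

lemma per_eq_of_agree {g g' : Perm α} {a : α} (h : ∀ z ∈ cyc g a, g' z = g z) :
    per g' a = per g a := by
  rw [← card_cyc, ← card_cyc, cyc_eq_of_agree h]

/-- If no other cycle of `g` has length divisible by the prime `p`, then a `p`-cycle of `g` is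
a power of `g`. -/
lemma exists_pow_isCycle {g : Perm α} {a : α} {p : ℕ} (hp : p.Prime) (ha : per g a = p)
    (h : ∀ b, b ∉ cyc g a → ¬ p ∣ per g b) :
    ∃ k : ℕ, (g ^ k).IsCycle ∧ #(g ^ k).support = p := by
  set k := ∏ b ∈ (cyc g a)ᶜ, per g b with hk
  have hcop : Nat.Coprime p k := by
    apply Nat.Coprime.prod_right
    intro b hb
    exact hp.coprime_iff_not_dvd.2 (h b (mem_compl.1 hb))
  have hfix : ∀ b, b ∉ cyc g a → (g ^ k) b = b := fun b hb =>
    pow_apply_eq_self_iff.2 (dvd_prod_of_mem _ (mem_compl.2 hb))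
  have hmov : (g ^ k) a ≠ a := by
    rw [Ne, pow_apply_eq_self_iff, ha]
    exact fun hd => hp.one_lt.ne' (Nat.Coprime.eq_one_of_dvd hcop hd)
  have hcyc : (g ^ k).IsCycle := by
    refine ⟨a, hmov, fun b hb => ?_⟩
    have hb' : b ∈ cyc g a := by by_contra h'; exact hb (hfix b h')
    obtain ⟨i, rfl⟩ := mem_cyc.1 hb'
    obtain ⟨j, hj⟩ := Nat.exists_mul_mod_eq_of_coprime (n := k) (k := p) i hcop.symm hp.ne_zero
    refine ⟨j, ?_⟩
    rw [zpow_natCast, ← pow_mul, ← pow_mod_per, ha, ← pow_mod_per g a i, ha]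
    rw [hj.2]
  refine ⟨k, hcyc, ?_⟩
  rw [← hcyc.orderOf]
  have := Fact.mk hp
  apply orderOf_eq_prime
  · ext b
    rw [← pow_mul, Perm.one_apply, pow_apply_eq_self_iff]
    by_cases hb : b ∈ cyc g a
    · rw [per_eq_of_mem hb, ha]; exact dvd_mul_left _ _
    · exact (pow_apply_eq_self_iff.1 (hfix b hb)).trans (dvd_mul_right _ _)
  · intro h1
    exact hmov (by rw [h1]; rfl)

end Cycles
end FixedOrder

namespace FixedOrder
open Equiv Finset
open scoped Pointwise

section NearInvariant
variable {α : Type*} [Fintype α] [DecidableEq α]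

/-- The set of cycles of `x`, fixed points included. -/
noncomputable def cycles (x : Perm α) : Finset (Finset α) := univ.image (cyc x)

lemma sum_cycles (x : Perm α) (F : ℕ → ℝ) :
    ∑ c ∈ cycles x, F #c = ∑ i, F (per x i) / per x i := by
  have h := sum_fiberwise_of_maps_to (s := (univ : Finset α)) (t := cycles x) (g := cyc x)
    (fun i _ => mem_image_of_mem _ (mem_univ i)) (fun i => F (per x i) / per x i)
  rw [← h]
  refine sum_congr rfl fun c hc => ?_
  obtain ⟨a, -, rfl⟩ := mem_image.1 hc
  have h1 : ∀ i ∈ ({i | cyc x i = cyc x a} : Finset α),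
      F (per x i) / per x i = F (per x a) / per x a := by
    intro i hi
    have : cyc x i = cyc x a := (mem_filter.1 hi).2
    rw [← card_cyc, ← card_cyc, this]
  have h2 : ({i | cyc x i = cyc x a} : Finset α) = cyc x a := by
    ext i
    simp only [mem_filter, mem_univ, true_and]
    exact ⟨fun h => h ▸ self_mem_cyc x i, fun h => cyc_eq_of_mem h⟩
  rw [sum_congr rfl h1, h2, sum_const, card_cyc, nsmul_eq_mul]
  have := per_pos x a
  field_simp

lemma smul_eq_self_of_forall_mem {x : Perm α} {Z : Finset α} (h : ∀ a ∈ Z, x a ∈ Z) :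
    x • Z = Z := by
  apply eq_of_subset_of_card_le
  · intro b hb
    obtain ⟨a, ha, rfl⟩ := mem_smul_finset.1 hb
    exact h a ha
  · rw [card_smul_finset]

lemma apply_mem_of_smul_eq {x : Perm α} {Z : Finset α} (h : x • Z = Z) {a : α} :
    x a ∈ Z ↔ a ∈ Z := by
  conv_lhs => rw [← h]
  exact smul_mem_smul_finset_iff x

lemma cyc_subset_of_smul_eq {x : Perm α} {Z : Finset α} (h : x • Z = Z) {a : α} (ha : a ∈ Z) :
    cyc x a ⊆ Z := by
  intro b hb
  obtain ⟨i, rfl⟩ := mem_cyc.1 hb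
  induction i with
  | zero => exact ha
  | succ i ih =>
    rw [pow_succ', Perm.mul_apply, apply_mem_of_smul_eq h]
    exact ih (pow_mem_cyc x a i)

lemma smul_cyc (x : Perm α) (a : α) : x • cyc x a = cyc x a :=
  smul_eq_self_of_forall_mem fun _ => apply_mem_cyc

/-- The generating polynomial of the `x`-invariant sets. -/
noncomputable def invSum (x : Perm α) (z : ℝ) : ℝ :=
  ∑ Z : Finset α with x • Z = Z, z ^ #Z

lemma invSum_le {x : Perm α} {z : ℝ} (hz : 0 ≤ z) :
    invSum x z ≤ Real.exp (∑ i, Real.log (1 + z ^ per x i) / per x i) := by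
  have h1 : invSum x z ≤ ∑ S ∈ (cycles x).powerset, ∏ c ∈ S, z ^ #c := by
    let f : Finset α → Finset (Finset α) := fun Z => (cycles x).filter (· ⊆ Z)
    have hf : ∀ Z : Finset α, x • Z = Z → (f Z).biUnion id = Z := by
      intro Z hZ
      ext a
      simp only [f, mem_biUnion, mem_filter, id]
      refine ⟨fun ⟨c, hc, ha⟩ => hc.2 ha, fun ha => ⟨cyc x a, ⟨mem_image_of_mem _ (mem_univ a),
        cyc_subset_of_smul_eq hZ ha⟩, self_mem_cyc x a⟩⟩
    have hcard : ∀ Z : Finset α, x • Z = Z → z ^ #Z = ∏ c ∈ f Z, z ^ #c := by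
      intro Z hZ
      rw [prod_pow_eq_pow_sum]
      congr 1
      conv_lhs => rw [← hf Z hZ]
      rw [card_biUnion]
      · rfl
      · intro c hc c' hc' hne
        obtain ⟨a, -, rfl⟩ := mem_image.1 (mem_filter.1 hc).1
        obtain ⟨b, -, rfl⟩ := mem_image.1 (mem_filter.1 hc').1
        apply disjoint_cyc
        intro hb
        exact hne (cyc_eq_of_mem hb).symm
    rw [invSum, sum_congr rfl fun Z hZ => hcard Z (mem_filter.1 hZ).2]
    rw [← sum_image (s := {Z : Finset α | x • Z = Z}) (g := f)
      (f := fun S => ∏ c ∈ S, z ^ #c)]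
    · apply sum_le_sum_of_subset_of_nonneg
      · intro S hS
        obtain ⟨Z, -, rfl⟩ := mem_image.1 hS
        exact mem_powerset.2 (filter_subset _ _)
      · intro S _ _
        positivity
    · intro Z hZ Z' hZ' h
      rw [← hf Z (by simpa using hZ), ← hf Z' (by simpa using hZ'), h]
  refine h1.trans ?_
  rw [← prod_one_add, ← sum_cycles x fun L => Real.log (1 + z ^ L), Real.exp_sum]
  refine prod_le_prod (fun c _ => by positivity) fun c _ => ?_
  rw [Real.exp_log (by positivity)]

lemma card_finset_card_le (s : ℕ) :
    #{Z : Finset α | #Z ≤ s} ≤ (Fintype.card α + 1) ^ s := by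
  have h1 : #(univ : Finset (Fin s → Option α)) = (Fintype.card α + 1) ^ s := by
    simp
  rw [← h1]
  apply card_le_card_of_surjOn (fun v => univ.filter fun a => ∃ i, v i = some a)
  intro Z hZ
  have hZ' : #Z ≤ s := by simpa using hZ
  obtain ⟨e⟩ : Nonempty (Z ↪ Fin s) := Function.Embedding.nonempty_of_card_le (by simpa using hZ')
  refine ⟨fun i => if h : ∃ a : Z, e a = i then some (h.choose : α) else none, mem_coe.2 (mem_univ _), ?_⟩
  ext a
  simp only [mem_filter, mem_univ, true_and]
  constructor
  · rintro ⟨i, hi⟩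
    split_ifs at hi with h
    · rw [← Option.some_inj.1 hi]; exact h.choose.2
  · intro ha
    refine ⟨e ⟨a, ha⟩, ?_⟩
    have h : ∃ b : Z, e b = e ⟨a, ha⟩ := ⟨_, rfl⟩
    rw [dif_pos h]
    congr 1
    exact congrArg Subtype.val (e.injective h.choose_spec)

/-- A set `Z` is determined by its `x`-boundary together with the union of the `x`-cycles it
contains. -/
lemma card_nearInvariant_le {x : Perm α} {z : ℝ} (hz : 0 < z) (hz1 : z ≤ 1) (ℓ s : ℕ) :
    (#{Z : Finset α | #Z = ℓ ∧ #(x • Z \ Z) ≤ s} : ℝ) ≤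
      (Fintype.card α + 1) ^ (2 * s) * (invSum x z * z⁻¹ ^ ℓ) := by
  let core : Finset α → Finset α := fun Z => {a | cyc x a ⊆ Z}
  have hcoresub : ∀ Z, core Z ⊆ Z := fun Z a ha => (mem_filter.1 ha).2 (self_mem_cyc x a)
  have hcoreinv : ∀ Z, x • core Z = core Z := by
    intro Z
    apply smul_eq_self_of_forall_mem
    intro a ha
    simp only [core, mem_filter, mem_univ, true_and] at ha ⊢
    rwa [cyc_eq_of_mem (apply_mem_cyc (self_mem_cyc x a))]
  let P : Finset (Finset α) := {Z | #Z ≤ s}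
  let C : Finset (Finset α) := {Z | x • Z = Z ∧ #Z ≤ ℓ}
  have h1 : #{Z : Finset α | #Z = ℓ ∧ #(x • Z \ Z) ≤ s} ≤ #(P ×ˢ P ×ˢ C) := by
    apply card_le_card_of_injOn (fun Z => (x • Z \ Z, Z \ x • Z, core Z))
    · intro Z hZ
      simp only [coe_filter, mem_univ, true_and, Set.mem_ofPred_eq] at hZ
      have h2 : #(Z \ x • Z) = #(x • Z \ Z) := by
        apply card_sdiff_comm; rw [card_smul_finset]
      simp only [P, C, coe_product, Set.mem_prod, mem_coe, mem_filter, mem_univ, true_and]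
      exact ⟨hZ.2, h2.trans_le hZ.2, hcoreinv Z, (card_le_card (hcoresub Z)).trans hZ.1.le⟩
    · have key : ∀ Z Z' : Finset α, x • Z \ Z = x • Z' \ Z' → Z \ x • Z = Z' \ x • Z' →
          core Z = core Z' → Z ⊆ Z' := by
        intro Z Z' e1 e2 e3 w hw
        by_contra hw'
        have hstep : ∀ i : ℕ, (x ^ i) w ∈ Z ∧ (x ^ i) w ∉ Z' := by
          intro i
          induction i with
          | zero => exact ⟨hw, hw'⟩
          | succ i ih =>
            rw [pow_succ', Perm.mul_apply]
            have m1 : x ((x ^ i) w) ∈ x • Z := (smul_mem_smul_finset_iff x).2 ih.1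
            have m2 : x ((x ^ i) w) ∉ x • Z' := fun h => ih.2 ((smul_mem_smul_finset_iff x).1 h)
            constructor
            · by_contra h
              have := mem_sdiff.2 ⟨m1, h⟩
              rw [e1] at this
              exact m2 (mem_sdiff.1 this).1
            · intro h
              have := mem_sdiff.2 ⟨h, m2⟩
              rw [← e2] at this
              exact (mem_sdiff.1 this).2 m1
        have : w ∈ core Z := by
          simp only [core, mem_filter, mem_univ, true_and]
          intro b hb
          obtain ⟨i, rfl⟩ := mem_cyc.1 hb
          exact (hstep i).1
        rw [e3] at this
        exact hw' (hcoresub _ this)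
      intro Z _ Z' _ h
      simp only [Prod.mk.injEq] at h
      exact (key Z Z' h.1 h.2.1 h.2.2).antisymm (key Z' Z h.1.symm h.2.1.symm h.2.2.symm)
  have h3 : (#C : ℝ) ≤ invSum x z * z⁻¹ ^ ℓ := by
    rw [invSum, sum_mul, card_eq_sum_ones, Nat.cast_sum]
    refine (sum_le_sum (fun Z hZ => ?_)).trans (sum_le_sum_of_subset_of_nonneg (f := fun Z =>
      z ^ #Z * z⁻¹ ^ ℓ) (t := ({Z | x • Z = Z} : Finset (Finset α))) ?_ ?_)
    · have hZ' : #Z ≤ ℓ := (mem_filter.1 hZ).2.2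
      rw [Nat.cast_one, inv_pow, ← div_eq_mul_inv, one_le_div (by positivity)]
      exact pow_le_pow_of_le_one hz.le hz1 hZ'
    · intro Z hZ
      simp only [C, mem_filter] at hZ ⊢
      exact ⟨hZ.1, hZ.2.1⟩
    · intro Z _ _
      positivity
  have h4 : (#P : ℝ) ≤ (Fintype.card α + 1) ^ s := by
    exact_mod_cast card_finset_card_le (α := α) s
  calc (#{Z : Finset α | #Z = ℓ ∧ #(x • Z \ Z) ≤ s} : ℝ) ≤ #(P ×ˢ P ×ˢ C) := by exact_mod_cast h1
    _ = #P * (#P * #C) := by simp [card_product]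
    _ ≤ (Fintype.card α + 1) ^ s * ((Fintype.card α + 1) ^ s * (invSum x z * z⁻¹ ^ ℓ)) := by
        gcongr
    _ = _ := by rw [two_mul, pow_add]; ring

/-- Invariant sets through a point on a cycle of length at least `3`. -/
lemma card_invariant_long_le {x : Perm α} {z : ℝ} (hz : 0 < z) (hz1 : z ≤ 1) (ℓ : ℕ) :
    (#{Z : Finset α | #Z = ℓ ∧ x • Z = Z ∧ ∃ i ∈ Z, 3 ≤ per x i} : ℝ) ≤
      Fintype.card α * z ^ 3 * (invSum x z * z⁻¹ ^ ℓ) := by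
  have h1 : ∀ i : α, 3 ≤ per x i → (#{Z : Finset α | #Z = ℓ ∧ x • Z = Z ∧ i ∈ Z} : ℝ) ≤
      z ^ 3 * (invSum x z * z⁻¹ ^ ℓ) := by
    intro i hi
    rw [invSum, mul_comm (z ^ 3), mul_assoc, sum_mul, card_eq_sum_ones, Nat.cast_sum]
    refine (sum_le_sum (fun Z hZ => ?_)).trans ((sum_image (f := fun Z =>
      z ^ #Z * (z⁻¹ ^ ℓ * z ^ 3)) (g := fun Z => Z \ cyc x i) ?_).symm.trans_le
      (sum_le_sum_of_subset_of_nonneg (t := ({Z | x • Z = Z} : Finset (Finset α))) ?_ ?_))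
    · obtain ⟨h1, h2, h3⟩ := (mem_filter.1 hZ).2
      have hsub := cyc_subset_of_smul_eq h2 h3
      have h4 : #(Z \ cyc x i) + per x i = ℓ := by
        rw [← card_cyc, card_sdiff_add_card_eq_card hsub, h1]
      rw [Nat.cast_one, ← h4, inv_pow, pow_add]
      have : z ^ per x i ≤ z ^ 3 := pow_le_pow_of_le_one hz.le hz1 hi
      rw [show z ^ #(Z \ cyc x i) * ((z ^ #(Z \ cyc x i) * z ^ per x i)⁻¹ * z ^ 3) =
        z ^ 3 / z ^ per x i by field_simp]
      rwa [one_le_div (by positivity)]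
    · intro Z hZ Z' hZ' h
      obtain ⟨-, h2, h3⟩ := (mem_filter.1 (mem_coe.1 hZ)).2
      obtain ⟨-, h2', h3'⟩ := (mem_filter.1 (mem_coe.1 hZ')).2
      dsimp only at h
      rw [← sdiff_union_of_subset (cyc_subset_of_smul_eq h2 h3), h,
        sdiff_union_of_subset (cyc_subset_of_smul_eq h2' h3')]
    · intro W hW
      obtain ⟨Z, hZ, rfl⟩ := mem_image.1 hW
      obtain ⟨-, h2, -⟩ := (mem_filter.1 hZ).2
      simp only [mem_filter, mem_univ, true_and]
      rw [smul_finset_sdiff, h2, smul_cyc]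
    · intro Z _ _
      positivity
  have h2 : ({Z : Finset α | #Z = ℓ ∧ x • Z = Z ∧ ∃ i ∈ Z, 3 ≤ per x i} : Finset (Finset α)) ⊆
      ({i | 3 ≤ per x i} : Finset α).biUnion fun i => {Z | #Z = ℓ ∧ x • Z = Z ∧ i ∈ Z} := by
    intro Z hZ
    obtain ⟨-, h1, h2, i, hi, h3⟩ := mem_filter.1 hZ
    simp only [mem_biUnion, mem_filter, mem_univ, true_and]
    exact ⟨i, h3, h1, h2, hi⟩
  have hnn : 0 ≤ z ^ 3 * (invSum x z * z⁻¹ ^ ℓ) := by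
    have : 0 ≤ invSum x z := sum_nonneg fun _ _ => by positivity
    positivity
  calc _ ≤ ((∑ i with 3 ≤ per x i, #{Z : Finset α | #Z = ℓ ∧ x • Z = Z ∧ i ∈ Z} : ℕ) : ℝ) := by
        exact_mod_cast (card_le_card h2).trans card_biUnion_le
    _ ≤ ∑ i with 3 ≤ per x i, z ^ 3 * (invSum x z * z⁻¹ ^ ℓ) := by
        rw [Nat.cast_sum]
        exact sum_le_sum fun i hi => h1 i (mem_filter.1 hi).2
    _ ≤ ∑ i : α, z ^ 3 * (invSum x z * z⁻¹ ^ ℓ) :=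
        sum_le_sum_of_subset_of_nonneg (filter_subset _ _) fun _ _ _ => hnn
    _ = _ := by simp; ring

end NearInvariant
end FixedOrder

namespace FixedOrder
open Equiv Finset
open scoped Pointwise

section Analytic

lemma factorial_mul_exp_le {k : ℕ} (hk : 0 < k) :
    (k.factorial : ℝ) * Real.exp k ≤ Real.exp 1 * k * (k : ℝ) ^ k := by
  induction k, hk using Nat.le_induction with
  | base => simp
  | succ k hk ih =>
    have hk' : (0 : ℝ) < k := by exact_mod_cast hk
    have h1 : Real.exp 1 * (k : ℝ) ^ (k + 1) ≤ ((k : ℝ) + 1) ^ (k + 1) := by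
      have h2 : 1 / ((k : ℝ) + 1) ≤ Real.log ((k + 1) / k) := by
        have := Real.one_sub_inv_le_log_of_pos (x := ((k : ℝ) + 1) / k) (by positivity)
        refine le_trans (le_of_eq ?_) this
        field_simp
        ring
      have h3 : Real.exp 1 ≤ (((k : ℝ) + 1) / k) ^ (k + 1) := by
        rw [← Real.log_le_log_iff (Real.exp_pos 1) (by positivity), Real.log_exp, Real.log_pow]
        calc (1 : ℝ) = ((k + 1 : ℕ) : ℝ) * (1 / ((k : ℝ) + 1)) := by push_cast; field_simp
          _ ≤ _ := by gcongr
      rw [div_pow, le_div_iff₀ (by positivity)] at h3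
      exact h3
    calc ((k + 1).factorial : ℝ) * Real.exp ((k + 1 : ℕ) : ℝ)
        = (k + 1) * Real.exp 1 * (k.factorial * Real.exp k) := by
          rw [Nat.factorial_succ]; push_cast; rw [Real.exp_add]; ring
      _ ≤ (k + 1) * Real.exp 1 * (Real.exp 1 * k * (k : ℝ) ^ k) := by gcongr
      _ = (k + 1) * Real.exp 1 * (Real.exp 1 * (k : ℝ) ^ (k + 1)) := by ring
      _ ≤ (k + 1) * Real.exp 1 * ((k : ℝ) + 1) ^ (k + 1) := by gcongr
      _ = _ := by push_cast; ring

lemma pow_self_le_exp_mul_factorial (n : ℕ) : (n : ℝ) ^ n ≤ Real.exp n * n.factorial := by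
  have := Real.pow_div_factorial_le_exp (n : ℝ) (by positivity) n
  rwa [div_le_iff₀ (by positivity)] at this

lemma entropy_le_choose {ℓ k : ℕ} (hℓ : 0 < ℓ) (hk : 0 < k) :
    ((ℓ + k : ℕ) : ℝ) ^ (ℓ + k) ≤
      (ℓ + k).choose ℓ * (Real.exp 2 * ℓ * k) * ((ℓ : ℝ) ^ ℓ * (k : ℝ) ^ k) := by
  have h1 : (((ℓ + k).choose ℓ : ℕ) : ℝ) * ℓ.factorial * k.factorial = (ℓ + k).factorial := by
    have := Nat.choose_mul_factorial_mul_factorial (Nat.le_add_right ℓ k)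
    rw [Nat.add_sub_cancel_left] at this
    exact_mod_cast this
  calc ((ℓ + k : ℕ) : ℝ) ^ (ℓ + k) ≤ Real.exp ((ℓ + k : ℕ) : ℝ) * (ℓ + k).factorial :=
        pow_self_le_exp_mul_factorial _
    _ = (ℓ + k).choose ℓ * (ℓ.factorial * Real.exp ℓ) * (k.factorial * Real.exp k) := by
        rw [← h1]; push_cast; rw [Real.exp_add]; ring
    _ ≤ (ℓ + k).choose ℓ * (Real.exp 1 * ℓ * (ℓ : ℝ) ^ ℓ) * (Real.exp 1 * k * (k : ℝ) ^ k) := by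
        have := factorial_mul_exp_le hℓ
        have := factorial_mul_exp_le hk
        gcongr
    _ = _ := by rw [show (2 : ℝ) = 1 + 1 by norm_num, Real.exp_add]; ring

lemma entropy_le_choose_of_small {ℓ k : ℕ} (hℓ : 0 < ℓ) (hk : 0 < k) :
    ((ℓ + k : ℕ) : ℝ) ^ (ℓ + k) ≤
      (ℓ + k).choose ℓ * (Real.exp 1 * ℓ * Real.exp (ℓ ^ 2 / k)) * ((ℓ : ℝ) ^ ℓ * (k : ℝ) ^ k) := by
  have hk' : (0 : ℝ) < k := by exact_mod_cast hk
  have hr : ((ℓ + k : ℕ) : ℝ) ≤ k * Real.exp (ℓ / k) := by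
    have := Real.add_one_le_exp ((ℓ : ℝ) / k)
    calc ((ℓ + k : ℕ) : ℝ) = k * (ℓ / k + 1) := by push_cast; field_simp
      _ ≤ _ := by gcongr
  have h1 : ((ℓ + k : ℕ) : ℝ) ^ k ≤ (k : ℝ) ^ k * Real.exp ℓ := by
    calc ((ℓ + k : ℕ) : ℝ) ^ k ≤ (k * Real.exp (ℓ / k)) ^ k := by gcongr
      _ = _ := by rw [mul_pow, ← Real.exp_nat_mul]; congr 2; field_simp
  have h2 : ((ℓ + k : ℕ) : ℝ) ^ ℓ ≤ (k : ℝ) ^ ℓ * Real.exp (ℓ ^ 2 / k) := by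
    calc ((ℓ + k : ℕ) : ℝ) ^ ℓ ≤ (k * Real.exp (ℓ / k)) ^ ℓ := by gcongr
      _ = _ := by rw [mul_pow, ← Real.exp_nat_mul]; congr 2; field_simp
  have h3 : (k : ℝ) ^ ℓ ≤ (ℓ + k).choose ℓ * ℓ.factorial := by
    have h := Nat.pow_sub_le_descFactorial (ℓ + k) ℓ
    rw [Nat.descFactorial_eq_factorial_mul_choose, mul_comm] at h
    have h' : k ^ ℓ ≤ (ℓ + k + 1 - ℓ) ^ ℓ := Nat.pow_le_pow_left (by omega) ℓ
    exact_mod_cast h'.trans h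
  calc ((ℓ + k : ℕ) : ℝ) ^ (ℓ + k) = ((ℓ + k : ℕ) : ℝ) ^ ℓ * ((ℓ + k : ℕ) : ℝ) ^ k := pow_add _ _ _
    _ ≤ ((ℓ + k).choose ℓ * ℓ.factorial * Real.exp (ℓ ^ 2 / k)) * ((k : ℝ) ^ k * Real.exp ℓ) := by
        gcongr
        exact h2.trans (by gcongr)
    _ = (ℓ + k).choose ℓ * Real.exp (ℓ ^ 2 / k) * (k : ℝ) ^ k * (ℓ.factorial * Real.exp ℓ) := by ring
    _ ≤ (ℓ + k).choose ℓ * Real.exp (ℓ ^ 2 / k) * (k : ℝ) ^ k * (Real.exp 1 * ℓ * (ℓ : ℝ) ^ ℓ) := by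
        have := factorial_mul_exp_le hℓ
        gcongr
    _ = _ := by ring

lemma log_one_add_pow_div_le {z : ℝ} (hz : 0 < z) (hz1 : z ≤ 1) {L : ℕ} (hL : 0 < L) :
    Real.log (1 + z ^ L) / L ≤ Real.log (1 + z ^ 2) / 2 + (if L = 1 then z else 0) -
      (if 3 ≤ L then z ^ 2 / 12 else 0) := by
  rcases (by omega : L = 1 ∨ L = 2 ∨ 3 ≤ L) with rfl | rfl | h3
  · have h1 : Real.log (1 + z) * 2 ≤ Real.log (1 + z ^ 2) + 2 * z := by
      have h2 : (1 + z) ^ 2 ≤ (1 + z ^ 2) * Real.exp (2 * z) := by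
        have := Real.add_one_le_exp (2 * z)
        nlinarith [sq_nonneg z, pow_pos hz 3]
      have h3 := Real.log_le_log (by positivity) h2
      rw [Real.log_mul (by positivity) (by positivity), Real.log_exp, Real.log_pow] at h3
      push_cast at h3
      linarith
    norm_num
    linarith
  · norm_num
  · rw [if_neg (by omega), if_pos h3]
    have hL3 : (3 : ℝ) ≤ L := by exact_mod_cast h3
    have h1 : Real.log (1 + z ^ L) / L ≤ Real.log (1 + z ^ 2) / 3 := by
      have h0 : 0 ≤ Real.log (1 + z ^ 2) := Real.log_nonneg (by nlinarith [sq_nonneg z])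
      apply div_le_div₀ h0 _ (by norm_num) hL3
      apply Real.log_le_log (by positivity)
      have : z ^ L ≤ z ^ 2 := pow_le_pow_of_le_one hz.le hz1 (by omega)
      linarith
    have h2 : z ^ 2 / 2 ≤ Real.log (1 + z ^ 2) := by
      have := Real.le_log_one_add_of_nonneg (sq_nonneg z)
      refine le_trans ?_ this
      rw [div_le_div_iff₀ (by norm_num) (by positivity)]
      have : z ^ 2 ≤ 1 := pow_le_one₀ hz.le hz1
      nlinarith [sq_nonneg z]
    linarith

end Analytic

section NearInvariantBound
variable {α : Type*} [Fintype α] [DecidableEq α]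

/-- The number of fixed points. -/
def fixCount (x : Perm α) : ℕ := #{i | x i = i}

/-- The number of points on cycles of length at least `3`. -/
noncomputable def longCount (x : Perm α) : ℕ := #{i | 3 ≤ per x i}

lemma per_eq_one_iff {x : Perm α} {i : α} : per x i = 1 ↔ x i = i := by
  rw [← Nat.dvd_one, ← pow_apply_eq_self_iff, pow_one]

lemma invSum_le_exp {x : Perm α} {z : ℝ} (hz : 0 < z) (hz1 : z ≤ 1) :
    invSum x z ≤ Real.exp (Fintype.card α * (Real.log (1 + z ^ 2) / 2) + fixCount x * z -
      longCount x * (z ^ 2 / 12)) := by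
  refine (invSum_le hz.le).trans (Real.exp_le_exp.2 ?_)
  refine (sum_le_sum fun i _ => log_one_add_pow_div_le hz hz1 (per_pos x i)).trans (le_of_eq ?_)
  rw [sum_sub_distrib, sum_add_distrib, sum_const, card_univ, nsmul_eq_mul]
  simp only [per_eq_one_iff, ← sum_filter, sum_const, nsmul_eq_mul, fixCount, longCount]

/-- The exponent controlling the expected number of near invariant sets of size `ℓ`. -/
lemma invSum_mul_invSum_le {x y : Perm α} {ℓ k : ℕ} (hℓ : 0 < ℓ) (hℓk : ℓ ≤ k)
    (hn : ℓ + k = Fintype.card α) {z : ℝ} (hzdef : z = Real.sqrt (ℓ / k)) :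
    (invSum x z * z⁻¹ ^ ℓ) * (invSum y z * z⁻¹ ^ ℓ) ≤
      ((ℓ + k : ℕ) : ℝ) ^ (ℓ + k) / ((ℓ : ℝ) ^ ℓ * (k : ℝ) ^ k) *
      Real.exp ((fixCount x + fixCount y) * z - longCount y * (z ^ 2 / 12)) := by
  have hk : 0 < k := hℓ.trans_le hℓk
  have hℓ' : (0 : ℝ) < ℓ := by exact_mod_cast hℓ
  have hk' : (0 : ℝ) < k := by exact_mod_cast hk
  have hz2 : z ^ 2 = ℓ / k := by rw [hzdef, Real.sq_sqrt (by positivity)]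
  have hz : 0 < z := by rw [hzdef]; positivity
  have hz1 : z ≤ 1 := by
    rw [hzdef]
    refine Real.sqrt_le_one.2 ((div_le_one hk').2 ?_)
    exact_mod_cast hℓk
  have hX := invSum_le_exp (x := x) hz hz1
  have hY := invSum_le_exp (x := y) hz hz1
  have hX0 : 0 ≤ invSum x z := sum_nonneg fun _ _ => by positivity
  have hY0 : 0 ≤ invSum y z := sum_nonneg fun _ _ => by positivity
  have e1 : Real.exp ((ℓ + k : ℕ) * Real.log (1 + z ^ 2)) * (z⁻¹ ^ ℓ * z⁻¹ ^ ℓ) =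
      ((ℓ + k : ℕ) : ℝ) ^ (ℓ + k) / ((ℓ : ℝ) ^ ℓ * (k : ℝ) ^ k) := by
    rw [Real.exp_nat_mul, Real.exp_log (by positivity), ← mul_pow, ← mul_inv, ← sq, hz2,
      show (1 : ℝ) + ℓ / k = (ℓ + k) / k by field_simp; ring, inv_div, div_pow, div_pow]
    push_cast
    rw [pow_add (k : ℝ)]
    field_simp
  calc _ = (invSum x z * invSum y z) * (z⁻¹ ^ ℓ * z⁻¹ ^ ℓ) := by ring
    _ ≤ (Real.exp (Fintype.card α * (Real.log (1 + z ^ 2) / 2) + fixCount x * z -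
      longCount x * (z ^ 2 / 12)) * Real.exp (Fintype.card α * (Real.log (1 + z ^ 2) / 2) +
      fixCount y * z - longCount y * (z ^ 2 / 12))) * (z⁻¹ ^ ℓ * z⁻¹ ^ ℓ) := by gcongr
    _ ≤ (Real.exp ((ℓ + k : ℕ) * Real.log (1 + z ^ 2)) *
        Real.exp ((fixCount x + fixCount y) * z - longCount y * (z ^ 2 / 12))) *
        (z⁻¹ ^ ℓ * z⁻¹ ^ ℓ) := by
        rw [← Real.exp_add, ← Real.exp_add, hn]
        refine mul_le_mul_of_nonneg_right (Real.exp_le_exp.2 ?_) (by positivity)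
        have : (0 : ℝ) ≤ longCount x * (z ^ 2 / 12) := by positivity
        linarith
    _ = _ := by rw [← e1]; ring

lemma smul_conj_sdiff (h y : Perm α) (Y : Finset α) :
    (h * y * h⁻¹) • (h • Y) \ (h • Y) = h • (y • Y \ Y) := by
  rw [smul_finset_sdiff, mul_smul, mul_smul, inv_smul_smul]

/-- First moment bound for the number of near invariant sets of a given size. -/
lemma Ex_card_nearInvariant_le {x y : Perm α} {ℓ k : ℕ} (s : ℕ) (hℓ : 0 < ℓ) (hℓk : ℓ ≤ k)
    (hn : ℓ + k = Fintype.card α) {z : ℝ} (hzdef : z = Real.sqrt (ℓ / k)) :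
    Ex (fun h => (#{Z : Finset α | #Z = ℓ ∧ #(x • Z \ Z) ≤ s ∧
        #((h * y * h⁻¹) • Z \ Z) ≤ s} : ℝ)) ≤
      (Fintype.card α + 1) ^ (4 * s) * (Real.exp 2 * ℓ * k) *
      Real.exp ((fixCount x + fixCount y) * z - longCount y * (z ^ 2 / 12)) := by
  set 𝒜 : Finset (Finset α) := {Z | #Z = ℓ ∧ #(x • Z \ Z) ≤ s}
  set ℬ : Finset (Finset α) := {Z | #Z = ℓ ∧ #(y • Z \ Z) ≤ s}
  have hk : 0 < k := hℓ.trans_le hℓk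
  have hℓ' : (0 : ℝ) < ℓ := by exact_mod_cast hℓ
  have hk' : (0 : ℝ) < k := by exact_mod_cast hk
  have hz : 0 < z := by rw [hzdef]; positivity
  have hz1 : z ≤ 1 := by
    rw [hzdef]
    refine Real.sqrt_le_one.2 ((div_le_one hk').2 ?_)
    exact_mod_cast hℓk
  have h1 : ∀ h : Perm α, (#{Z : Finset α | #Z = ℓ ∧ #(x • Z \ Z) ≤ s ∧
      #((h * y * h⁻¹) • Z \ Z) ≤ s} : ℝ) ≤ #{Y ∈ ℬ | h • Y ∈ 𝒜} := by
    intro h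
    norm_cast
    apply card_le_card_of_injOn (fun Z => h⁻¹ • Z)
    · intro Z hZ
      obtain ⟨-, h2, h3, h4⟩ := mem_filter.1 (mem_coe.1 hZ)
      have h5 := smul_conj_sdiff h y (h⁻¹ • Z)
      rw [smul_inv_smul] at h5
      rw [h5, card_smul_finset] at h4
      simp only [mem_coe, mem_filter, 𝒜, ℬ, mem_univ, true_and, card_smul_finset, smul_inv_smul]
      exact ⟨⟨h2, h4⟩, h2, h3⟩
    · intro Z _ Z' _ he
      simpa using he
  have h2 := Ex_card_smul_mem_le ℓ 𝒜 ℬ fun Z hZ => (mem_filter.1 hZ).2.1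
  have h3 := card_nearInvariant_le (x := x) hz hz1 ℓ s
  have h4 := card_nearInvariant_le (x := y) hz hz1 ℓ s
  have h5 := invSum_mul_invSum_le (x := x) (y := y) hℓ hℓk hn hzdef
  have h6 := entropy_le_choose hℓ hk
  have hch : (0 : ℝ) < (ℓ + k).choose ℓ := by
    exact_mod_cast Nat.choose_pos (by omega)
  set E := Real.exp ((fixCount x + fixCount y) * z - longCount y * (z ^ 2 / 12)) with hE
  set N : ℝ := (Fintype.card α + 1) with hN
  have h7 : ((ℓ + k : ℕ) : ℝ) ^ (ℓ + k) / ((ℓ : ℝ) ^ ℓ * (k : ℝ) ^ k) ≤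
      (ℓ + k).choose ℓ * (Real.exp 2 * ℓ * k) := by
    rw [div_le_iff₀ (by positivity)]; exact h6
  refine (Ex_mono h1).trans (h2.trans ?_)
  rw [← hn, div_le_iff₀ hch]
  calc (#𝒜 : ℝ) * #ℬ ≤ (N ^ (2 * s) * (invSum x z * z⁻¹ ^ ℓ)) *
        (N ^ (2 * s) * (invSum y z * z⁻¹ ^ ℓ)) := by
        have : 0 ≤ N := by positivity
        gcongr
        exact (Nat.cast_nonneg _).trans h3
    _ = N ^ (4 * s) * ((invSum x z * z⁻¹ ^ ℓ) * (invSum y z * z⁻¹ ^ ℓ)) := by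
        rw [show 4 * s = 2 * s + 2 * s by ring, pow_add]; ring
    _ ≤ N ^ (4 * s) * (((ℓ + k).choose ℓ * (Real.exp 2 * ℓ * k)) * E) := by
        have : 0 ≤ N := by positivity
        refine mul_le_mul_of_nonneg_left (h5.trans ?_) (by positivity)
        gcongr
    _ = _ := by ring

end NearInvariantBound
end FixedOrder

namespace FixedOrder
open Equiv Finset
open scoped Pointwise

section Expansion
variable {α : Type*} [Fintype α] [DecidableEq α]

/-- The expansion rate. -/
noncomputable def rho (δ : ℝ) (n : ℕ) : ℝ := δ / (200 * Real.log n)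

/-- Few fixed points for both permutations, and the second has many points on long cycles. -/
def Good (K δ : ℝ) (x y : Perm α) : Prop :=
  fixCount x ≤ K * Real.sqrt (Fintype.card α) ∧ fixCount y ≤ K * Real.sqrt (Fintype.card α) ∧
    δ * Fintype.card α ≤ longCount y

lemma per_conj (h y : Perm α) (i : α) : per (h * y * h⁻¹) (h i) = per y i := by
  refine Nat.dvd_antisymm ?_ ?_
  · rw [← pow_apply_eq_self_iff, conj_pow]
    simp [pow_per]
  · rw [← pow_apply_eq_self_iff]
    have := pow_per (h * y * h⁻¹) (h i)
    rw [conj_pow] at this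
    simpa using this

lemma Good.exponent_le {K δ : ℝ} {x y : Perm α} (hG : Good K δ x y) (hδ : 0 ≤ δ) (hK : 0 ≤ K)
    {ℓ k : ℕ} (hℓ : 0 < ℓ) (hℓk : ℓ ≤ k)
    (hn : ℓ + k = Fintype.card α) {z : ℝ} (hzdef : z = Real.sqrt (ℓ / k)) :
    (fixCount x + fixCount y) * z - longCount y * (z ^ 2 / 12) ≤
      2 * K * Real.sqrt (2 * ℓ) - δ * ℓ / 12 := by
  obtain ⟨h1, h2, h3⟩ := hG
  have hk : 0 < k := hℓ.trans_le hℓk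
  have hℓ' : (0 : ℝ) < ℓ := by exact_mod_cast hℓ
  have hk' : (0 : ℝ) < k := by exact_mod_cast hk
  have hℓk' : (ℓ : ℝ) ≤ k := by exact_mod_cast hℓk
  have hn' : (Fintype.card α : ℝ) = ℓ + k := by rw [← hn]; push_cast; rfl
  have hz2 : z ^ 2 = ℓ / k := by rw [hzdef, Real.sq_sqrt (by positivity)]
  have hz : 0 < z := by rw [hzdef]; positivity
  have h4 : Real.sqrt (Fintype.card α) * z ≤ Real.sqrt (2 * ℓ) := by
    rw [hzdef, ← Real.sqrt_mul (by positivity), hn']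
    apply Real.sqrt_le_sqrt
    rw [← mul_div_assoc, div_le_iff₀ hk']
    nlinarith
  have h5 : (ℓ : ℝ) ≤ Fintype.card α * z ^ 2 := by
    rw [hz2, hn', ← mul_div_assoc, le_div_iff₀ hk']
    nlinarith
  have h6 : (fixCount x + fixCount y) * z ≤ 2 * K * Real.sqrt (2 * ℓ) := by
    calc (fixCount x + fixCount y) * z
        ≤ (K * Real.sqrt (Fintype.card α) + K * Real.sqrt (Fintype.card α)) * z := by gcongr
      _ = 2 * K * (Real.sqrt (Fintype.card α) * z) := by ring
      _ ≤ _ := by gcongr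
  have h7 : δ * ℓ ≤ longCount y * z ^ 2 := by
    calc δ * ℓ ≤ δ * (Fintype.card α * z ^ 2) := by gcongr
      _ = δ * Fintype.card α * z ^ 2 := by ring
      _ ≤ _ := by gcongr
  linarith

lemma eventually_exp_nearInvariant_le {K δ : ℝ} (hK : 0 < K) (hδ : 0 < δ) :
    ∀ᶠ n : ℕ in atTop, ∀ ℓ : ℕ, 1 ≤ rho δ n * ℓ →
      ((n : ℝ) + 1) ^ (4 * ⌊rho δ n * ℓ⌋₊) * Real.exp (2 * K * Real.sqrt (2 * ℓ) - δ * ℓ / 12) ≤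
        1 / (n : ℝ) ^ 8 := by
  have hlog : Tendsto (fun n : ℕ => Real.log n) atTop atTop :=
    Real.tendsto_log_atTop.comp tendsto_natCast_atTop_atTop
  filter_upwards [hlog.eventually_ge_atTop (3600 * K ^ 2 / δ), hlog.eventually_ge_atTop 1,
    eventually_ge_atTop 2] with n h1 h2 hn ℓ hℓ
  have hn2 : (2 : ℝ) ≤ n := by exact_mod_cast hn
  have hn0 : (0 : ℝ) < n := by linarith
  have hL : 0 < Real.log n := by linarith
  have hρ : 0 < rho δ n := by unfold rho; positivity
  have hℓ1 : 200 * Real.log n ≤ δ * ℓ := by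
    unfold rho at hℓ
    rw [div_mul_eq_mul_div, le_div_iff₀ (by positivity)] at hℓ
    linarith
  have hℓ0 : (0 : ℝ) ≤ ℓ := by positivity
  have h3 : 2 * K * Real.sqrt (2 * ℓ) ≤ δ * ℓ / 300 := by
    refine (pow_le_pow_iff_left₀ (by positivity) (by positivity) two_ne_zero).1 ?_
    rw [mul_pow, Real.sq_sqrt (by positivity)]
    rw [div_le_iff₀ hδ] at h1
    have : 720000 * K ^ 2 ≤ δ * (δ * ℓ) := by nlinarith
    nlinarith
  have h4 : Real.log ((n : ℝ) + 1) ≤ 2 * Real.log n := by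
    rw [← Real.log_rpow hn0]
    apply Real.log_le_log (by positivity)
    norm_num
    nlinarith
  have h5 : ((n : ℝ) + 1) ^ (4 * ⌊rho δ n * ℓ⌋₊) ≤ Real.exp (δ * ℓ / 25) := by
    rw [← Real.log_le_iff_le_exp (by positivity), Real.log_pow]
    have h6 : ((⌊rho δ n * ℓ⌋₊ : ℕ) : ℝ) ≤ rho δ n * ℓ := Nat.floor_le (by positivity)
    calc (((4 * ⌊rho δ n * ℓ⌋₊ : ℕ) : ℝ)) * Real.log ((n : ℝ) + 1)
        ≤ (4 * (rho δ n * ℓ)) * (2 * Real.log n) := by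
          push_cast
          have : 0 ≤ Real.log ((n : ℝ) + 1) := Real.log_nonneg (by linarith)
          gcongr
      _ = _ := by unfold rho; field_simp; ring
  calc _ ≤ Real.exp (δ * ℓ / 25) * Real.exp (2 * K * Real.sqrt (2 * ℓ) - δ * ℓ / 12) := by gcongr
    _ = Real.exp (δ * ℓ / 25 + (2 * K * Real.sqrt (2 * ℓ) - δ * ℓ / 12)) := by rw [Real.exp_add]
    _ ≤ Real.exp (-(8 * Real.log n)) := by
        apply Real.exp_le_exp.2
        linarith
    _ = 1 / (n : ℝ) ^ 8 := by
        rw [Real.exp_neg, show (8 : ℝ) * Real.log n = ((8 : ℕ) : ℝ) * Real.log n by norm_num,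
          Real.exp_nat_mul, Real.exp_log hn0, one_div]

/-- With high probability there is no large set almost invariant under both permutations. -/
lemma eventually_Pr_nearInvariant_le {K δ : ℝ} (hK : 0 < K) (hδ : 0 < δ) :
    ∀ᶠ n : ℕ in atTop, ∀ x y : Perm (Fin n), Good K δ x y →
      Pr (fun h => ∃ Z : Finset (Fin n), 1 ≤ rho δ n * #Z ∧ 2 * #Z ≤ n ∧
        #(x • Z \ Z) < rho δ n * #Z ∧ #((h * y * h⁻¹) • Z \ Z) < rho δ n * #Z) ≤ 1 / (n : ℝ) ^ 3 := by
  filter_upwards [eventually_exp_nearInvariant_le hK hδ, eventually_ge_atTop 10] with n h1 hn x y hG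
  have hn0 : (10 : ℝ) ≤ n := by exact_mod_cast hn
  have hterm : ∀ ℓ ∈ (range (n + 1)).filter (fun ℓ : ℕ => 1 ≤ rho δ n * ℓ ∧ 2 * ℓ ≤ n),
      Pr (fun h => ∃ Z : Finset (Fin n), #Z = ℓ ∧ #(x • Z \ Z) < rho δ n * #Z ∧
        #((h * y * h⁻¹) • Z \ Z) < rho δ n * #Z) ≤ 8 / (n : ℝ) ^ 6 := by
    intro ℓ hℓ
    obtain ⟨-, hℓ1, hℓ2⟩ := mem_filter.1 hℓ
    have hℓ0 : 0 < ℓ := by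
      rcases Nat.eq_zero_or_pos ℓ with rfl | h
      · simp at hℓ1; linarith
      · exact h
    have hnn : ℓ + (n - ℓ) = Fintype.card (Fin n) := by rw [Fintype.card_fin]; omega
    refine (Pr_le_Ex (F := fun h => (#{Z : Finset (Fin n) | #Z = ℓ ∧
      #(x • Z \ Z) ≤ ⌊rho δ n * ℓ⌋₊ ∧ #((h * y * h⁻¹) • Z \ Z) ≤ ⌊rho δ n * ℓ⌋₊} : ℝ))
      (fun _ => by positivity) ?_).trans ?_
    · rintro h ⟨Z, hZ, h2, h3⟩
      rw [hZ] at h2 h3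
      norm_cast
      rw [Nat.one_le_iff_ne_zero, ← Nat.pos_iff_ne_zero, card_pos]
      exact ⟨Z, mem_filter.2 ⟨mem_univ _, hZ, Nat.le_floor h2.le, Nat.le_floor h3.le⟩⟩
    · refine (Ex_card_nearInvariant_le (k := n - ℓ) _ hℓ0 (by omega) hnn rfl).trans ?_
      have h2 := hG.exponent_le hδ.le hK.le (k := n - ℓ) hℓ0 (by omega) hnn rfl
      have h3 := h1 ℓ hℓ1
      rw [Fintype.card_fin]
      have h4 : Real.exp 2 ≤ 8 := by
        rw [show (2 : ℝ) = 1 + 1 by norm_num, Real.exp_add]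
        nlinarith [Real.exp_one_lt_d9, Real.exp_pos 1]
      have h5 : (ℓ : ℝ) ≤ n := by exact_mod_cast (by omega : ℓ ≤ n)
      have h6 : ((n - ℓ : ℕ) : ℝ) ≤ n := by exact_mod_cast (by omega : n - ℓ ≤ n)
      calc _ ≤ ((n : ℝ) + 1) ^ (4 * ⌊rho δ n * ℓ⌋₊) * (8 * n * n) *
            Real.exp (2 * K * Real.sqrt (2 * ℓ) - δ * ℓ / 12) := by gcongr
        _ = 8 * n ^ 2 * (((n : ℝ) + 1) ^ (4 * ⌊rho δ n * ℓ⌋₊) *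
            Real.exp (2 * K * Real.sqrt (2 * ℓ) - δ * ℓ / 12)) := by ring
        _ ≤ 8 * n ^ 2 * (1 / (n : ℝ) ^ 8) := by gcongr
        _ = _ := by field_simp
  calc _ ≤ Pr (fun h => ∃ ℓ ∈ (range (n + 1)).filter (fun ℓ : ℕ => 1 ≤ rho δ n * ℓ ∧ 2 * ℓ ≤ n),
        ∃ Z : Finset (Fin n), #Z = ℓ ∧ #(x • Z \ Z) < rho δ n * #Z ∧
        #((h * y * h⁻¹) • Z \ Z) < rho δ n * #Z) := by
        apply Pr_mono
        rintro h ⟨Z, h1, h2, h3, h4⟩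
        exact ⟨#Z, mem_filter.2 ⟨mem_range.2 (by omega), h1, h2⟩, Z, rfl, h3, h4⟩
    _ ≤ _ := Pr_exists_le _ _
    _ ≤ ∑ ℓ ∈ (range (n + 1)).filter (fun ℓ : ℕ => 1 ≤ rho δ n * ℓ ∧ 2 * ℓ ≤ n), 8 / (n : ℝ) ^ 6 :=
        sum_le_sum hterm
    _ ≤ ∑ ℓ ∈ range (n + 1), 8 / (n : ℝ) ^ 6 :=
        sum_le_sum_of_subset_of_nonneg (filter_subset _ _) fun _ _ _ => by positivity
    _ = (n + 1) * (8 / (n : ℝ) ^ 6) := by simp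
    _ ≤ 1 / (n : ℝ) ^ 3 := by
        rw [← mul_div_assoc, div_le_div_iff₀ (by positivity) (by positivity)]
        have : (8 : ℝ) * (n + 1) ≤ (n : ℝ) ^ 3 := by nlinarith [mul_self_nonneg (n : ℝ)]
        calc ((n : ℝ) + 1) * 8 * (n : ℝ) ^ 3 = (8 * (n + 1)) * (n : ℝ) ^ 3 := by ring
          _ ≤ (n : ℝ) ^ 3 * (n : ℝ) ^ 3 := by gcongr
          _ = _ := by ring

lemma Ex_card_invariant_long_le {x y : Perm α} {ℓ k : ℕ} (hℓ : 0 < ℓ) (hℓk : ℓ ≤ k)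
    (hn : ℓ + k = Fintype.card α) {z : ℝ} (hzdef : z = Real.sqrt (ℓ / k)) :
    Pr (fun h => ∃ Z : Finset α, #Z = ℓ ∧ x • Z = Z ∧ (h * y * h⁻¹) • Z = Z ∧
        ∃ i ∈ Z, 3 ≤ per x i ∨ 3 ≤ per (h * y * h⁻¹) i) ≤
      2 * Fintype.card α * z ^ 3 * (Real.exp 1 * ℓ * Real.exp (ℓ ^ 2 / k)) *
      Real.exp ((fixCount x + fixCount y) * z - longCount y * (z ^ 2 / 12)) := by
  set 𝒜 : Finset (Finset α) := {Z | #Z = ℓ ∧ #(x • Z \ Z) ≤ 0}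
  set ℬ : Finset (Finset α) := {Z | #Z = ℓ ∧ #(y • Z \ Z) ≤ 0}
  set 𝒜' : Finset (Finset α) := {Z : Finset α | #Z = ℓ ∧ x • Z = Z ∧ ∃ i ∈ Z, 3 ≤ per x i}
  set ℬ' : Finset (Finset α) := {Z : Finset α | #Z = ℓ ∧ y • Z = Z ∧ ∃ i ∈ Z, 3 ≤ per y i}
  have hk : 0 < k := hℓ.trans_le hℓk
  have hℓ' : (0 : ℝ) < ℓ := by exact_mod_cast hℓ
  have hk' : (0 : ℝ) < k := by exact_mod_cast hk
  have hz : 0 < z := by rw [hzdef]; positivity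
  have hz1 : z ≤ 1 := by
    rw [hzdef]
    refine Real.sqrt_le_one.2 ((div_le_one hk').2 ?_)
    exact_mod_cast hℓk
  have h1 : Pr (fun h => ∃ Z : Finset α, #Z = ℓ ∧ x • Z = Z ∧ (h * y * h⁻¹) • Z = Z ∧
        ∃ i ∈ Z, 3 ≤ per x i ∨ 3 ≤ per (h * y * h⁻¹) i) ≤
      Ex (fun h : Perm α => (#{Y ∈ ℬ | h • Y ∈ 𝒜'} : ℝ) + #{Y ∈ ℬ' | h • Y ∈ 𝒜}) := by
    refine Pr_le_Ex (fun _ => by positivity) ?_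
    rintro h ⟨Z, h2, h3, h4, i, hi, h5⟩
    have h6 : y • (h⁻¹ • Z) = h⁻¹ • Z := by
      conv_rhs => rw [← h4]
      simp [mul_smul]
    norm_cast
    rw [Nat.one_le_iff_ne_zero, ← Nat.pos_iff_ne_zero]
    rcases h5 with h5 | h5
    · refine Nat.add_pos_left (card_pos.2 ⟨h⁻¹ • Z, ?_⟩) _
      simp only [mem_filter, ℬ, 𝒜', mem_univ, true_and, card_smul_finset, smul_inv_smul, h6, h2, h3]
      simpa using ⟨i, hi, h5⟩
    · refine Nat.add_pos_right _ (card_pos.2 ⟨h⁻¹ • Z, ?_⟩)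
      simp only [mem_filter, ℬ', 𝒜, mem_univ, true_and, card_smul_finset, smul_inv_smul, h6, h2, h3]
      refine ⟨⟨h⁻¹ • i, smul_mem_smul_finset hi, ?_⟩, by simp⟩
      rw [← per_conj h]
      simpa using h5
  have hX0 : 0 ≤ invSum x z := sum_nonneg fun _ _ => by positivity
  have hY0 : 0 ≤ invSum y z := sum_nonneg fun _ _ => by positivity
  have a1 := card_nearInvariant_le (x := x) hz hz1 ℓ 0
  have b1 := card_nearInvariant_le (x := y) hz hz1 ℓ 0
  have a2 := card_invariant_long_le (x := x) hz hz1 ℓ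
  have b2 := card_invariant_long_le (x := y) hz hz1 ℓ
  simp only [mul_zero, pow_zero, one_mul] at a1 b1
  have h2 := Ex_card_smul_mem_le ℓ 𝒜' ℬ fun Z hZ => (mem_filter.1 hZ).2.1
  have h3 := Ex_card_smul_mem_le ℓ 𝒜 ℬ' fun Z hZ => (mem_filter.1 hZ).2.1
  have h5 := invSum_mul_invSum_le (x := x) (y := y) hℓ hℓk hn hzdef
  have h6 := entropy_le_choose_of_small hℓ hk
  have hch : (0 : ℝ) < (ℓ + k).choose ℓ := by
    exact_mod_cast Nat.choose_pos (by omega)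
  set E := Real.exp ((fixCount x + fixCount y) * z - longCount y * (z ^ 2 / 12)) with hE
  set N : ℝ := ((Fintype.card α : ℕ) : ℝ) with hN
  set D := Real.exp 1 * ℓ * Real.exp (ℓ ^ 2 / k) with hD
  have h7 : ((ℓ + k : ℕ) : ℝ) ^ (ℓ + k) / ((ℓ : ℝ) ^ ℓ * (k : ℝ) ^ k) ≤ (ℓ + k).choose ℓ * D := by
    rw [div_le_iff₀ (by positivity)]; exact h6
  have hN0 : 0 ≤ N := by positivity
  have h8 : (invSum x z * z⁻¹ ^ ℓ) * (invSum y z * z⁻¹ ^ ℓ) ≤ (ℓ + k).choose ℓ * D * E :=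
    h5.trans (by gcongr)
  refine h1.trans ?_
  rw [Ex_add]
  refine (add_le_add h2 h3).trans ?_
  rw [← add_div, ← hn, div_le_iff₀ hch]
  calc (#𝒜' : ℝ) * #ℬ + #𝒜 * #ℬ' ≤ (N * z ^ 3 * (invSum x z * z⁻¹ ^ ℓ)) * (invSum y z * z⁻¹ ^ ℓ) +
        (invSum x z * z⁻¹ ^ ℓ) * (N * z ^ 3 * (invSum y z * z⁻¹ ^ ℓ)) := by gcongr
    _ = 2 * N * z ^ 3 * ((invSum x z * z⁻¹ ^ ℓ) * (invSum y z * z⁻¹ ^ ℓ)) := by ring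
    _ ≤ 2 * N * z ^ 3 * ((ℓ + k).choose ℓ * D * E) := by gcongr
    _ = _ := by ring

/-- With high probability no small set containing a point on a long cycle is invariant under both
permutations. -/
lemma eventually_Pr_invariant_long_le {K δ η : ℝ} (hK : 0 < K) (hδ : 0 < δ) (hη : 0 < η) :
    ∀ᶠ n : ℕ in atTop, ∀ x y : Perm (Fin n), Good K δ x y →
      Pr (fun h => ∃ Z : Finset (Fin n), rho δ n * #Z ≤ 1 ∧ x • Z = Z ∧ (h * y * h⁻¹) • Z = Z ∧
        ∃ i ∈ Z, 3 ≤ per x i ∨ 3 ≤ per (h * y * h⁻¹) i) ≤ η := by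
  set C : ℝ := 200 / δ with hC
  have hC0 : 0 < C := by positivity
  set A : ℝ := 8 * Real.exp 2 * Real.exp (24 * K ^ 2 / δ) with hA
  have hlog : Tendsto (fun n : ℕ => Real.log n) atTop atTop :=
    Real.tendsto_log_atTop.comp tendsto_natCast_atTop_atTop
  have hsmall : ∀ k : ℕ, Tendsto (fun n : ℕ => (C * Real.log n) ^ k / Real.sqrt n) atTop (nhds 0) := by
    intro k
    have h1 : (fun n : ℝ => Real.log n ^ k) =o[atTop] fun n : ℝ => n ^ (1 / 2 : ℝ) := by
      have := isLittleO_log_rpow_rpow_atTop (s := 1 / 2) k (by norm_num)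
      simpa using this
    have h2 := (h1.tendsto_div_nhds_zero.comp tendsto_natCast_atTop_atTop).const_mul (C ^ k)
    simp only [mul_zero] at h2
    refine h2.congr fun n => ?_
    simp only [Function.comp, Real.sqrt_eq_rpow, mul_pow]
    ring
  have e1 := (hsmall 4).const_mul A
  rw [mul_zero] at e1
  have hbig : Tendsto (fun n : ℕ => Real.sqrt n) atTop atTop :=
    Real.tendsto_sqrt_atTop.comp tendsto_natCast_atTop_atTop
  filter_upwards [e1.eventually_le_const hη, (hsmall 2).eventually_le_const (u := 1 / 2) (by norm_num),
    hlog.eventually_ge_atTop 1, eventually_ge_atTop 10,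
    (hsmall 1).eventually_le_const (u := 1 / 2) (by norm_num)] with n h1 h2 h3 hn h2' x y hG
  have hn0 : (10 : ℝ) ≤ n := by exact_mod_cast hn
  have hs1 : 1 ≤ Real.sqrt n := Real.one_le_sqrt.2 (by linarith)
  have hss : Real.sqrt n * Real.sqrt n = n := Real.mul_self_sqrt (by positivity)
  set L := C * Real.log n with hL
  have hL0 : 0 < L := by positivity
  rw [div_le_iff₀ (by positivity)] at h2 h2'
  rw [pow_one] at h2'
  have hterm : ∀ ℓ ∈ Icc 1 ⌊L⌋₊,
      Pr (fun h => ∃ Z : Finset (Fin n), #Z = ℓ ∧ x • Z = Z ∧ (h * y * h⁻¹) • Z = Z ∧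
        ∃ i ∈ Z, 3 ≤ per x i ∨ 3 ≤ per (h * y * h⁻¹) i) ≤ A * L ^ 3 / Real.sqrt n := by
    intro ℓ hℓ
    obtain ⟨hℓ1, hℓ2⟩ := mem_Icc.1 hℓ
    have hℓL : (ℓ : ℝ) ≤ L := (Nat.le_floor_iff hL0.le).1 hℓ2
    have hℓ1' : (1 : ℝ) ≤ ℓ := by exact_mod_cast hℓ1
    have hℓn : 2 * ℓ ≤ n := by
      have h6 : Real.sqrt n ≤ n := by
        conv_rhs => rw [← hss]
        exact le_mul_of_one_le_left (by positivity) hs1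
      have : (2 : ℝ) * ℓ ≤ n := by linarith
      exact_mod_cast this
    have hk : ((n - ℓ : ℕ) : ℝ) = n - ℓ := by rw [Nat.cast_sub (by omega)]
    have hk2 : (n : ℝ) / 2 ≤ ((n - ℓ : ℕ) : ℝ) := by
      have : (2 : ℝ) * ℓ ≤ n := by exact_mod_cast hℓn
      rw [hk]; linarith
    have hk0 : (0 : ℝ) < ((n - ℓ : ℕ) : ℝ) := by linarith
    have hnn : ℓ + (n - ℓ) = Fintype.card (Fin n) := by rw [Fintype.card_fin]; omega
    refine (Ex_card_invariant_long_le (k := n - ℓ) hℓ1 (by omega) hnn rfl).trans ?_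
    have h4 := hG.exponent_le hδ.le hK.le (k := n - ℓ) hℓ1 (by omega) hnn rfl
    set z := Real.sqrt (ℓ / ((n - ℓ : ℕ) : ℝ)) with hz
    have hz0 : 0 ≤ z := Real.sqrt_nonneg _
    have hz2 : z ^ 2 = ℓ / ((n - ℓ : ℕ) : ℝ) := Real.sq_sqrt (by positivity)
    have hz2' : z ^ 2 ≤ 2 * L / n := by
      rw [hz2, div_le_div_iff₀ hk0 (by positivity)]
      nlinarith
    have hz1 : z ≤ 2 * L / Real.sqrt n := by
      refine (pow_le_pow_iff_left₀ hz0 (by positivity) two_ne_zero).1 (hz2'.trans ?_)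
      rw [div_pow, sq (Real.sqrt n), hss]
      gcongr
      nlinarith
    have hz3 : n * z ^ 3 ≤ 4 * L ^ 2 / Real.sqrt n := by
      calc n * z ^ 3 = n * z ^ 2 * z := by ring
        _ ≤ n * (2 * L / n) * (2 * L / Real.sqrt n) := by gcongr
        _ = _ := by field_simp; ring
    have h5 : (2 * K * Real.sqrt (2 * ℓ) - δ * ℓ / 12) ≤ 24 * K ^ 2 / δ := by
      rw [le_div_iff₀ hδ]
      have h6 : Real.sqrt (2 * ℓ) ^ 2 = 2 * ℓ := Real.sq_sqrt (by positivity)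
      have h8 : δ ^ 2 * Real.sqrt (2 * ℓ) ^ 2 = δ ^ 2 * (2 * ℓ) := by rw [h6]
      have h9 := sq_nonneg (δ * Real.sqrt (2 * ℓ) - 24 * K)
      ring_nf at h8 h9 ⊢
      linarith
    have h7 : (ℓ : ℝ) ^ 2 / ((n - ℓ : ℕ) : ℝ) ≤ 1 := by
      rw [div_le_one hk0]
      nlinarith
    rw [Fintype.card_fin]
    calc _ = 2 * (n * z ^ 3) * (Real.exp 1 * ℓ * Real.exp (ℓ ^ 2 / ((n - ℓ : ℕ) : ℝ))) *
          Real.exp ((fixCount x + fixCount y) * z - longCount y * (z ^ 2 / 12)) := by ring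
      _ ≤ 2 * (4 * L ^ 2 / Real.sqrt n) * (Real.exp 1 * L * Real.exp 1) *
          Real.exp (24 * K ^ 2 / δ) := by
          gcongr
          exact h4.trans h5
      _ = _ := by
          rw [hA, show (2 : ℝ) = 1 + 1 by norm_num, Real.exp_add]
          ring
  calc _ ≤ Pr (fun h => ∃ ℓ ∈ Icc 1 ⌊L⌋₊, ∃ Z : Finset (Fin n), #Z = ℓ ∧ x • Z = Z ∧
        (h * y * h⁻¹) • Z = Z ∧ ∃ i ∈ Z, 3 ≤ per x i ∨ 3 ≤ per (h * y * h⁻¹) i) := by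
        apply Pr_mono
        rintro h ⟨Z, h4, h5, h6, i, hi, h7⟩
        refine ⟨#Z, mem_Icc.2 ⟨card_pos.2 ⟨i, hi⟩, Nat.le_floor ?_⟩, Z, rfl, h5, h6, i, hi, h7⟩
        unfold rho at h4
        rw [div_mul_eq_mul_div, div_le_one (by positivity)] at h4
        rw [hL, hC, div_mul_eq_mul_div, le_div_iff₀ hδ]
        linarith
    _ ≤ _ := Pr_exists_le _ _
    _ ≤ ∑ ℓ ∈ Icc 1 ⌊L⌋₊, A * L ^ 3 / Real.sqrt n := sum_le_sum hterm
    _ = ⌊L⌋₊ * (A * L ^ 3 / Real.sqrt n) := by simp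
    _ ≤ L * (A * L ^ 3 / Real.sqrt n) := by
        have := Nat.floor_le hL0.le
        gcongr
    _ = A * (L ^ 4 / Real.sqrt n) := by ring
    _ ≤ η := h1

end Expansion
end FixedOrder

namespace FixedOrder
open Equiv Finset
open scoped Pointwise

section Dihedral
variable {α : Type*} [Fintype α] [DecidableEq α]

/-- The point opposite to `u` on its cycle. -/
noncomputable def antipode (g : Perm α) (u : α) : α := (g ^ (per g u / 2)) u

/-- The point just after the middle of the cycle of `e`. -/
noncomputable def antipode' (g : Perm α) (e : α) : α := (g ^ ((per g e + 1) / 2)) e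

lemma antipode_antipode {g : Perm α} {u : α} (h : Even (per g u)) :
    antipode g (antipode g u) = u := by
  have h1 : per g (antipode g u) = per g u := per_eq_of_mem (pow_mem_cyc g u _)
  unfold antipode at h1 ⊢
  rw [h1, ← Perm.mul_apply, ← pow_add]
  obtain ⟨k, hk⟩ := h
  rw [show per g u / 2 + per g u / 2 = per g u by omega, pow_per]

/-- In a finite dihedral action, a fixed point of one involution is matched with another fixed
point of one of the two involutions. -/
lemma dihedral_end {x y : Perm α} {Z : Finset α} (hx : ∀ i ∈ Z, x i ∈ Z) (hy : ∀ i ∈ Z, y i ∈ Z)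
    (hxx : ∀ i ∈ Z, x (x i) = i) (hyy : ∀ i ∈ Z, y (y i) = i) {u : α} (hu : u ∈ Z)
    (hyu : y u = u) :
    (∃ e ∈ Z, x e = e ∧ u = antipode' (y * x) e) ∨
    (antipode (y * x) u ∈ Z ∧ antipode (y * x) u ≠ u ∧
      y (antipode (y * x) u) = antipode (y * x) u ∧ u = antipode (y * x) (antipode (y * x) u)) := by
  set g := y * x with hg
  have hgZ : ∀ i : ℕ, (g ^ i) u ∈ Z := by
    intro i
    induction i with
    | zero => simpa
    | succ i ih => rw [pow_succ', Perm.mul_apply, hg, Perm.mul_apply]; exact hy _ (hx _ ih)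
  set L := per g u with hL
  have hL0 : 0 < L := per_pos g u
  have hgL : (g ^ L) u = u := pow_per g u
  have hyg : ∀ i j : ℕ, i + j = L → y ((g ^ i) u) = (g ^ j) u := by
    intro i
    induction i with
    | zero => intro j hj; simp [(by omega : j = L), hgL, hyu]
    | succ i ih =>
      intro j hj
      have h1 := ih (j + 1) (by omega)
      have h2 : g ((g ^ j) u) = y ((g ^ i) u) := by
        rw [h1, pow_succ' g j]; rfl
      have h3 : x ((g ^ j) u) = (g ^ i) u := y.injective h2
      rw [pow_succ', Perm.mul_apply, hg, Perm.mul_apply, ← hg,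
        hyy _ (hx _ (hgZ i)), ← h3, hxx _ (hgZ j)]
  rcases Nat.even_or_odd' L with ⟨k, hk | hk⟩
  · right
    have hA : antipode g u = (g ^ k) u := by
      rw [antipode, ← hL, show L / 2 = k by omega]
    refine ⟨hA ▸ hgZ k, ?_, ?_, (antipode_antipode ⟨k, by omega⟩).symm⟩
    · rw [hA, Ne, pow_apply_eq_self_iff, ← hL]
      exact Nat.not_dvd_of_pos_of_lt (by omega) (by omega)
    · rw [hA, hyg k k (by omega)]
  · left
    refine ⟨(g ^ k) u, hgZ k, ?_, ?_⟩
    · have h1 := hyg (k + 1) k (by omega)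
      rw [pow_succ', Perm.mul_apply, hg, Perm.mul_apply, ← hg, hyy _ (hx _ (hgZ k))] at h1
      exact h1
    · rw [antipode', per_eq_of_mem (pow_mem_cyc g u k), ← hL, ← Perm.mul_apply, ← pow_add,
        show (L + 1) / 2 + k = L by omega, hgL]

end Dihedral

section Exposure
variable {α : Type*} [Fintype α] [DecidableEq α]

open Classical in
lemma card_apply_mem_mul_le {A : Perm α → Prop} {E W : Finset α}
    (hA : ∀ h τ : Perm α, (∀ i ∈ E, τ i = i) → A h → A (h * τ))
    (B : Perm α → Finset α) (hB : ∀ h τ : Perm α, (∀ i ∈ E, τ i = i) → B (h * τ) = B h)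
    {k : ℕ} (hk : ∀ h, #(B h) ≤ k) {s : α} (hs : s ∉ E) (hW : Disjoint W E) :
    #{h | A h ∧ h s ∈ B h} * #W ≤ k * #{h | A h} := by
  have key : ∀ w ∈ W, #{h | A h ∧ h s ∈ B h} ≤ #{h | A h ∧ h w ∈ B h} := by
    intro w hw
    have hτ : ∀ i ∈ E, swap s w i = i := fun i hi => swap_apply_of_ne_of_ne
      (fun h => hs (h ▸ hi)) (fun h => disjoint_left.1 hW hw (h ▸ hi))
    refine card_le_card_of_injOn (fun h => h * swap s w) ?_ (fun _ _ _ _ h => mul_right_cancel h)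
    intro h hh
    obtain ⟨-, h1, h2⟩ := mem_filter.1 (mem_coe.1 hh)
    refine mem_coe.2 (mem_filter.2 ⟨mem_univ _, hA _ _ hτ h1, ?_⟩)
    rw [hB _ _ hτ]
    simpa using h2
  calc #{h | A h ∧ h s ∈ B h} * #W = ∑ w ∈ W, #{h | A h ∧ h s ∈ B h} := by
        rw [sum_const, smul_eq_mul, mul_comm]
    _ ≤ ∑ w ∈ W, #{h | A h ∧ h w ∈ B h} := sum_le_sum key
    _ = ∑ w ∈ W, ∑ h with A h, if h w ∈ B h then 1 else 0 := by
        refine sum_congr rfl fun w _ => ?_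
        rw [← sum_filter, filter_filter, card_eq_sum_ones]
    _ = ∑ h with A h, #{w ∈ W | h w ∈ B h} := by
        rw [sum_comm]
        exact sum_congr rfl fun h _ => by rw [card_filter]
    _ ≤ ∑ h with A h, k := by
        refine sum_le_sum fun h _ => le_trans ?_ (hk h)
        exact card_le_card_of_injOn h (fun w hw => (mem_filter.1 (mem_coe.1 hw)).2)
          h.injective.injOn
    _ = _ := by rw [sum_const, smul_eq_mul, mul_comm]

open Classical in
lemma card_apply_pair_mem_mul_le {A : Perm α → Prop} {E W : Finset α}
    (hA : ∀ h τ : Perm α, (∀ i ∈ E, τ i = i) → A h → A (h * τ))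
    (B : Perm α → Finset (α × α)) (hB : ∀ h τ : Perm α, (∀ i ∈ E, τ i = i) → B (h * τ) = B h)
    {k : ℕ} (hk : ∀ h, #(B h) ≤ k) {s t : α} (hst : s ≠ t) (hs : s ∉ E) (ht : t ∉ E)
    (htW : t ∉ W) (hW : Disjoint W E) :
    #{h | A h ∧ (h s, h t) ∈ B h} * #W.offDiag ≤ k * #{h | A h} := by
  have key : ∀ w ∈ W.offDiag,
      #{h | A h ∧ (h s, h t) ∈ B h} ≤ #{h | A h ∧ (h w.1, h w.2) ∈ B h} := by
    rintro ⟨w, w'⟩ hw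
    obtain ⟨hw1, hw2, hww⟩ := mem_offDiag.1 hw
    have hτ : ∀ i ∈ E, (swap s w * swap t w') i = i := fun i hi => by
      have h1 : i ≠ s := fun h => hs (h ▸ hi)
      have h2 : i ≠ t := fun h => ht (h ▸ hi)
      have h3 : i ≠ w := fun h => disjoint_left.1 hW hw1 (h ▸ hi)
      have h4 : i ≠ w' := fun h => disjoint_left.1 hW hw2 (h ▸ hi)
      rw [Perm.mul_apply, swap_apply_of_ne_of_ne h2 h4, swap_apply_of_ne_of_ne h1 h3]
    have hwt : w ≠ t := fun h => htW (h ▸ hw1)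
    refine card_le_card_of_injOn (fun h => h * (swap s w * swap t w')) ?_
      (fun _ _ _ _ h => mul_right_cancel h)
    intro h hh
    obtain ⟨-, h1, h2⟩ := mem_filter.1 (mem_coe.1 hh)
    refine mem_coe.2 (mem_filter.2 ⟨mem_univ _, hA _ _ hτ h1, ?_⟩)
    rw [hB _ _ hτ]
    have e1 : (swap s w * swap t w') w = s := by
      rw [Perm.mul_apply, swap_apply_of_ne_of_ne hwt hww, swap_apply_right]
    have e2 : (swap s w * swap t w') w' = t := by
      rw [Perm.mul_apply, swap_apply_right, swap_apply_of_ne_of_ne hst.symm hwt.symm]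
    simp only [Perm.mul_apply] at e1 e2 ⊢
    rw [e1, e2]
    exact h2
  calc #{h | A h ∧ (h s, h t) ∈ B h} * #W.offDiag
      = ∑ w ∈ W.offDiag, #{h | A h ∧ (h s, h t) ∈ B h} := by
        rw [sum_const, smul_eq_mul, mul_comm]
    _ ≤ ∑ w ∈ W.offDiag, #{h | A h ∧ (h w.1, h w.2) ∈ B h} := sum_le_sum key
    _ = ∑ w ∈ W.offDiag, ∑ h with A h, if (h w.1, h w.2) ∈ B h then 1 else 0 := by
        refine sum_congr rfl fun w _ => ?_
        rw [← sum_filter, filter_filter, card_eq_sum_ones]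
    _ = ∑ h with A h, #{w ∈ W.offDiag | (h w.1, h w.2) ∈ B h} := by
        rw [sum_comm]
        exact sum_congr rfl fun h _ => by rw [card_filter]
    _ ≤ ∑ h with A h, k := by
        refine sum_le_sum fun h _ => le_trans ?_ (hk h)
        refine card_le_card_of_injOn (fun w => (h w.1, h w.2))
          (fun w hw => (mem_filter.1 (mem_coe.1 hw)).2) ?_
        rintro ⟨a, b⟩ - ⟨c, d⟩ - h1
        simpa using h1
    _ = _ := by rw [sum_const, smul_eq_mul, mul_comm]

end Exposure
end FixedOrder

namespace FixedOrder
open Equiv Finset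
open scoped Pointwise

section NoClosed
variable {α : Type*} [Fintype α] [DecidableEq α]

/-- `y` on the invariant set `E` and the identity elsewhere. -/
noncomputable def restr (y : Perm α) (E : Finset α) (hE : ∀ i, y i ∈ E ↔ i ∈ E) : Perm α :=
  (y.subtypePerm (p := (· ∈ E)) hE).ofSubtype

lemma restr_apply_of_mem {y : Perm α} {E : Finset α} (hE : ∀ i, y i ∈ E ↔ i ∈ E) {i : α}
    (hi : i ∈ E) : restr y E hE i = y i := by
  rw [restr, Perm.ofSubtype_apply_of_mem _ hi]; rfl

lemma restr_apply_of_notMem {y : Perm α} {E : Finset α} (hE : ∀ i, y i ∈ E ↔ i ∈ E) {i : α}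
    (hi : i ∉ E) : restr y E hE i = i := by
  rw [restr, Perm.ofSubtype_apply_of_not_mem _ hi]

/-- No nonempty set inside `h • E` is invariant under `x` and the conjugate of `y`, with `x` acting
as an involution on it. -/
def NoClosed (x y : Perm α) (E : Finset α) (h : Perm α) : Prop :=
  ∀ Z ⊆ h • E, (∀ i ∈ Z, x i ∈ Z) → (∀ i ∈ Z, (h * y * h⁻¹) i ∈ Z) → (∀ i ∈ Z, x (x i) = i) →
    Z = ∅

lemma conj_mul_restr {y : Perm α} {E : Finset α} (hE : ∀ i, y i ∈ E ↔ i ∈ E) (h τ : Perm α)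
    (hτ : ∀ i ∈ E, τ i = i) :
    (h * τ) * restr y E hE * (h * τ)⁻¹ = h * restr y E hE * h⁻¹ := by
  have h1 : τ * restr y E hE = restr y E hE * τ := by
    ext i
    simp only [Perm.mul_apply]
    by_cases hi : i ∈ E
    · rw [restr_apply_of_mem hE hi, hτ i hi, restr_apply_of_mem hE hi, hτ _ ((hE i).2 hi)]
    · have h2 : τ i ∉ E := fun h' => hi (by
        have := hτ _ h'
        rw [τ.injective this] at h'
        exact h')
      rw [restr_apply_of_notMem hE hi, restr_apply_of_notMem hE h2]
  calc _ = h * (τ * restr y E hE) * τ⁻¹ * h⁻¹ := by group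
    _ = _ := by rw [h1]; group

lemma mul_smul_eq_of_fixed {E : Finset α} (h τ : Perm α) (hτ : ∀ i ∈ E, τ i = i) :
    (h * τ) • E = h • E := by
  rw [mul_smul]
  congr 1
  ext i
  rw [mem_smul_finset]
  exact ⟨fun ⟨j, hj, e⟩ => by rw [← e, Perm.smul_def, hτ j hj]; exact hj,
    fun hi => ⟨i, hi, hτ i hi⟩⟩

lemma restr_conj_apply {y : Perm α} {E : Finset α} (hE : ∀ i, y i ∈ E ↔ i ∈ E) (h : Perm α) {i : α}
    (hi : i ∈ h • E) : (h * restr y E hE * h⁻¹) i = (h * y * h⁻¹) i := by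
  obtain ⟨j, hj, rfl⟩ := mem_smul_finset.1 hi
  simp [restr_apply_of_mem hE hj]

lemma restr_conj_apply_of_notMem {y : Perm α} {E : Finset α} (hE : ∀ i, y i ∈ E ↔ i ∈ E)
    (h : Perm α) {j : α} (hj : j ∉ E) : (h * restr y E hE * h⁻¹) (h j) = h j := by
  simp [restr_apply_of_notMem hE hj]

lemma NoClosed.mul {x y : Perm α} {E : Finset α} (hE : ∀ i, y i ∈ E ↔ i ∈ E) {h τ : Perm α}
    (hτ : ∀ i ∈ E, τ i = i) (hh : NoClosed x y E h) : NoClosed x y E (h * τ) := by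
  intro Z hZ h1 h2 h3
  have hZ' := hZ
  rw [mul_smul_eq_of_fixed h τ hτ] at hZ'
  refine hh Z hZ' h1 (fun i hi => ?_) h3
  rw [← restr_conj_apply hE h (hZ' hi), ← conj_mul_restr hE h τ hτ, restr_conj_apply hE _ (hZ hi)]
  exact h2 i hi

/-- Free points whose dihedral orbit ends at a point fixed by one of the two permutations. -/
noncomputable def dihedralEnds (x y : Perm α) (E : Finset α) (hE : ∀ i, y i ∈ E ↔ i ∈ E)
    (h : Perm α) : Finset α :=
  ({e | x e = e} : Finset α).image (antipode' (h * restr y E hE * h⁻¹ * x)) ∪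
  ({e ∈ h • E | (h * restr y E hE * h⁻¹) e = e} : Finset α).image
    (antipode (h * restr y E hE * h⁻¹ * x))

lemma card_dihedralEnds_le (x y : Perm α) (E : Finset α) (hE : ∀ i, y i ∈ E ↔ i ∈ E) (h : Perm α) :
    #(dihedralEnds x y E hE h) ≤ fixCount x + fixCount y := by
  refine (card_union_le _ _).trans (add_le_add (card_image_le.trans le_rfl) ?_)
  refine card_image_le.trans ?_
  refine card_le_card_of_injOn (fun i => h⁻¹ i) ?_ h⁻¹.injective.injOn
  intro i hi
  obtain ⟨h1, h2⟩ := mem_filter.1 (mem_coe.1 hi)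
  rw [restr_conj_apply hE h h1] at h2
  refine mem_coe.2 (mem_filter.2 ⟨mem_univ _, ?_⟩)
  conv_rhs => rw [← h2]
  simp

lemma dihedralEnds_mul {x y : Perm α} {E : Finset α} (hE : ∀ i, y i ∈ E ↔ i ∈ E) (h τ : Perm α)
    (hτ : ∀ i ∈ E, τ i = i) : dihedralEnds x y E hE (h * τ) = dihedralEnds x y E hE h := by
  rw [dihedralEnds, conj_mul_restr hE h τ hτ, mul_smul_eq_of_fixed h τ hτ, dihedralEnds]

/-- Adding a cycle `(s t)` of `y` can only close an orbit through matched end points. -/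
lemma NoClosed.step {x y : Perm α} {E : Finset α} (hE : ∀ i, y i ∈ E ↔ i ∈ E)
    (hyy : ∀ i ∈ E, y (y i) = i) {s t : α} (hst : y s = t) (hts : y t = s) (hs : s ∉ E) (ht : t ∉ E)
    {h : Perm α} (hh : NoClosed x y E h) (hnot : ¬ NoClosed x y (insert s (insert t E)) h) :
    h s ∈ dihedralEnds x y E hE h ∨
      (s ≠ t ∧ h t = antipode (h * restr y E hE * h⁻¹ * x) (h s)) := by
  unfold NoClosed at hnot
  push Not at hnot
  obtain ⟨Z, hZ, h1, h2, h3, hne⟩ := hnot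
  set r := h * restr y E hE * h⁻¹ with hr
  have hmem : ∀ i ∈ Z, i = h s ∨ i = h t ∨ i ∈ h • E := by
    intro i hi
    obtain ⟨j, hj, rfl⟩ := mem_smul_finset.1 (hZ hi)
    rcases mem_insert.1 hj with rfl | hj
    · simp
    · rcases mem_insert.1 hj with rfl | hj
      · simp
      · exact Or.inr (Or.inr (smul_mem_smul_finset hj))
  have hsZ_iff : h s ∈ Z ↔ h t ∈ Z := by
    constructor
    · intro hi; have := h2 _ hi; simpa [hst] using this
    · intro hi; have := h2 _ hi; simpa [hts] using this
  have hsZ : h s ∈ Z := by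
    by_contra hsZ
    have htZ : h t ∉ Z := fun h' => hsZ (hsZ_iff.2 h')
    refine hne.ne_empty (hh Z (fun i hi => ?_) h1 h2 h3)
    rcases hmem i hi with rfl | rfl | h'
    · exact absurd hi hsZ
    · exact absurd hi htZ
    · exact h'
  have hrs : r (h s) = h s := restr_conj_apply_of_notMem hE h hs
  have hrt : r (h t) = h t := restr_conj_apply_of_notMem hE h ht
  have hrZ : ∀ i ∈ Z, r i ∈ Z := by
    intro i hi
    rcases hmem i hi with rfl | rfl | h'
    · rwa [hrs]
    · rwa [hrt]
    · rw [hr, restr_conj_apply hE h h']; exact h2 i hi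
  have hrr : ∀ i ∈ Z, r (r i) = i := by
    intro i hi
    rcases hmem i hi with rfl | rfl | h'
    · rw [hrs, hrs]
    · rw [hrt, hrt]
    · obtain ⟨j, hj, rfl⟩ := mem_smul_finset.1 h'
      simp [hr, restr_apply_of_mem hE hj, restr_apply_of_mem hE ((hE j).2 hj), hyy j hj]
  rcases dihedral_end h1 hrZ h3 hrr hsZ hrs with ⟨e, -, he, hse⟩ | ⟨h4, h5, h6, h7⟩
  · left
    exact mem_union_left _ (mem_image.2 ⟨e, mem_filter.2 ⟨mem_univ _, he⟩, hse.symm⟩)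
  · rcases hmem _ h4 with h8 | h8 | h8
    · exact absurd h8 h5
    · right
      refine ⟨fun h9 => h5 ?_, h8.symm⟩
      rw [h8, h9]
    · left
      exact mem_union_right _ (mem_image.2 ⟨_, mem_filter.2 ⟨h8, h6⟩, h7.symm⟩)

open Classical in
lemma card_noClosed_ge {x y : Perm α} {W : Finset α} {ε ε' : ℝ} (hε : ε ≤ 1) (hε' : ε' ≤ 1)
    (h1 : (2 * Fintype.card α + (fixCount x + fixCount y) ^ 2 : ℕ) ≤ ε * #W.offDiag)
    (h2 : (fixCount x + fixCount y : ℕ) ≤ ε' * #W) (hW : 0 < #W.offDiag) (E : Finset α) :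
    (∀ i, y i ∈ E ↔ i ∈ E) → (∀ i ∈ E, y (y i) = i) → Disjoint W E →
    (1 - ε) ^ #E * (1 - ε') ^ #{i ∈ E | y i = i} * (Fintype.card α).factorial ≤
      #{h | NoClosed x y E h} := by
  have hε0 : 0 ≤ ε := by
    by_contra hneg
    have : ε * #W.offDiag < 0 := mul_neg_of_neg_of_pos (by linarith) (by exact_mod_cast hW)
    have : (0 : ℝ) ≤ (2 * Fintype.card α + (fixCount x + fixCount y) ^ 2 : ℕ) := by positivity
    linarith
  have hW1 : 0 < #W := by
    rw [card_pos] at hW ⊢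
    obtain ⟨a, ha⟩ := hW
    exact ⟨a.1, (mem_offDiag.1 ha).1⟩
  have hε'0 : 0 ≤ ε' := by
    by_contra hneg
    have : ε' * #W < 0 := mul_neg_of_neg_of_pos (by linarith) (by exact_mod_cast hW1)
    have : (0 : ℝ) ≤ (fixCount x + fixCount y : ℕ) := by positivity
    linarith
  induction E using Finset.strongInduction with
  | H E ih =>
  intro hE hyy hWE
  rcases E.eq_empty_or_nonempty with rfl | ⟨s, hs⟩
  · have : ∀ h : Perm α, NoClosed x y ∅ h := fun h Z hZ _ _ _ => by simpa using hZ
    simp [this, Fintype.card_perm]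
  set t := y s with ht
  have htE : t ∈ E := (hE s).2 hs
  have hts : y t = s := hyy s hs
  set E' := (E.erase t).erase s with hE'
  have hsE' : s ∉ E' := notMem_erase _ _
  have htE' : t ∉ E' := fun h => notMem_erase t E (mem_of_mem_erase h)
  have hins : insert s (insert t E') = E := by
    ext i
    simp only [hE', mem_insert, mem_erase]
    by_cases h1 : i = s
    · simp [h1, hs]
    · by_cases h2 : i = t
      · simp [h2, htE]
      · simp [h1, h2]
  have hsub : E' ⊆ E := (erase_subset _ _).trans (erase_subset _ _)
  have hss : E' ⊂ E := ⟨hsub, fun h => hsE' (h hs)⟩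
  have hinv : ∀ i, y i ∈ E' ↔ i ∈ E' := by
    intro i
    have e1 : y i = s ↔ i = t := by rw [← hts]; exact y.injective.eq_iff
    have e2 : y i = t ↔ i = s := by rw [ht]; exact y.injective.eq_iff
    simp only [hE', mem_erase, hE, Ne, e1, e2]
    tauto
  have hyy' : ∀ i ∈ E', y (y i) = i := fun i hi => hyy i (hsub hi)
  have hWE' : Disjoint W E' := hWE.mono_right hsub
  have hsW : s ∉ W := fun h => disjoint_left.1 hWE h hs
  have htW : t ∉ W := fun h => disjoint_left.1 hWE h htE
  have IH := ih E' hss hinv hyy' hWE'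
  set T : ℝ := (#{h | NoClosed x y E' h} : ℝ) with hT
  have hsplit : T ≤ #{h | NoClosed x y E h} +
      #{h | NoClosed x y E' h ∧ ¬ NoClosed x y E h} := by
    rw [hT]
    norm_cast
    refine (card_le_card (fun h hh => ?_)).trans (card_union_le _ _)
    simp only [mem_filter, mem_univ, true_and, mem_union] at hh ⊢
    tauto
  have hcl : ∀ h τ : Perm α, (∀ i ∈ E', τ i = i) → NoClosed x y E' h → NoClosed x y E' (h * τ) :=
    fun h τ hτ hh => hh.mul hinv hτ
  by_cases hst : s = t
  · have hbad : (#{h | NoClosed x y E' h ∧ ¬ NoClosed x y E h} : ℝ) ≤ ε' * T := by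
      have hb := card_apply_mem_mul_le hcl (dihedralEnds x y E' hinv)
        (fun h τ hτ => dihedralEnds_mul hinv h τ hτ) (card_dihedralEnds_le x y E' hinv) hsE' hWE'
      have hb1 : #{h | NoClosed x y E' h ∧ ¬ NoClosed x y E h} ≤
          #{h | NoClosed x y E' h ∧ h s ∈ dihedralEnds x y E' hinv h} := by
        refine card_le_card fun h hh => ?_
        obtain ⟨-, h3, h4⟩ := mem_filter.1 hh
        refine mem_filter.2 ⟨mem_univ _, h3, ?_⟩
        rw [← hins] at h4
        exact (h3.step hinv hyy' ht.symm hts hsE' htE' h4).resolve_right fun h5 => h5.1 hst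
      have hW' : (0 : ℝ) < #W := by exact_mod_cast hW1
      have hb2 : (#{h | NoClosed x y E' h ∧ ¬ NoClosed x y E h} : ℝ) * #W ≤
          ((fixCount x + fixCount y : ℕ) : ℝ) * T := by
        rw [hT]
        exact_mod_cast (Nat.mul_le_mul_right _ hb1).trans hb
      have hT0 : 0 ≤ T := Nat.cast_nonneg _
      have : (#{h | NoClosed x y E' h ∧ ¬ NoClosed x y E h} : ℝ) * #W ≤ (ε' * T) * #W :=
        hb2.trans (by nlinarith)
      exact le_of_mul_le_mul_right this hW'
    have hfix : #{i ∈ E | y i = i} = #{i ∈ E' | y i = i} + 1 := by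
      rw [← hins, ← hst, insert_idem, filter_insert, if_pos (by rw [← ht, hst]),
        card_insert_of_notMem (fun h => hsE' (mem_filter.1 h).1)]
    have hcard : #E' ≤ #E := card_le_card hsub
    calc _ ≤ (1 - ε) ^ #E' * (1 - ε') ^ (#{i ∈ E' | y i = i} + 1) * (Fintype.card α).factorial := by
          rw [hfix]
          have : (1 - ε) ^ #E ≤ (1 - ε) ^ #E' :=
            pow_le_pow_of_le_one (by linarith) (by linarith) hcard
          have h0 : 0 ≤ 1 - ε' := by linarith
          gcongr
      _ = (1 - ε') * ((1 - ε) ^ #E' * (1 - ε') ^ #{i ∈ E' | y i = i} *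
          (Fintype.card α).factorial) := by ring
      _ ≤ (1 - ε') * T := mul_le_mul_of_nonneg_left IH (by linarith)
      _ ≤ _ := by linarith
  · have hbad : (#{h | NoClosed x y E' h ∧ ¬ NoClosed x y E h} : ℝ) ≤ ε * T := by
      let R : Perm α → Finset (α × α) := fun h =>
        (dihedralEnds x y E' hinv h ×ˢ dihedralEnds x y E' hinv h) ∪
        (univ.image (fun u => (u, antipode (h * restr y E' hinv * h⁻¹ * x) u)) ∪
        univ.image (fun u => (antipode (h * restr y E' hinv * h⁻¹ * x) u, u)))
      have hR : ∀ h τ : Perm α, (∀ i ∈ E', τ i = i) → R (h * τ) = R h := by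
        intro h τ hτ
        simp only [R]
        rw [dihedralEnds_mul hinv h τ hτ, conj_mul_restr hinv h τ hτ]
      have hRc : ∀ h, #(R h) ≤ 2 * Fintype.card α + (fixCount x + fixCount y) ^ 2 := by
        intro h
        have c1 := card_dihedralEnds_le x y E' hinv h
        have c2 : #(univ.image (fun u => (u, antipode (h * restr y E' hinv * h⁻¹ * x) u))) ≤
          Fintype.card α := card_image_le
        have c3 : #(univ.image (fun u => (antipode (h * restr y E' hinv * h⁻¹ * x) u, u))) ≤
          Fintype.card α := card_image_le
        refine (card_union_le _ _).trans ?_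
        have c4 := card_union_le (univ.image (fun u =>
            (u, antipode (h * restr y E' hinv * h⁻¹ * x) u)))
          (univ.image (fun u => (antipode (h * restr y E' hinv * h⁻¹ * x) u, u)))
        rw [card_product]
        nlinarith
      have hb := card_apply_pair_mem_mul_le hcl R hR hRc hst hsE' htE' htW hWE'
      have hb1 : #{h | NoClosed x y E' h ∧ ¬ NoClosed x y E h} ≤
          #{h | NoClosed x y E' h ∧ (h s, h t) ∈ R h} := by
        refine card_le_card fun h hh => ?_
        obtain ⟨-, h3, h4⟩ := mem_filter.1 hh
        refine mem_filter.2 ⟨mem_univ _, h3, ?_⟩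
        rw [← hins] at h4
        have h5 := h3.step hinv hyy' ht.symm hts hsE' htE' h4
        rw [insert_comm] at h4
        have h6 := h3.step hinv hyy' hts ht.symm htE' hsE' h4
        simp only [R, mem_union, mem_product, mem_image, mem_univ, true_and, Prod.mk.injEq]
        rcases h5 with h5 | ⟨-, h5⟩
        · rcases h6 with h6 | ⟨-, h6⟩
          · exact Or.inl ⟨h5, h6⟩
          · exact Or.inr (Or.inr ⟨_, h6.symm, rfl⟩)
        · exact Or.inr (Or.inl ⟨_, rfl, h5.symm⟩)
      have hW' : (0 : ℝ) < #W.offDiag := by exact_mod_cast hW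
      have hb2 : (#{h | NoClosed x y E' h ∧ ¬ NoClosed x y E h} : ℝ) * #W.offDiag ≤
          ((2 * Fintype.card α + (fixCount x + fixCount y) ^ 2 : ℕ) : ℝ) * T := by
        rw [hT]
        exact_mod_cast (Nat.mul_le_mul_right _ hb1).trans hb
      have hT0 : 0 ≤ T := Nat.cast_nonneg _
      have : (#{h | NoClosed x y E' h ∧ ¬ NoClosed x y E h} : ℝ) * #W.offDiag ≤
          (ε * T) * #W.offDiag :=
        hb2.trans (by nlinarith)
      exact le_of_mul_le_mul_right this hW'
    have hfix : #{i ∈ E' | y i = i} ≤ #{i ∈ E | y i = i} := card_le_card (filter_subset_filter _ hsub)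
    have hcard : #E' + 1 ≤ #E := card_lt_card hss
    calc _ ≤ (1 - ε) ^ #E * (1 - ε') ^ #{i ∈ E' | y i = i} * (Fintype.card α).factorial := by
          have h0 : 0 ≤ 1 - ε := by linarith
          gcongr ?_ * ?_ * ?_
          exact pow_le_pow_of_le_one (by linarith) (by linarith) hfix
      _ ≤ (1 - ε) ^ (#E' + 1) * (1 - ε') ^ #{i ∈ E' | y i = i} * (Fintype.card α).factorial := by
          have h0 : 0 ≤ 1 - ε' := by linarith
          gcongr ?_ * ?_ * ?_
          exact pow_le_pow_of_le_one (by linarith) (by linarith) hcard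
      _ = (1 - ε) * ((1 - ε) ^ #E' * (1 - ε') ^ #{i ∈ E' | y i = i} *
          (Fintype.card α).factorial) := by ring
      _ ≤ (1 - ε) * T := mul_le_mul_of_nonneg_left IH (by linarith)
      _ ≤ _ := by linarith

end NoClosed
end FixedOrder

namespace FixedOrder
open Equiv Finset
open scoped Pointwise

lemma exp_neg_two_mul_le {t : ℝ} (h0 : 0 ≤ t) (h1 : t ≤ 1 / 2) : Real.exp (-(2 * t)) ≤ 1 - t := by
  rw [Real.exp_neg, inv_le_comm₀ (Real.exp_pos _) (by linarith), inv_le_iff_one_le_mul₀ (by linarith)]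
  have := Real.add_one_le_exp (2 * t)
  nlinarith

lemma exp_neg_le_one_sub_pow {t C : ℝ} {k : ℕ} (h0 : 0 ≤ t) (h1 : t ≤ 1 / 2) (hk : k * t ≤ C) :
    Real.exp (-(2 * C)) ≤ (1 - t) ^ k := by
  calc Real.exp (-(2 * C)) ≤ Real.exp (-(2 * (k * t))) := Real.exp_le_exp.2 (by linarith)
    _ = Real.exp (-(2 * t)) ^ k := by rw [← Real.exp_nat_mul]; ring_nf
    _ ≤ _ := by gcongr; exact exp_neg_two_mul_le h0 h1

lemma eventually_Pr_noClosed_ge {K δ : ℝ} (hK : 0 < K) (hδ : 0 < δ) :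
    ∃ c : ℝ, 0 < c ∧ ∀ᶠ n : ℕ in atTop, ∀ x y : Perm (Fin n), Good K δ x y →
      c ≤ Pr (NoClosed x y {i | y (y i) = i}) := by
  set C : ℝ := 2 * (2 + 4 * K ^ 2) / δ ^ 2 with hC
  set C' : ℝ := 2 * K / δ with hC'
  have hC0 : 0 < C := by positivity
  have hC'0 : 0 < C' := by positivity
  refine ⟨Real.exp (-(2 * C)) * Real.exp (-(2 * (C' * K))), by positivity, ?_⟩
  have hsq : Tendsto (fun n : ℕ => Real.sqrt n) atTop atTop :=
    Real.tendsto_sqrt_atTop.comp tendsto_natCast_atTop_atTop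
  filter_upwards [tendsto_natCast_atTop_atTop.eventually_ge_atTop (2 * C),
    hsq.eventually_ge_atTop (2 * C'), tendsto_natCast_atTop_atTop.eventually_ge_atTop (2 / δ),
    eventually_gt_atTop 0] with n h1 h2 h3 hn x y ⟨g1, g2, g3⟩
  rw [Fintype.card_fin] at g1 g2 g3
  have hn0 : (0 : ℝ) < n := by exact_mod_cast hn
  have hs0 : 0 < Real.sqrt n := Real.sqrt_pos.2 hn0
  have hss : Real.sqrt n * Real.sqrt n = n := Real.mul_self_sqrt hn0.le
  set W : Finset (Fin n) := {i | 3 ≤ per y i} with hW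
  have hwc : (#W : ℝ) = longCount y := rfl
  rw [← hwc] at g3
  have hw2 : (2 : ℝ) ≤ #W := by
    rw [div_le_iff₀ hδ] at h3
    linarith
  have hoff : (#W.offDiag : ℝ) = #W * #W - #W := by
    rw [offDiag_card, Nat.cast_sub (Nat.le_mul_self _)]
    push_cast; rfl
  have hoff2 : (#W : ℝ) ^ 2 / 2 ≤ #W.offDiag := by rw [hoff]; nlinarith
  have hf : ((fixCount x + fixCount y : ℕ) : ℝ) ≤ 2 * K * Real.sqrt n := by push_cast; linarith
  have hεle : C / n ≤ 1 / 2 := by rw [div_le_iff₀ hn0]; linarith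
  have hε'le : C' / Real.sqrt n ≤ 1 / 2 := by rw [div_le_iff₀ hs0]; linarith
  have key := card_noClosed_ge (x := x) (y := y) (W := W) (ε := C / n) (ε' := C' / Real.sqrt n)
    (by linarith) (by linarith) ?_ ?_ ?_ {i | y (y i) = i} ?_ ?_ ?_
  · rw [Pr_eq_card, le_div_iff₀ (by positivity)]
    refine le_trans ?_ key
    have c1 : #({i | y (y i) = i} : Finset (Fin n)) ≤ n := (card_le_univ _).trans (by simp)
    have c2 : #({i ∈ ({i | y (y i) = i} : Finset (Fin n)) | y i = i}) ≤ fixCount y :=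
      card_le_card (filter_subset_filter _ (subset_univ _))
    have e1 : Real.exp (-(2 * C)) ≤ (1 - C / n) ^ #({i | y (y i) = i} : Finset (Fin n)) := by
      refine exp_neg_le_one_sub_pow (by positivity) hεle ?_
      rw [← mul_div_assoc, div_le_iff₀ hn0]
      have : (#({i | y (y i) = i} : Finset (Fin n)) : ℝ) ≤ n := by exact_mod_cast c1
      nlinarith
    have e2 : Real.exp (-(2 * (C' * K))) ≤
        (1 - C' / Real.sqrt n) ^ #({i ∈ ({i | y (y i) = i} : Finset (Fin n)) | y i = i}) := by
      refine exp_neg_le_one_sub_pow (by positivity) hε'le ?_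
      rw [← mul_div_assoc, div_le_iff₀ hs0]
      have : (#({i ∈ ({i | y (y i) = i} : Finset (Fin n)) | y i = i}) : ℝ) ≤ K * Real.sqrt n :=
        le_trans (by exact_mod_cast c2) g2
      nlinarith
    gcongr
    exact le_trans (by positivity) e1
  · rw [Fintype.card_fin]
    push_cast at hf ⊢
    have h5 : ((fixCount x : ℝ) + fixCount y) ^ 2 ≤ 4 * K ^ 2 * n := by
      calc ((fixCount x : ℝ) + fixCount y) ^ 2 ≤ (2 * K * Real.sqrt n) ^ 2 := by gcongr
        _ = 4 * K ^ 2 * (Real.sqrt n * Real.sqrt n) := by ring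
        _ = _ := by rw [hss]
    have h6 : (δ * n) ^ 2 / 2 ≤ #W.offDiag := le_trans (by gcongr) hoff2
    calc 2 * (n : ℝ) + ((fixCount x : ℝ) + fixCount y) ^ 2 ≤ (2 + 4 * K ^ 2) * n := by linarith
      _ = C / n * ((δ * n) ^ 2 / 2) := by rw [hC]; field_simp
      _ ≤ _ := by gcongr
  · calc ((fixCount x + fixCount y : ℕ) : ℝ) ≤ 2 * K * Real.sqrt n := hf
      _ = C' / Real.sqrt n * (δ * (Real.sqrt n * Real.sqrt n)) := by rw [hC']; field_simp
      _ = C' / Real.sqrt n * (δ * n) := by rw [hss]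
      _ ≤ _ := by gcongr
  · have : (0 : ℝ) < #W.offDiag := lt_of_lt_of_le (by positivity) hoff2
    exact_mod_cast this
  · intro i
    simp
  · intro i hi
    exact (mem_filter.1 hi).2
  · rw [disjoint_left]
    intro i hi hi'
    have h5 : (y ^ 2) i = i := by simpa [sq] using (mem_filter.1 hi').2
    have := Nat.le_of_dvd (by norm_num) (pow_apply_eq_self_iff.1 h5)
    have := (mem_filter.1 hi).2
    omega

section
variable {α : Type*} [Fintype α] [DecidableEq α]

/-- Every nonempty set of at most half of the points is expanded by `x` or by `y`. -/
def Expands (ρ : ℝ) (x y : Perm α) : Prop :=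
  ∀ Z : Finset α, Z.Nonempty → 2 * #Z ≤ Fintype.card α →
    ρ * #Z ≤ #(x • Z \ Z) ∨ ρ * #Z ≤ #(y • Z \ Z)

lemma smul_eq_self_of_card_sdiff_lt_one {x : Perm α} {Z : Finset α} (h : (#(x • Z \ Z) : ℝ) < 1) :
    x • Z = Z := by
  have h1 : #(x • Z \ Z) = 0 := by
    have : #(x • Z \ Z) < 1 := by exact_mod_cast h
    omega
  rw [card_eq_zero, sdiff_eq_empty_iff_subset] at h1
  exact eq_of_subset_of_card_le h1 (by rw [card_smul_finset])

lemma per_lt_three_iff {x : Perm α} {i : α} : per x i < 3 ↔ x (x i) = i := by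
  rw [show x (x i) = (x ^ 2) i by simp [sq], pow_apply_eq_self_iff]
  have := per_pos x i
  constructor
  · intro h
    interval_cases per x i <;> norm_num
  · intro h
    have := Nat.le_of_dvd (by norm_num) h
    omega
end

/-- Expansion has probability bounded away from zero. -/
theorem eventually_Pr_expands_ge {K δ : ℝ} (hK : 0 < K) (hδ : 0 < δ) :
    ∃ c : ℝ, 0 < c ∧ ∀ᶠ n : ℕ in atTop, ∀ x y : Perm (Fin n), Good K δ x y →
      c ≤ Pr (fun h => Expands (rho δ n) x (h * y * h⁻¹)) := by
  obtain ⟨c, hc, hT⟩ := eventually_Pr_noClosed_ge hK hδ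
  have hcube : Tendsto (fun n : ℕ => 1 / (n : ℝ) ^ 3) atTop (nhds 0) := by
    have := (tendsto_pow_atTop (α := ℝ) (n := 3) (by norm_num)).comp
      (tendsto_natCast_atTop_atTop (R := ℝ))
    simp only [one_div]
    exact this.inv_tendsto_atTop
  refine ⟨c / 2, by positivity, ?_⟩
  filter_upwards [hT, eventually_Pr_nearInvariant_le hK hδ,
    eventually_Pr_invariant_long_le hK hδ (η := c / 4) (by positivity),
    hcube.eventually_le_const (u := c / 4) (by positivity)] with n h1 h2 h3 h4 x y hG
  have e1 := h1 x y hG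
  have e2 := (h2 x y hG).trans h4
  have e3 := h3 x y hG
  have key : Pr (NoClosed x y {i | y (y i) = i}) ≤
      Pr (fun h => Expands (rho δ n) x (h * y * h⁻¹) ∨
        ((∃ Z : Finset (Fin n), 1 ≤ rho δ n * #Z ∧ 2 * #Z ≤ n ∧
        #(x • Z \ Z) < rho δ n * #Z ∧ #((h * y * h⁻¹) • Z \ Z) < rho δ n * #Z) ∨
        (∃ Z : Finset (Fin n), rho δ n * #Z ≤ 1 ∧ x • Z = Z ∧ (h * y * h⁻¹) • Z = Z ∧
        ∃ i ∈ Z, 3 ≤ per x i ∨ 3 ≤ per (h * y * h⁻¹) i))) := by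
    apply Pr_mono
    intro h hh
    by_contra hcon
    push Not at hcon
    obtain ⟨h5, h6, h7⟩ := hcon
    unfold Expands at h5
    push Not at h5
    obtain ⟨Z, hne, h8, h9, h10⟩ := h5
    rw [Fintype.card_fin] at h8
    by_cases h11 : 1 ≤ rho δ n * #Z
    · exact absurd h10 (not_lt.2 (h6 Z h11 h8 h9))
    push Not at h11
    have hx := smul_eq_self_of_card_sdiff_lt_one (h9.trans h11)
    have hy := smul_eq_self_of_card_sdiff_lt_one (h10.trans h11)
    have h12 := h7 Z h11.le hx hy
    refine hne.ne_empty (hh Z (fun i hi => ?_) (fun i hi => ?_) (fun i hi => ?_) fun i hi => ?_)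
    · rw [mem_smul_finset]
      refine ⟨h⁻¹ i, mem_filter.2 ⟨mem_univ _, ?_⟩, by simp⟩
      have := per_lt_three_iff.1 (h12 i hi).2
      have h13 := congrArg (fun j => h⁻¹ j) this
      simpa using h13
    · have := smul_mem_smul_finset (a := x) hi
      rwa [hx] at this
    · have := smul_mem_smul_finset (a := h * y * h⁻¹) hi
      rwa [hy] at this
    · exact per_lt_three_iff.1 (h12 i hi).1
  have h5 := key.trans (Pr_or_le _ _)
  have h6 := Pr_or_le (fun h => ∃ Z : Finset (Fin n), 1 ≤ rho δ n * #Z ∧ 2 * #Z ≤ n ∧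
        #(x • Z \ Z) < rho δ n * #Z ∧ #((h * y * h⁻¹) • Z \ Z) < rho δ n * #Z)
    (fun h => ∃ Z : Finset (Fin n), rho δ n * #Z ≤ 1 ∧ x • Z = Z ∧ (h * y * h⁻¹) • Z = Z ∧
        ∃ i ∈ Z, 3 ≤ per x i ∨ 3 ≤ per (h * y * h⁻¹) i)
  linarith

end FixedOrder

namespace FixedOrder
open Equiv Finset
open scoped Pointwise

section
variable {α : Type*} [Fintype α] [DecidableEq α]

lemma card_cycles_le (x : Perm α) :
    (#(cycles x) : ℝ) ≤ (Fintype.card α : ℝ) / 2 + (fixCount x : ℝ) / 2 - (longCount x : ℝ) / 6 := by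
  have h := sum_cycles x fun _ => 1
  simp only [sum_const, nsmul_eq_mul, mul_one] at h
  have e1 : (Fintype.card α : ℝ) = ∑ _i : α, (1 : ℝ) := by simp
  have e2 : (fixCount x : ℝ) = ∑ i : α, if x i = i then (1 : ℝ) else 0 := by simp [fixCount]
  have e3 : (longCount x : ℝ) = ∑ i : α, if 3 ≤ per x i then (1 : ℝ) else 0 := by simp [longCount]
  rw [h, e1, e2, e3, sum_div, sum_div, sum_div, ← sum_add_distrib, ← sum_sub_distrib]
  refine sum_le_sum fun i _ => ?_
  simp only [← per_eq_one_iff]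
  have := per_pos x i
  by_cases h1 : per x i = 1
  · simp [h1]; norm_num
  by_cases h2 : 3 ≤ per x i
  · rw [if_neg h1, if_pos h2, div_le_iff₀ (by positivity)]
    have : (3 : ℝ) ≤ per x i := by exact_mod_cast h2
    linarith
  · have : per x i = 2 := by omega
    rw [if_neg h1, if_neg h2, this]
    norm_num

open Classical in
lemma card_labelling_le (x : Perm α) (r : ℕ) :
    #{φ : α → Fin r | ∃ σ : Perm (Fin r), ∀ a, φ (x a) = σ (φ a)} ≤
      r.factorial * r ^ #(cycles x) := by
  have hsub : ({φ : α → Fin r | ∃ σ : Perm (Fin r), ∀ a, φ (x a) = σ (φ a)} : Finset _) ⊆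
      (univ : Finset (Perm (Fin r))).biUnion
        fun σ => {φ : α → Fin r | ∀ a, φ (x a) = σ (φ a)} := by
    intro φ hφ
    simpa using hφ
  refine (card_le_card hsub).trans (card_biUnion_le.trans ?_)
  have key : ∀ σ ∈ (univ : Finset (Perm (Fin r))),
      #{φ : α → Fin r | ∀ a, φ (x a) = σ (φ a)} ≤ r ^ #(cycles x) := by
    intro σ _
    have hne : ∀ c : cycles x, ∃ a, cyc x a = c := fun c => by
      obtain ⟨a, -, ha⟩ := mem_image.1 c.2
      exact ⟨a, ha⟩
    choose rep hrep using hne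
    calc #{φ : α → Fin r | ∀ a, φ (x a) = σ (φ a)} ≤ #(univ : Finset (cycles x → Fin r)) := by
          refine card_le_card_of_injOn (fun φ c => φ (rep c)) (fun _ _ => by simp) ?_
          intro φ hφ ψ hψ he
          simp only [coe_filter, mem_univ, true_and, Set.mem_ofPred_eq] at hφ hψ
          have hpow : ∀ θ : α → Fin r, (∀ a, θ (x a) = σ (θ a)) → ∀ (k : ℕ) a,
              θ ((x ^ k) a) = (σ ^ k) (θ a) := by
            intro θ hθ k a
            induction k with
            | zero => simp
            | succ k ih => rw [pow_succ', pow_succ', Perm.mul_apply, Perm.mul_apply, hθ, ih]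
          funext a
          have hc : cyc x a ∈ cycles x := mem_image_of_mem _ (mem_univ a)
          have h1 : a ∈ cyc x (rep ⟨_, hc⟩) := by
            rw [hrep]; exact self_mem_cyc x a
          obtain ⟨k, hk⟩ := mem_cyc.1 h1
          rw [← hk, hpow φ hφ, hpow ψ hψ]
          exact congrArg _ (congrFun he _)
      _ = r ^ #(cycles x) := by simp
  calc ∑ σ : Perm (Fin r), #{φ : α → Fin r | ∀ a, φ (x a) = σ (φ a)}
      ≤ ∑ _σ : Perm (Fin r), r ^ #(cycles x) := sum_le_sum key
    _ = _ := by simp [Fintype.card_perm]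

open Classical in
lemma card_comp_eq_le {r d : ℕ} (φ ψ : α → Fin r) (hφ : ∀ j, #{a | φ a = j} = d) :
    #{h : Perm α | φ ∘ h = ψ} ≤ d.factorial ^ r := by
  by_cases hex : ∃ h₀ : Perm α, φ ∘ h₀ = ψ
  · obtain ⟨h₀, hh₀⟩ := hex
    have h1 := DomMulAct.stabilizer_card (f := φ)
    have h2 : ∀ i, Fintype.card {a // φ a = i} = d := fun i => by
      rw [Fintype.card_subtype, hφ]
    simp only [h2, prod_const, card_univ, Fintype.card_fin] at h1
    rw [← h1, Fintype.card_subtype]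
    refine card_le_card_of_injOn (fun h => h * h₀⁻¹) ?_ ?_
    · intro h hh
      simp only [coe_filter, mem_univ, true_and, Set.mem_ofPred_eq] at hh ⊢
      funext a
      have h3 := congrFun (hh.trans hh₀.symm) (h₀⁻¹ a)
      simpa using h3
    · intro g _ g' _ h
      simpa using h
  · have : #{h : Perm α | φ ∘ h = ψ} = 0 := by
      rw [card_eq_zero, filter_eq_empty_iff]
      exact fun g _ hg => hex ⟨g, hg⟩
    omega

/-- A common equal-size labelling of `x` and `z` by `r` labels with fibres of size `d`. -/
def Labelled (r d : ℕ) (x z : Perm α) : Prop :=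
  ∃ φ : α → Fin r, (∀ j, #{a | φ a = j} = d) ∧
    (∃ σ : Perm (Fin r), ∀ a, φ (x a) = σ (φ a)) ∧ ∃ σ : Perm (Fin r), ∀ a, φ (z a) = σ (φ a)

lemma Pr_labelled_le (x y : Perm α) (r d : ℕ) :
    Pr (fun h => Labelled r d x (h * y * h⁻¹)) ≤
      (r.factorial * r ^ #(cycles x) * (r.factorial * r ^ #(cycles y)) * d.factorial ^ r : ℕ) /
        (Fintype.card α).factorial := by
  classical
  rw [Pr_eq_card]
  gcongr
  set A : Finset (α → Fin r) := {φ | ∃ σ : Perm (Fin r), ∀ a, φ (x a) = σ (φ a)} with hA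
  set B : Finset (α → Fin r) := {φ | ∃ σ : Perm (Fin r), ∀ a, φ (y a) = σ (φ a)} with hB
  have hsub : ({h : Perm α | Labelled r d x (h * y * h⁻¹)} : Finset _) ⊆
      ((A.filter fun φ => ∀ j, #{a | φ a = j} = d) ×ˢ B).biUnion
        fun P => {h : Perm α | P.1 ∘ h = P.2} := by
    intro h hh
    obtain ⟨φ, hd, h1, σ, h2⟩ := (mem_filter.1 hh).2
    simp only [mem_biUnion, mem_product, mem_filter, mem_univ, true_and, Prod.exists, hA, hB]
    refine ⟨φ, φ ∘ h, ⟨⟨h1, hd⟩, σ, fun a => ?_⟩, rfl⟩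
    have := h2 (h a)
    simpa using this
  refine (card_le_card hsub).trans (card_biUnion_le.trans ?_)
  calc ∑ P ∈ (A.filter fun φ => ∀ j, #{a | φ a = j} = d) ×ˢ B, #{h : Perm α | P.1 ∘ h = P.2}
      ≤ ∑ P ∈ (A.filter fun φ => ∀ j, #{a | φ a = j} = d) ×ˢ B, d.factorial ^ r :=
        sum_le_sum fun P hP => card_comp_eq_le _ _ (mem_filter.1 (mem_product.1 hP).1).2
    _ = #(A.filter fun φ => ∀ j, #{a | φ a = j} = d) * #B * d.factorial ^ r := by
        rw [sum_const, smul_eq_mul, card_product]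
    _ ≤ _ := by
        gcongr
        · exact (card_filter_le _ _).trans (card_labelling_le x r)
        · exact card_labelling_le y r

lemma factorial_pow_mul_pow_le {r d : ℕ} (hr : 0 < r) (hd : 0 < d) :
    (d.factorial : ℝ) ^ r * (r : ℝ) ^ (r * d) ≤
      (Real.exp 1 * d) ^ r * (r * d).factorial := by
  have h1 : ((d.factorial : ℝ) * Real.exp d) ^ r ≤ (Real.exp 1 * d * (d : ℝ) ^ d) ^ r := by
    have := factorial_mul_exp_le hd
    gcongr
  have h2 := pow_self_le_exp_mul_factorial (r * d)
  have h3 : Real.exp ((r * d : ℕ) : ℝ) = Real.exp d ^ r := by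
    rw [← Real.exp_nat_mul]; push_cast; ring_nf
  have h4 : ((r * d : ℕ) : ℝ) ^ (r * d) = (r : ℝ) ^ (r * d) * ((d : ℝ) ^ d) ^ r := by
    push_cast; rw [mul_pow]; congr 1; rw [← pow_mul, mul_comm]
  rw [h3, h4] at h2
  have hd' : (0 : ℝ) < d := by exact_mod_cast hd
  have hpos : 0 < Real.exp d ^ r * ((d : ℝ) ^ d) ^ r := by positivity
  refine le_of_mul_le_mul_right ?_ hpos
  calc _ = ((d.factorial : ℝ) * Real.exp d) ^ r * ((r : ℝ) ^ (r * d) * ((d : ℝ) ^ d) ^ r) := by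
        rw [mul_pow]; ring
    _ ≤ (Real.exp 1 * d * (d : ℝ) ^ d) ^ r * (Real.exp d ^ r * (r * d).factorial) := by gcongr
    _ = _ := by rw [mul_pow]; ring

lemma Pr_labelled_le_exp {x y : Perm α} {r d : ℕ} (hr : 0 < r) (hd : 0 < d)
    (hn : r * d = Fintype.card α) :
    Pr (fun h => Labelled r d x (h * y * h⁻¹)) ≤
      Real.exp (r * (1 + 3 * Real.log (Fintype.card α)) -
        Real.log r * (Fintype.card α - #(cycles x) - #(cycles y))) := by
  refine (Pr_labelled_le x y r d).trans ?_
  have hr' : (0 : ℝ) < r := by exact_mod_cast hr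
  have hd' : (0 : ℝ) < d := by exact_mod_cast hd
  set n := Fintype.card α with hndef
  have hrn : r ≤ n := hn ▸ Nat.le_mul_of_pos_right r hd
  have hdn : d ≤ n := hn ▸ Nat.le_mul_of_pos_left d hr
  have hn0 : (0 : ℝ) < n := lt_of_lt_of_le hr' (by exact_mod_cast hrn)
  have hexp : Real.exp (r * (1 + 3 * Real.log n) - Real.log r * (n - #(cycles x) - #(cycles y))) =
      (Real.exp 1 * n ^ 3) ^ r * ((r : ℝ) ^ #(cycles x) * (r : ℝ) ^ #(cycles y)) / (r : ℝ) ^ n := by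
    have e1 : ∀ k : ℕ, (r : ℝ) ^ k = Real.exp (k * Real.log r) := fun k => by
      rw [Real.exp_nat_mul, Real.exp_log hr']
    have e2 : (n : ℝ) ^ 3 = Real.exp (3 * Real.log n) := by
      rw [show (3 : ℝ) = ((3 : ℕ) : ℝ) by norm_num, Real.exp_nat_mul, Real.exp_log hn0]
    rw [e1, e1, e1, e2, ← Real.exp_add, ← Real.exp_nat_mul, ← Real.exp_add, ← Real.exp_add,
      ← Real.exp_sub]
    congr 1
    ring
  rw [hexp, div_le_div_iff₀ (by positivity) (by positivity)]
  have h1 := factorial_pow_mul_pow_le hr hd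
  rw [hn] at h1
  have h2 : (r.factorial : ℝ) ≤ (n : ℝ) ^ r :=
    (by exact_mod_cast r.factorial_le_pow : (r.factorial : ℝ) ≤ (r : ℝ) ^ r).trans (by gcongr)
  push_cast
  calc (r.factorial : ℝ) * r ^ #(cycles x) * (r.factorial * r ^ #(cycles y)) *
        d.factorial ^ r * r ^ n
      = (r.factorial * r.factorial * ((r : ℝ) ^ #(cycles x) * r ^ #(cycles y))) *
        ((d.factorial : ℝ) ^ r * r ^ n) := by ring
    _ ≤ ((n : ℝ) ^ r * (n : ℝ) ^ r * ((r : ℝ) ^ #(cycles x) * r ^ #(cycles y))) *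
        ((Real.exp 1 * n) ^ r * n.factorial) := by
        refine mul_le_mul ?_ (h1.trans ?_) (by positivity) (by positivity)
        · gcongr
        · gcongr
    _ = _ := by ring

end

/-- A nontrivial system of imprimitivity with large blocks is unlikely. -/
theorem eventually_Pr_labelled_le {K δ ε η : ℝ} (hδ : 0 < δ) (hε : 0 < ε) (hη : 0 < η) :
    ∀ᶠ n : ℕ in atTop, ∀ x y : Perm (Fin n), Good K δ x y →
      Pr (fun h => ∃ r d : ℕ, 2 ≤ r ∧ (n : ℝ) ^ ε ≤ d ∧ r * d = n ∧
        Labelled r d x (h * y * h⁻¹)) ≤ η := by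
  have hl : ∀ᶠ n : ℕ in atTop, 1 + 3 * Real.log n ≤ δ / 48 * (n : ℝ) ^ ε := by
    have h1 : (fun t : ℝ => 1 + 3 * Real.log t) =o[atTop] fun t => t ^ ε :=
      (isLittleO_const_left.2 (Or.inr (tendsto_norm_atTop_atTop.comp (tendsto_rpow_atTop hε)))).add
        ((isLittleO_log_rpow_atTop hε).const_mul_left 3)
    have h2 := tendsto_natCast_atTop_atTop (R := ℝ) |>.eventually
      (h1.bound (show 0 < δ / 48 by positivity))
    filter_upwards [h2, eventually_gt_atTop 0] with n h3 hn
    have hn : (0 : ℝ) < n := by exact_mod_cast hn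
    rw [Real.norm_of_nonneg (by positivity : 0 ≤ (n : ℝ) ^ ε)] at h3
    exact (le_abs_self _).trans h3
  have hs : ∀ᶠ n : ℕ in atTop, K * Real.sqrt n ≤ δ / 12 * n := by
    have h1 : Tendsto (fun n : ℕ => Real.sqrt n) atTop atTop :=
      Real.tendsto_sqrt_atTop.comp tendsto_natCast_atTop_atTop
    filter_upwards [h1.eventually_ge_atTop (12 * K / δ)] with n h2
    rw [div_le_iff₀ hδ] at h2
    have := mul_le_mul_of_nonneg_right h2 (Real.sqrt_nonneg n)
    have h3 : Real.sqrt n * Real.sqrt n = n := Real.mul_self_sqrt (Nat.cast_nonneg _)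
    linear_combination (1 / 12) * this + δ / 12 * h3
  have he : Tendsto (fun n : ℕ => (n : ℝ) * Real.exp (-(δ / 48) * n)) atTop (nhds 0) := by
    have := (Real.tendsto_pow_mul_exp_neg_atTop_nhds_zero 1).comp
      ((tendsto_natCast_atTop_atTop (R := ℝ)).const_mul_atTop (show 0 < δ / 48 by positivity))
    have := this.const_mul (48 / δ)
    rw [mul_zero] at this
    refine this.congr fun n => ?_
    simp only [Function.comp, pow_one]
    rw [neg_mul]
    field_simp
  filter_upwards [hl, hs, he.eventually_le_const (u := η) (by positivity),
    eventually_gt_atTop 0] with n h1 h2 h3 hn x y hG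
  have hn0 : (0 : ℝ) < n := by exact_mod_cast hn
  have hn1 : (1 : ℝ) ≤ n := by exact_mod_cast hn
  obtain ⟨g1, g2, g3⟩ := hG
  have c1 := card_cycles_le x
  have c2 := card_cycles_le y
  rw [Fintype.card_fin] at *
  have hterm : ∀ r ∈ Icc 1 n, Pr (fun h => 2 ≤ r ∧ ∃ d : ℕ, (n : ℝ) ^ ε ≤ d ∧ r * d = n ∧
      Labelled r d x (h * y * h⁻¹)) ≤ Real.exp (-(δ / 48) * n) := by
    intro r hr
    have hr1 := (mem_Icc.1 hr).1
    by_cases hcon : 2 ≤ r ∧ (n : ℝ) ^ ε ≤ (n / r : ℕ) ∧ r * (n / r) = n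
    · obtain ⟨hr2, hd, hrd⟩ := hcon
      have hd0 : 0 < n / r := by
        rcases Nat.eq_zero_or_pos (n / r) with h0 | h0
        · rw [h0, mul_zero] at hrd; omega
        · exact h0
      have hb := Pr_labelled_le_exp (x := x) (y := y) (r := r) (d := n / r) (by omega) hd0
        (by rw [Fintype.card_fin, hrd])
      rw [Fintype.card_fin] at hb
      refine (Pr_mono ?_).trans (hb.trans (Real.exp_le_exp.2 ?_))
      · rintro h ⟨-, d, -, hd2, hd3⟩
        have : d = n / r := (Nat.div_eq_of_eq_mul_right (by omega) hd2.symm).symm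
        rwa [← this]
      · have hlog : (1 : ℝ) / 2 ≤ Real.log r := by
          have := Real.log_two_gt_d9
          have h4 : Real.log 2 ≤ Real.log r := Real.log_le_log (by norm_num) (by exact_mod_cast hr2)
          linarith
        have h5 : δ / 12 * n ≤ n - #(cycles x) - #(cycles y) := by
          have : (0 : ℝ) ≤ longCount x := Nat.cast_nonneg _
          linarith
        have h6 : δ / 24 * n ≤ Real.log r * (n - #(cycles x) - #(cycles y)) := by
          calc δ / 24 * n = 1 / 2 * (δ / 12 * n) := by ring
            _ ≤ _ := mul_le_mul hlog h5 (by positivity) (by linarith)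
        have h7 : (r : ℝ) * (n : ℝ) ^ ε ≤ n := by
          calc (r : ℝ) * (n : ℝ) ^ ε ≤ r * (n / r : ℕ) := by gcongr
            _ = n := by exact_mod_cast hrd
        have h8 : (r : ℝ) * (1 + 3 * Real.log n) ≤ δ / 48 * n := by
          calc (r : ℝ) * (1 + 3 * Real.log n) ≤ r * (δ / 48 * (n : ℝ) ^ ε) := by gcongr
            _ = δ / 48 * (r * (n : ℝ) ^ ε) := by ring
            _ ≤ _ := by gcongr
        linarith
    · refine le_trans (Pr_mono (B := fun _ => False) ?_) ?_
      · rintro h ⟨hr2, d, hd1, hd2, hd3⟩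
        have : d = n / r := (Nat.div_eq_of_eq_mul_right (by omega) hd2.symm).symm
        subst this
        exact hcon ⟨hr2, hd1, hd2⟩
      · simp only [Pr, if_false, Ex_const]
        positivity
  calc _ ≤ Pr (fun h => ∃ r ∈ Icc 1 n, 2 ≤ r ∧ ∃ d : ℕ, (n : ℝ) ^ ε ≤ d ∧ r * d = n ∧
        Labelled r d x (h * y * h⁻¹)) := by
        apply Pr_mono
        rintro h ⟨r, d, hr, hd, hrd, hL⟩
        have : 0 < d := by
          rcases Nat.eq_zero_or_pos d with h0 | h0
          · rw [h0, mul_zero] at hrd; omega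
          · exact h0
        refine ⟨r, mem_Icc.2 ⟨by omega, ?_⟩, hr, d, hd, hrd, hL⟩
        rw [← hrd]; exact Nat.le_mul_of_pos_right r this
    _ ≤ ∑ r ∈ Icc 1 n, Real.exp (-(δ / 48) * n) := (Pr_exists_le _ _).trans (sum_le_sum hterm)
    _ = n * Real.exp (-(δ / 48) * n) := by simp
    _ ≤ η := h3

end FixedOrder

namespace FixedOrder
open Equiv Finset
open scoped Pointwise

section
variable {α : Type*} [Fintype α] [DecidableEq α]

/-- The product of `x` with the `h`-conjugate of `y`. -/
def mix (x y h : Perm α) : Perm α := h * y * h⁻¹ * x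

lemma mix_swap (x y h : Perm α) (a b : α) :
    mix x y (swap a b * h) = swap a b * mix x y h * swap (x⁻¹ a) (x⁻¹ b) := by
  have h1 := swap_mul_eq_mul_swap x a b
  simp only [mix, mul_inv_rev, swap_inv, mul_assoc]
  rw [h1]

lemma sum_switch_le {x y : Perm α} {ℓ : ℕ} {f W : Perm α → α → ℝ} {m : ℝ}
    (B : Perm α → α → Finset α) (hf : ∀ h a, 0 ≤ f h a) (hW : ∀ h a, 0 ≤ W h a)
    (hm : ∀ h a, f h a ≠ 0 → m ≤ #(B h a))
    (hB : ∀ h a b, f h a ≠ 0 → b ∈ B h a →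
      (mix x y (swap a b * h) ^ ℓ) a = b ∧ f h a ≤ W (swap a b * h) a) :
    m * Ex (fun h => ∑ a, f h a) ≤ Ex (fun h => ∑ a, W h a) := by
  rw [← Ex_mul_left]
  unfold Ex
  have := card_perm_pos (α := α)
  gcongr ?_ / _
  have h1 : ∑ h : Perm α, m * ∑ a, f h a ≤
      ∑ P : (Perm α × α) × α, if f P.1.1 P.1.2 ≠ 0 ∧ P.2 ∈ B P.1.1 P.1.2 then
        W (swap P.1.2 P.2 * P.1.1) P.1.2 else 0 := by
    rw [Fintype.sum_prod_type, Fintype.sum_prod_type]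
    refine sum_le_sum fun h _ => ?_
    rw [mul_sum]
    refine sum_le_sum fun a _ => ?_
    by_cases h0 : f h a = 0
    · simp [h0]
    · simp only [ne_eq, h0, not_false_eq_true, true_and]
      rw [← sum_filter, filter_mem_eq_inter, univ_inter]
      calc m * f h a ≤ #(B h a) * f h a := mul_le_mul_of_nonneg_right (hm h a h0) (hf h a)
        _ = ∑ b ∈ B h a, f h a := by simp
        _ ≤ _ := sum_le_sum fun b hb => (hB h a b h0 hb).2
  refine h1.trans ?_
  rw [← sum_filter, ← Fintype.sum_prod_type' (f := W)]
  set T : Finset ((Perm α × α) × α) :=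
    {P | f P.1.1 P.1.2 ≠ 0 ∧ P.2 ∈ B P.1.1 P.1.2} with hT
  have hinj : Set.InjOn (fun P : (Perm α × α) × α => (swap P.1.2 P.2 * P.1.1, P.1.2)) T := by
    rintro ⟨⟨h, a⟩, b⟩ hP ⟨⟨h', a'⟩, b'⟩ hP' he
    simp only [Prod.mk.injEq] at he
    obtain ⟨he1, rfl⟩ := he
    simp only [hT, coe_filter, mem_univ, true_and, Set.mem_ofPred_eq] at hP hP'
    have e1 := (hB h a b hP.1 hP.2).1
    have e2 := (hB h' a b' hP'.1 hP'.2).1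
    rw [← he1, e1] at e2
    subst e2
    simpa using he1
  rw [← sum_image (f := fun P : Perm α × α => W P.1 P.2) hinj]
  exact sum_le_sum_of_subset_of_nonneg (subset_univ _) fun _ _ _ => hW _ _

/-- The `g`-cycle of `a` is opened by a switch and becomes a path ending in `b`. -/
lemma switch_path {g : Perm α} {a b u v : α} (hb : b ∉ cyc g a) (hu : u ∉ cyc g a)
    (hv : v ∉ cyc g a) :
    path (swap a b * g * swap u v) a (per g a) = cyc g a ∧
      ((swap a b * g * swap u v) ^ per g a) a = b := by
  set g' := swap a b * g * swap u v with hg'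
  have hstep : ∀ z ∈ cyc g a, g' z = swap a b (g z) := by
    intro z hz
    have h1 : z ≠ u := fun h => hu (h ▸ hz)
    have h2 : z ≠ v := fun h => hv (h ▸ hz)
    simp [hg', swap_apply_of_ne_of_ne h1 h2]
  have hpow : ∀ i, i < per g a → (g' ^ i) a = (g ^ i) a := by
    refine pow_eq_of_agree fun i hi => ?_
    rw [hstep _ (pow_mem_cyc g a i)]
    have h3 : g ((g ^ i) a) = (g ^ (i + 1)) a := by rw [pow_succ']; rfl
    rw [h3]
    refine swap_apply_of_ne_of_ne (fun h => ?_) (fun h => ?_)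
    · have := Nat.le_of_dvd (by omega) (pow_apply_eq_self_iff.1 h)
      omega
    · exact hb (h ▸ pow_mem_cyc g a (i + 1))
  constructor
  · rw [cyc_eq_path]
    exact image_congr fun i hi => hpow i (by simpa using hi)
  · obtain ⟨k, hk⟩ : ∃ k, per g a = k + 1 := ⟨per g a - 1, by have := per_pos g a; omega⟩
    rw [hk, pow_succ', Perm.mul_apply, hpow k (by omega), hstep _ (pow_mem_cyc g a k)]
    have h3 : g ((g ^ k) a) = (g ^ per g a) a := by rw [hk, pow_succ']; rfl
    rw [h3, pow_per, swap_apply_left]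

/-- A cycle avoiding the four switched points is kept. -/
lemma switch_cyc {g : Perm α} {a b u v s : α} (ha : a ∉ cyc g s) (hb : b ∉ cyc g s)
    (hu : u ∉ cyc g s) (hv : v ∉ cyc g s) : cyc (swap a b * g * swap u v) s = cyc g s := by
  refine cyc_eq_of_agree fun z hz => ?_
  have h1 : z ≠ u := fun h => hu (h ▸ hz)
  have h2 : z ≠ v := fun h => hv (h ▸ hz)
  have h5 := apply_mem_cyc hz
  have h3 : g z ≠ a := fun h => ha (h ▸ h5)
  have h4 : g z ≠ b := fun h => hb (h ▸ h5)
  simp [swap_apply_of_ne_of_ne h1 h2, swap_apply_of_ne_of_ne h3 h4]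

/-- The points that avoid `U` together with their `x`-preimages. -/
def avoiding (x : Perm α) (U : Finset α) : Finset α := {b | b ∉ U ∧ x⁻¹ b ∉ U}

lemma card_avoiding_ge (x : Perm α) (U : Finset α) :
    (Fintype.card α : ℝ) - 2 * #U ≤ #(avoiding x U) := by
  have h1 : (univ : Finset α) ⊆ avoiding x U ∪ (U ∪ x • U) := by
    intro b _
    simp only [avoiding, mem_union, mem_filter, mem_univ, true_and]
    by_cases h2 : b ∈ U
    · exact Or.inr (Or.inl h2)
    · by_cases h3 : x⁻¹ b ∈ U
      · exact Or.inr (Or.inr (mem_smul_finset.2 ⟨_, h3, by simp⟩))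
      · exact Or.inl ⟨h2, h3⟩
  have h2 := card_le_card h1
  have h3 := card_union_le (avoiding x U) (U ∪ x • U)
  have h4 := card_union_le U (x • U)
  rw [card_smul_finset] at h4
  rw [card_univ] at h2
  have : Fintype.card α ≤ #(avoiding x U) + 2 * #U := by omega
  have : (Fintype.card α : ℝ) ≤ #(avoiding x U) + 2 * #U := by exact_mod_cast this
  linarith

open Classical in
/-- The expected number of points on `ℓ`-cycles of `mix x y h` whose `x`-preimage is off the
cycle. -/
lemma Ex_open_le (x y : Perm α) (ℓ : ℕ) :
    ((Fintype.card α : ℝ) - 2 * ℓ) * Ex (fun h =>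
      (#{a | per (mix x y h) a = ℓ ∧ x⁻¹ a ∉ cyc (mix x y h) a} : ℝ)) ≤ Fintype.card α := by
  have := sum_switch_le (x := x) (y := y) (ℓ := ℓ) (m := (Fintype.card α : ℝ) - 2 * ℓ)
    (f := fun h a => if per (mix x y h) a = ℓ ∧ x⁻¹ a ∉ cyc (mix x y h) a then 1 else 0)
    (W := fun _ _ => 1) (fun h a => avoiding x (cyc (mix x y h) a))
    (fun _ _ => by positivity) (fun _ _ => by norm_num) ?_ ?_
  · simpa [Ex_const] using this
  · intro h a hf
    have hf : per (mix x y h) a = ℓ ∧ x⁻¹ a ∉ cyc (mix x y h) a := by simpa using hf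
    have := card_avoiding_ge x (cyc (mix x y h) a)
    rwa [card_cyc, hf.1] at this
  · intro h a b hf hb
    have hf : per (mix x y h) a = ℓ ∧ x⁻¹ a ∉ cyc (mix x y h) a := by simpa using hf
    have hb := (mem_filter.1 hb).2
    have := (switch_path hb.1 hf.2 hb.2).2
    rw [hf.1] at this
    rw [mix_swap]
    exact ⟨this, by split_ifs; norm_num⟩

open Classical in
/-- The one-sided pair bound: the cycle of `s` is kept and that of `a` is opened. -/
lemma Ex_pair_open_le (x y : Perm α) {p ℓ : ℕ} (𝒮 : Finset α → Prop) (h𝒮 : ∀ S, 𝒮 S → #S = p)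
    (Q : Finset α → Finset α → ℝ) (hQ : ∀ S Z, 0 ≤ Q S Z) {q : ℝ}
    (hq : ∀ (g : Perm α) S, 𝒮 S → ∑ a, Q S (path g a ℓ) ≤ q) :
    ((Fintype.card α : ℝ) - 2 * (p + ℓ)) * Ex (fun h => ∑ s, ∑ a,
      if 𝒮 (cyc (mix x y h) s) ∧ per (mix x y h) a = ℓ ∧ a ∉ cyc (mix x y h) s ∧
        x⁻¹ a ∉ cyc (mix x y h) s ∧ x⁻¹ a ∉ cyc (mix x y h) a then
        Q (cyc (mix x y h) s) (cyc (mix x y h) a) else 0) ≤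
      q * Ex (fun h => (#{s | 𝒮 (cyc (mix x y h) s)} : ℝ)) := by
  have key : ∀ s : α, ((Fintype.card α : ℝ) - 2 * (p + ℓ)) * Ex (fun h => ∑ a,
      if 𝒮 (cyc (mix x y h) s) ∧ per (mix x y h) a = ℓ ∧ a ∉ cyc (mix x y h) s ∧
        x⁻¹ a ∉ cyc (mix x y h) s ∧ x⁻¹ a ∉ cyc (mix x y h) a then
        Q (cyc (mix x y h) s) (cyc (mix x y h) a) else 0) ≤
      Ex (fun h => ∑ a, if 𝒮 (cyc (mix x y h) s) then
        Q (cyc (mix x y h) s) (path (mix x y h) a ℓ) else 0) := by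
    intro s
    refine sum_switch_le (x := x) (y := y) (ℓ := ℓ)
      (fun h a => avoiding x (cyc (mix x y h) s ∪ cyc (mix x y h) a)) ?_ ?_ ?_ ?_
    · intro h a
      split_ifs
      exacts [hQ _ _, le_rfl]
    · intro h a
      split_ifs
      exacts [hQ _ _, le_rfl]
    · intro h a hf
      obtain ⟨h1, h2, h3, -, -⟩ := (ite_ne_right_iff.1 hf).1
      have := card_avoiding_ge x (cyc (mix x y h) s ∪ cyc (mix x y h) a)
      rw [card_union_of_disjoint (disjoint_cyc h3), h𝒮 _ h1, card_cyc, h2] at this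
      exact_mod_cast this
    · intro h a b hf hb
      have hc := (ite_ne_right_iff.1 hf).1
      rw [if_pos hc]
      obtain ⟨h1, h2, h3, h4, h5⟩ := hc
      have hb := (mem_filter.1 hb).2
      simp only [mem_union, not_or] at hb
      have e1 := switch_path hb.1.2 h5 hb.2.2
      have e2 := switch_cyc h3 hb.1.1 h4 hb.2.1
      rw [h2] at e1
      rw [mix_swap, e2, if_pos h1, e1.1]
      exact ⟨e1.2, le_rfl⟩
  have h1 : ∀ F : Perm α → α → ℝ, Ex (fun h => ∑ s, F h s) = ∑ s, Ex (fun h => F h s) :=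
    fun F => Ex_sum univ fun s h => F h s
  rw [h1, mul_sum]
  refine (sum_le_sum fun s _ => key s).trans ?_
  rw [← h1, ← Ex_mul_left]
  refine Ex_mono fun h => ?_
  calc _ ≤ ∑ s, if 𝒮 (cyc (mix x y h) s) then q else 0 := by
        refine sum_le_sum fun s _ => ?_
        split_ifs with h2
        · exact hq _ _ h2
        · simp
    _ = _ := by rw [← sum_filter, sum_const, nsmul_eq_mul, mul_comm]
end

end FixedOrder

namespace FixedOrder
open Equiv Finset
open scoped Pointwise

section
variable {α : Type*} [Fintype α] [DecidableEq α]

/-- The points on `p`-cycles of `g` that are disjoint from their `x`-image. -/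
noncomputable def genPts (x g : Perm α) (p : ℕ) : Finset α :=
  {s | per g s = p ∧ Disjoint (cyc g s) (x • cyc g s)}

lemma inv_apply_notMem_iff {x : Perm α} {U : Finset α} {a : α} :
    x⁻¹ a ∉ U ↔ a ∉ x • U := by
  rw [not_iff_not, mem_smul_finset]
  exact ⟨fun h => ⟨_, h, by simp⟩, fun ⟨b, hb, hba⟩ => by rw [← hba]; simpa using hb⟩

lemma Ex_genPts_le (x y : Perm α) {p : ℕ} (hp : 4 * p ≤ Fintype.card α) (hp0 : 0 < p) :
    Ex (fun h => (#(genPts x (mix x y h) p) : ℝ)) ≤ 2 := by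
  classical
  have h1 := Ex_open_le x y p
  have hp' : (4 : ℝ) * p ≤ Fintype.card α := by exact_mod_cast hp
  have hp0' : (0 : ℝ) < p := by exact_mod_cast hp0
  have h2 : Ex (fun h => (#(genPts x (mix x y h) p) : ℝ)) ≤ Ex (fun h =>
      (#{a | per (mix x y h) a = p ∧ x⁻¹ a ∉ cyc (mix x y h) a} : ℝ)) := by
    refine Ex_mono fun h => ?_
    refine Nat.cast_le.2 (card_le_card fun s hs => ?_)
    rw [genPts, mem_filter] at hs
    rw [mem_filter]
    refine ⟨mem_univ _, ?_⟩
    have hs := hs.2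
    refine ⟨hs.1, fun hc => ?_⟩
    exact disjoint_left.1 hs.2 (self_mem_cyc _ s) (by
      by_contra hcon
      exact inv_apply_notMem_iff.2 hcon hc)
  set E := Ex (fun h => (#{a | per (mix x y h) a = p ∧ x⁻¹ a ∉ cyc (mix x y h) a} : ℝ))
  have hE : 0 ≤ E := Ex_nonneg fun _ => Nat.cast_nonneg _
  refine h2.trans ?_
  by_contra hcon
  push Not at hcon
  nlinarith

lemma sum_sum_cyc (g : Perm α) (F : Finset α → α → ℝ) :
    ∑ z, ∑ a ∈ cyc g z, F (cyc g z) a = ∑ a, per g a * F (cyc g a) a := by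
  calc ∑ z, ∑ a ∈ cyc g z, F (cyc g z) a = ∑ a, ∑ z ∈ cyc g a, F (cyc g z) a := by
        refine sum_comm' fun z a => ?_
        simp [mem_cyc_comm (g := g) (a := z)]
    _ = ∑ a, ∑ z ∈ cyc g a, F (cyc g a) a :=
        sum_congr rfl fun a _ => sum_congr rfl fun z hz => by rw [cyc_eq_of_mem hz]
    _ = _ := by simp [card_cyc]

lemma card_sdiff_smul (x : Perm α) (Z : Finset α) :
    #(Z \ x • Z) = #{a ∈ Z | x⁻¹ a ∉ Z} := by
  congr 1
  ext a
  rw [Finset.mem_sdiff, mem_filter, inv_apply_notMem_iff]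

open Classical in
lemma Ex_expanding_le (x y : Perm α) {ℓ : ℕ} {ρ : ℝ} (hρ : 0 < ρ) (hℓ : 4 * ℓ ≤ Fintype.card α)
    (hℓ0 : 0 < ℓ) :
    Ex (fun h => (#{z | #(cyc (mix x y h) z) = ℓ ∧
      ρ * ℓ ≤ #(cyc (mix x y h) z \ x • cyc (mix x y h) z)} : ℝ)) ≤ 2 / ρ := by
  have h1 := Ex_open_le x y ℓ
  have hℓ' : (4 : ℝ) * ℓ ≤ Fintype.card α := by exact_mod_cast hℓ
  have hℓ0' : (0 : ℝ) < ℓ := by exact_mod_cast hℓ0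
  set E := Ex (fun h => (#{a | per (mix x y h) a = ℓ ∧ x⁻¹ a ∉ cyc (mix x y h) a} : ℝ)) with hE
  have h2 : E ≤ 2 := by
    have hE : 0 ≤ E := Ex_nonneg fun _ => Nat.cast_nonneg _
    by_contra hcon
    push Not at hcon
    nlinarith
  rw [le_div_iff₀ hρ, mul_comm, ← Ex_mul_left]
  refine le_trans (Ex_mono fun h => ?_) h2
  set g := mix x y h
  have e1 := sum_sum_cyc g fun Z a => if #Z = ℓ ∧ x⁻¹ a ∉ Z then 1 else 0
  have e2 : ∑ a, (per g a : ℝ) * (if #(cyc g a) = ℓ ∧ x⁻¹ a ∉ cyc g a then 1 else 0) =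
      ℓ * #{a | per g a = ℓ ∧ x⁻¹ a ∉ cyc g a} := by
    rw [card_filter, Nat.cast_sum, mul_sum]
    refine sum_congr rfl fun a _ => ?_
    rw [card_cyc]
    split_ifs with h3
    · rw [h3.1]; simp
    · simp
  rw [e2] at e1
  refine le_of_mul_le_mul_left ?_ hℓ0'
  rw [← e1, card_filter, Nat.cast_sum, mul_sum, mul_sum]
  refine sum_le_sum fun z _ => ?_
  split_ifs with h3
  · rw [card_sdiff_smul] at h3
    simp only [h3.1, true_and]
    rw [← natCast_card_filter]
    have := h3.2
    push_cast
    linarith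
  · simp only [Nat.cast_zero, mul_zero]
    exact sum_nonneg fun _ _ => by positivity

lemma Expands.le_card_sdiff {ρ : ℝ} {x w : Perm α} (hE : Expands ρ x w) {U : Finset α}
    (hU : (w * x) • U = U) (hne : U.Nonempty) (hc : 2 * #U ≤ Fintype.card α) :
    ρ * #U ≤ #(U \ x • U) := by
  have h1 : #(x • U \ U) = #(U \ x • U) := card_sdiff_comm (card_smul_finset _ _)
  have h2 : #(w • U \ U) = #(U \ x • U) := by
    have h3 : w • x • U = U := by rw [← mul_smul, hU]
    calc #(w • U \ U) = #(w • U \ w • x • U) := by rw [h3]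
      _ = _ := by rw [← smul_finset_sdiff, card_smul_finset]
  rcases hE U hne hc with h | h
  · rwa [h1] at h
  · rwa [h2] at h

open Classical in
/-- The weighted count of pairs of points `s`, `z` on distinct cycles of lengths `p` and `ℓ`, that
of `s` being generic. -/
noncomputable def pairSum (x g : Perm α) (p ℓ : ℕ) (Q : Finset α → Finset α → ℝ) : ℝ :=
  ∑ s, ∑ z, if s ∈ genPts x g p ∧ per g z = ℓ ∧ z ∉ cyc g s then Q (cyc g s) (cyc g z) else 0

lemma pairSum_nonneg {x g : Perm α} {p ℓ : ℕ} {Q : Finset α → Finset α → ℝ}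
    (hQ : ∀ S Z, 0 ≤ Q S Z) : 0 ≤ pairSum x g p ℓ Q :=
  sum_nonneg fun s _ => sum_nonneg fun z _ => by
    split_ifs
    exacts [hQ _ _, le_rfl]

open Classical in
/-- The weighted count of pairs of points `s`, `a` on distinct cycles, that of `a` having length `ℓ`
and that of `s` satisfying `𝒮`, such that `x⁻¹ a` lies on neither. -/
noncomputable def openPairs (x g : Perm α) (ℓ : ℕ) (𝒮 : Finset α → Prop)
    (Q : Finset α → Finset α → ℝ) : ℝ :=
  ∑ s, ∑ a, if 𝒮 (cyc g s) ∧ per g a = ℓ ∧ a ∉ cyc g s ∧ x⁻¹ a ∉ cyc g s ∧ x⁻¹ a ∉ cyc g a then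
    Q (cyc g s) (cyc g a) else 0

lemma openPairs_nonneg {x g : Perm α} {ℓ : ℕ} {𝒮 : Finset α → Prop} {Q : Finset α → Finset α → ℝ}
    (hQ : ∀ S Z, 0 ≤ Q S Z) : 0 ≤ openPairs x g ℓ 𝒮 Q :=
  sum_nonneg fun s _ => sum_nonneg fun z _ => by
    split_ifs
    exacts [hQ _ _, le_rfl]

open Classical in
lemma sum_mul_pairSum_le {x w : Perm α} {p ℓ : ℕ} {ρ : ℝ} (hE : Expands ρ x w)
    (hpℓ : 2 * (p + ℓ) ≤ Fintype.card α) {Q : Finset α → Finset α → ℝ} (hQ : ∀ S Z, 0 ≤ Q S Z) :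
    ρ * (p + ℓ) * pairSum x (w * x) p ℓ Q ≤
      ℓ * openPairs x (w * x) ℓ (fun S => #S = p ∧ Disjoint S (x • S)) Q +
      p * openPairs x (w * x) p (fun Z => #Z = ℓ ∧ ρ * ℓ ≤ #(Z \ x • Z)) fun Z S => Q S Z := by
  set g := w * x with hg
  set G : Finset α → Finset α → ℝ := fun S Z =>
    if (#S = p ∧ Disjoint S (x • S)) ∧ #Z = ℓ ∧ Disjoint S Z then Q S Z else 0 with hG
  have hG0 : ∀ S Z, 0 ≤ G S Z := fun S Z => by
    simp only [hG]; split_ifs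
    exacts [hQ _ _, le_rfl]
  have hdisj : ∀ s z, z ∉ cyc g s ↔ Disjoint (cyc g s) (cyc g z) := fun s z =>
    ⟨disjoint_cyc, fun h hz => disjoint_left.1 h hz (self_mem_cyc g z)⟩
  have hcyc : ∀ s, g • cyc g s = cyc g s := fun s => smul_cyc g s
  have hP : pairSum x g p ℓ Q = ∑ s, ∑ z, G (cyc g s) (cyc g z) := by
    simp only [pairSum, hG, genPts, mem_filter, mem_univ, true_and, card_cyc, hdisj]
  have hpt : ∀ s z, ρ * (p + ℓ) * G (cyc g s) (cyc g z) ≤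
      (∑ a ∈ cyc g z, if x⁻¹ a ∉ cyc g s ∧ x⁻¹ a ∉ cyc g z then G (cyc g s) (cyc g z) else 0) +
      ∑ a ∈ cyc g s, if x⁻¹ a ∉ cyc g z ∧ x⁻¹ a ∉ cyc g s then G (cyc g s) (cyc g z) else 0 := by
    intro s z
    by_cases hc : (#(cyc g s) = p ∧ Disjoint (cyc g s) (x • cyc g s)) ∧ #(cyc g z) = ℓ ∧
      Disjoint (cyc g s) (cyc g z)
    swap
    · simp [hG, hc]
    have hG0' := hG0 (cyc g s) (cyc g z)
    generalize G (cyc g s) (cyc g z) = t at hG0' ⊢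
    rw [← sum_filter, ← sum_filter, sum_const, sum_const, nsmul_eq_mul, nsmul_eq_mul, ← add_mul]
    refine mul_le_mul_of_nonneg_right ?_ hG0'
    have hU : #(cyc g s ∪ cyc g z) = p + ℓ := by
      rw [card_union_of_disjoint hc.2.2, hc.1.1, hc.2.1]
    have h1 := hE.le_card_sdiff (U := cyc g s ∪ cyc g z)
      (by rw [smul_finset_union, ← hg, hcyc, hcyc])
      ⟨s, mem_union_left _ (self_mem_cyc g s)⟩ (by rw [hU]; exact hpℓ)
    rw [hU, card_sdiff_smul] at h1
    push_cast at h1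
    refine h1.trans ?_
    rw [filter_union]
    have h2 := card_union_le {a ∈ cyc g s | x⁻¹ a ∉ cyc g s ∪ cyc g z}
      {a ∈ cyc g z | x⁻¹ a ∉ cyc g s ∪ cyc g z}
    simp only [mem_union, not_or] at h2 ⊢
    have h3 : #{a ∈ cyc g s | x⁻¹ a ∉ cyc g s ∧ x⁻¹ a ∉ cyc g z} =
      #{a ∈ cyc g s | x⁻¹ a ∉ cyc g z ∧ x⁻¹ a ∉ cyc g s} := by simp only [and_comm]
    rw [h3] at h2
    rw [add_comm]
    exact_mod_cast h2
  have hsum : ρ * (p + ℓ) * pairSum x g p ℓ Q ≤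
      (∑ s, ∑ z, ∑ a ∈ cyc g z,
        if x⁻¹ a ∉ cyc g s ∧ x⁻¹ a ∉ cyc g z then G (cyc g s) (cyc g z) else 0) +
      ∑ z, ∑ s, ∑ a ∈ cyc g s,
        if x⁻¹ a ∉ cyc g z ∧ x⁻¹ a ∉ cyc g s then G (cyc g s) (cyc g z) else 0 := by
    rw [hP, mul_sum]
    rw [sum_comm (f := fun z s => ∑ a ∈ cyc g s,
        if x⁻¹ a ∉ cyc g z ∧ x⁻¹ a ∉ cyc g s then G (cyc g s) (cyc g z) else 0),
      ← sum_add_distrib]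
    refine sum_le_sum fun s _ => ?_
    rw [mul_sum, ← sum_add_distrib]
    exact sum_le_sum fun z _ => hpt s z
  refine hsum.trans (add_le_add ?_ ?_) <;> rw [openPairs]
  · rw [mul_sum]
    refine sum_le_sum fun s _ => ?_
    rw [sum_sum_cyc g fun Z a => if x⁻¹ a ∉ cyc g s ∧ x⁻¹ a ∉ Z then G (cyc g s) Z else 0, mul_sum]
    refine sum_le_sum fun a _ => le_of_eq ?_
    have hd := hdisj s a
    by_cases h1 : per g a = ℓ
    · rw [h1]
      congr 1
      simp only [hG, card_cyc, h1, true_and]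
      split_ifs <;> first | rfl | (exfalso; tauto)
    · simp [hG, card_cyc, h1]
  · rw [mul_sum]
    refine sum_le_sum fun z _ => ?_
    rw [sum_sum_cyc g fun S a => if x⁻¹ a ∉ cyc g z ∧ x⁻¹ a ∉ S then G S (cyc g z) else 0, mul_sum]
    refine sum_le_sum fun a _ => ?_
    by_cases h1 : per g a = p
    swap
    · simp [hG, h1, card_cyc]
    rw [h1]
    refine mul_le_mul_of_nonneg_left ?_ (Nat.cast_nonneg _)
    by_cases h2 : (x⁻¹ a ∉ cyc g z ∧ x⁻¹ a ∉ cyc g a) ∧ #(cyc g z) = ℓ ∧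
      Disjoint (cyc g a) (cyc g z)
    · have h3 := hE.le_card_sdiff (U := cyc g z) (by rw [← hg, hcyc])
        ⟨z, self_mem_cyc g z⟩ (by rw [h2.2.1]; omega)
      rw [h2.2.1] at h3
      rw [if_pos h2.1, if_pos ⟨⟨h2.2.1, h3⟩, rfl, (hdisj _ _).2 h2.2.2.symm, h2.1⟩]
      simp only [hG]
      split_ifs
      exacts [le_rfl, hQ _ _]
    · refine le_trans (le_of_eq ?_) (by split_ifs; exacts [hQ _ _, le_rfl])
      simp only [hG]
      split_ifs <;> first | rfl | (exfalso; tauto)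

lemma le_div_of_pair_bounds {ρ p ℓ n q E₁ E₂ T : ℝ} (hρ : 0 < ρ) (hρ1 : ρ ≤ 1) (hp : 0 < p)
    (hℓ : 0 < ℓ) (hn : 0 < n) (hq : 0 ≤ q) (e₁ : n / 2 * E₁ ≤ q * 2)
    (e₂ : n / 2 * E₂ ≤ q * (2 / ρ)) (e₃ : ρ * (p + ℓ) * T ≤ ℓ * E₁ + p * E₂) :
    T ≤ 4 * q / (n * ρ ^ 2) := by
  have e4 : E₁ ≤ 4 * q / (n * ρ) := by
    rw [le_div_iff₀ (by positivity)]
    have h1 : n / 2 * E₁ * ρ ≤ q * 2 * ρ := mul_le_mul_of_nonneg_right e₁ hρ.le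
    nlinarith
  have e5 : E₂ ≤ 4 * q / (n * ρ) := by
    rw [le_div_iff₀ (by positivity)]
    have h1 : n / 2 * E₂ * ρ ≤ q * (2 / ρ) * ρ := mul_le_mul_of_nonneg_right e₂ hρ.le
    have h2 : q * (2 / ρ) * ρ = 2 * q := by field_simp
    linarith
  have e6 : (p + ℓ) * (ρ * T) ≤ (p + ℓ) * (4 * q / (n * ρ)) := by
    have := mul_le_mul_of_nonneg_left e4 hℓ.le
    have := mul_le_mul_of_nonneg_left e5 hp.le
    linarith
  have e7 := le_of_mul_le_mul_left e6 (by positivity)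
  rw [le_div_iff₀ (by positivity)] at e7 ⊢
  linarith

open Classical in
/-- The pair bound on the expanding event. -/
lemma Ex_expands_pairSum_le (x y : Perm α) {p ℓ : ℕ} {ρ q : ℝ} (hρ : 0 < ρ) (hρ1 : ρ ≤ 1)
    (hp : 0 < p) (hℓ : 0 < ℓ) (hpℓ : 4 * (p + ℓ) ≤ Fintype.card α)
    {Q : Finset α → Finset α → ℝ} (hQ : ∀ S Z, 0 ≤ Q S Z)
    (hq : ∀ (g : Perm α) S, #S = p → ∑ a, Q S (path g a ℓ) ≤ q)
    (hq' : ∀ (g : Perm α) Z, #Z = ℓ → ∑ a, Q (path g a p) Z ≤ q) :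
    Ex (fun h => if Expands ρ x (h * y * h⁻¹) then pairSum x (mix x y h) p ℓ Q else 0) ≤
      4 * q / (Fintype.card α * ρ ^ 2) := by
  have h1 := Ex_pair_open_le x y (p := p) (ℓ := ℓ)
    (fun S => #S = p ∧ Disjoint S (x • S)) (fun S hS => hS.1) Q hQ (q := q)
    fun g S hS => hq g S hS.1
  have h2 := Ex_pair_open_le x y (p := ℓ) (ℓ := p)
    (fun Z => #Z = ℓ ∧ ρ * ℓ ≤ #(Z \ x • Z)) (fun S hS => hS.1) (fun Z S => Q S Z)
    (fun Z S => hQ S Z) (q := q) fun g Z hZ => hq' g Z hZ.1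
  obtain ⟨E₁, hE₁⟩ : ∃ E, E = Ex (fun h => openPairs x (mix x y h) ℓ
    (fun S => #S = p ∧ Disjoint S (x • S)) Q) := ⟨_, rfl⟩
  obtain ⟨E₂, hE₂⟩ : ∃ E, E = Ex (fun h => openPairs x (mix x y h) p
    (fun Z => #Z = ℓ ∧ ρ * ℓ ≤ #(Z \ x • Z)) fun Z S => Q S Z) := ⟨_, rfl⟩
  change _ * Ex (fun h => openPairs x (mix x y h) ℓ
    (fun S => #S = p ∧ Disjoint S (x • S)) Q) ≤ _ at h1
  change _ * Ex (fun h => openPairs x (mix x y h) p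
    (fun Z => #Z = ℓ ∧ ρ * ℓ ≤ #(Z \ x • Z)) fun Z S => Q S Z) ≤ _ at h2
  rw [← hE₁] at h1
  rw [← hE₂] at h2
  have hn : (4 : ℝ) * (p + ℓ) ≤ Fintype.card α := by exact_mod_cast hpℓ
  have hp0 : (0 : ℝ) < p := by exact_mod_cast hp
  have hℓ0 : (0 : ℝ) < ℓ := by exact_mod_cast hℓ
  have hn0 : (0 : ℝ) < Fintype.card α := by linarith
  set n : ℝ := ((Fintype.card α : ℕ) : ℝ) with hndef
  have hE₁0 : 0 ≤ E₁ := hE₁ ▸ Ex_nonneg fun _ => openPairs_nonneg hQ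
  have hE₂0 : 0 ≤ E₂ := hE₂ ▸ Ex_nonneg fun _ => openPairs_nonneg fun _ _ => hQ _ _
  have hq0 : 0 ≤ q := by
    obtain ⟨S, -, hS⟩ := exists_subset_card_eq (s := (univ : Finset α)) (n := p)
      (by rw [card_univ]; omega)
    exact (sum_nonneg fun a _ => hQ _ _).trans (hq 1 S hS)
  have e1 : n / 2 * E₁ ≤ q * 2 := by
    refine le_trans (mul_le_mul_of_nonneg_right (by linarith) hE₁0)
      (h1.trans (mul_le_mul_of_nonneg_left ?_ hq0))
    have := Ex_genPts_le x y (p := p) (by omega) hp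
    refine le_trans (le_of_eq ?_) this
    simp only [genPts, card_cyc]
  have e2 : n / 2 * E₂ ≤ q * (2 / ρ) := by
    refine le_trans (mul_le_mul_of_nonneg_right (by linarith) hE₂0)
      (h2.trans (mul_le_mul_of_nonneg_left ?_ hq0))
    refine le_trans (le_of_eq ?_) (Ex_expanding_le x y hρ (by omega) hℓ)
    congr!
  set T := Ex (fun h => if Expands ρ x (h * y * h⁻¹) then pairSum x (mix x y h) p ℓ Q else 0)
    with hT
  have e3 : ρ * (p + ℓ) * T ≤ ℓ * E₁ + p * E₂ := by
    rw [hT, hE₁, hE₂, ← Ex_mul_left, ← Ex_mul_left, ← Ex_mul_left, ← Ex_add]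
    refine Ex_mono fun h => ?_
    split_ifs with hE
    · exact sum_mul_pairSum_le hE (by omega) hQ
    · rw [mul_zero]
      exact add_nonneg (mul_nonneg hℓ0.le (openPairs_nonneg hQ))
        (mul_nonneg hp0.le (openPairs_nonneg fun _ _ => hQ _ _))
  exact le_div_of_pair_bounds hρ hρ1 hp0 hℓ0 hn0 hq0 e1 e2 e3

lemma sum_card_path_inter_le (g : Perm α) (ℓ : ℕ) (T : Finset α) :
    ∑ a, #(path g a ℓ ∩ T) ≤ ℓ * #T := by
  calc ∑ a, #(path g a ℓ ∩ T) ≤ ∑ a, ∑ i ∈ range ℓ, if (g ^ i) a ∈ T then 1 else 0 := by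
        refine sum_le_sum fun a _ => ?_
        rw [← card_filter]
        refine (card_le_card ?_).trans (card_image_le (f := fun i => (g ^ i) a)
          (s := {i ∈ range ℓ | (g ^ i) a ∈ T}))
        intro b hb
        obtain ⟨hb1, hb2⟩ := mem_inter.1 hb
        obtain ⟨i, hi, rfl⟩ := mem_image.1 hb1
        exact mem_image.2 ⟨i, mem_filter.2 ⟨hi, hb2⟩, rfl⟩
    _ = ∑ i ∈ range ℓ, ∑ a, if (g ^ i) a ∈ T then 1 else 0 := sum_comm
    _ = ∑ i ∈ range ℓ, #T := by
        refine sum_congr rfl fun i _ => ?_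
        rw [Equiv.sum_comp (g ^ i) (fun b => if b ∈ T then 1 else 0), ← card_filter,
          filter_mem_eq_inter, univ_inter]
    _ = _ := by simp

end

end FixedOrder

namespace FixedOrder
open Equiv Finset
open scoped Pointwise

section
variable {α : Type*} [Fintype α] [DecidableEq α]

/-- If every `h` with `A h` can be switched in at least `card α - k` ways, and at most `c` switches
lead to a given permutation, then `A` has probability at most `c / (card α - k)`. -/
lemma Pr_switch_le {A : Perm α → Prop} (s : Perm α → α) (V : Perm α → Finset α)
    (R : Perm α → Finset (α × α)) {k c : ℕ} (hV : ∀ h, A h → #(V h) ≤ k) (hR : ∀ h, #(R h) ≤ c)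
    (hA : ∀ h b, A h → b ∉ V h → (s h, b) ∈ R (swap (s h) b * h)) :
    ((Fintype.card α : ℝ) - k) * Pr A ≤ c := by
  classical
  calc ((Fintype.card α : ℝ) - k) * Pr A
      ≤ Ex (fun h => ∑ P : α × α, if P ∈ R (swap P.1 P.2 * h) then (1 : ℝ) else 0) := by
        rw [Pr, ← Ex_mul_left]
        refine Ex_mono fun h => ?_
        split_ifs with h1
        · calc ((Fintype.card α : ℝ) - k) * 1 ≤ #(univ \ V h) := by
                have h2 := le_card_sdiff (V h) univ
                rw [card_univ] at h2
                have h3 := hV h h1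
                have : Fintype.card α ≤ #(univ \ V h) + k := by omega
                have : (Fintype.card α : ℝ) ≤ #(univ \ V h) + k := by exact_mod_cast this
                linarith
            _ = ∑ b ∈ univ \ V h, (1 : ℝ) := by simp
            _ ≤ ∑ b, if (s h, b) ∈ R (swap (s h) b * h) then (1 : ℝ) else 0 := by
                rw [← sum_filter]
                refine sum_le_sum_of_subset_of_nonneg (fun b hb => ?_) fun _ _ _ => zero_le_one
                exact mem_filter.2 ⟨mem_univ _, hA h b h1 (Finset.mem_sdiff.1 hb).2⟩
            _ ≤ _ := by
                rw [Fintype.sum_prod_type]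
                exact single_le_sum (f := fun t => ∑ b, if (t, b) ∈ R (swap t b * h) then (1 : ℝ)
                  else 0) (fun t _ => sum_nonneg fun _ _ => by positivity) (mem_univ (s h))
        · rw [mul_zero]
          exact sum_nonneg fun _ _ => by positivity
    _ = ∑ P : α × α, Ex (fun h => if P ∈ R (swap P.1 P.2 * h) then (1 : ℝ) else 0) :=
        Ex_sum univ fun (P : α × α) h => if P ∈ R (swap P.1 P.2 * h) then (1 : ℝ) else 0
    _ = ∑ P : α × α, Ex (fun h => if P ∈ R h then (1 : ℝ) else 0) :=
        sum_congr rfl fun P _ => Ex_comp (Equiv.mulLeft (swap P.1 P.2))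
          fun h => if P ∈ R h then (1 : ℝ) else 0
    _ = Ex (fun h => ∑ P : α × α, if P ∈ R h then (1 : ℝ) else 0) :=
        (Ex_sum univ fun (P : α × α) h => if P ∈ R h then (1 : ℝ) else 0).symm
    _ ≤ Ex (fun _ : Perm α => (c : ℝ)) := by
        refine Ex_mono fun h => ?_
        rw [← sum_filter, filter_mem_eq_inter, univ_inter, sum_const, nsmul_eq_mul, mul_one]
        exact_mod_cast hR h
    _ = c := Ex_const _

/-- The walk from `a` applying `x` and `z` alternately. -/
def walk (x z : Perm α) (a : α) : ℕ → α
  | 0 => a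
  | m + 1 => if Even m then x (walk x z a m) else z (walk x z a m)

lemma walk_succ_even {x z : Perm α} {a : α} {m : ℕ} (hm : Even m) :
    walk x z a (m + 1) = x (walk x z a m) := by simp [walk, hm]

lemma walk_succ_odd {x z : Perm α} {a : α} {m : ℕ} (hm : ¬ Even m) :
    walk x z a (m + 1) = z (walk x z a m) := by simp [walk, hm]

lemma walk_two_mul (x z : Perm α) (a : α) (i : ℕ) : walk x z a (2 * i) = ((z * x) ^ i) a := by
  induction i with
  | zero => simp [walk]
  | succ i ih =>
    rw [show 2 * (i + 1) = 2 * i + 1 + 1 by ring, walk_succ_odd (by simp),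
      walk_succ_even (by simp), ih, pow_succ']
    rfl

lemma walk_two_mul_add_one (x z : Perm α) (a : α) (i : ℕ) :
    walk x z a (2 * i + 1) = x (((z * x) ^ i) a) := by
  rw [walk_succ_even (by simp), walk_two_mul]

lemma walk_swap {x z : Perm α} {a s b : α} {m : ℕ}
    (h : ∀ j ≤ m, walk x z a j ≠ s ∧ walk x z a j ≠ b) :
    ∀ j ≤ m, walk x (swap s b * z * swap s b) a j = walk x z a j := by
  intro j
  induction j with
  | zero => intro; rfl
  | succ j ih =>
    intro hj
    have ih := ih (by omega)
    by_cases he : Even j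
    · rw [walk_succ_even he, walk_succ_even he, ih]
    · have h1 := h j (by omega)
      have h2 := h (j + 1) hj
      rw [walk_succ_odd he] at h2
      rw [walk_succ_odd he, walk_succ_odd he, ih, Perm.mul_apply, Perm.mul_apply,
        swap_apply_of_ne_of_ne h1.1 h1.2, swap_apply_of_ne_of_ne h2.1 h2.2]

/-- The walk first revisits a point at time `m + 1`. -/
def Collides (x z : Perm α) (a : α) (m : ℕ) : Prop :=
  Set.InjOn (walk x z a) (Set.Iic m) ∧ ∃ j ≤ m, walk x z a (m + 1) = walk x z a j

lemma conj_swap (y h : Perm α) (s b : α) :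
    (swap s b * h) * y * (swap s b * h)⁻¹ = swap s b * (h * y * h⁻¹) * swap s b := by
  simp [mul_assoc]

lemma fixCount_conj (y h : Perm α) : #{i | (h * y * h⁻¹) i = i} = fixCount y := by
  rw [fixCount]
  refine card_bij' (fun i _ => h⁻¹ i) (fun i _ => h i) ?_ ?_ ?_ ?_
  · intro i hi
    simp only [mem_filter, mem_univ, true_and] at hi ⊢
    nth_rewrite 2 [← hi]
    simp
  · intro i hi
    simp only [mem_filter, mem_univ, true_and] at hi ⊢
    simp [hi]
  · simp
  · simp

lemma Pr_collides_even_le (x y : Perm α) (a : α) {m : ℕ} (hm : Even m) (hm0 : 0 < m) :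
    ((Fintype.card α : ℝ) - (m + 1 : ℕ)) * Pr (fun h => Collides x (h * y * h⁻¹) a m) ≤
      (fixCount x + m : ℕ) := by
  classical
  refine Pr_switch_le (fun h => walk x (h * y * h⁻¹) a m)
    (fun h => (range (m + 1)).image (walk x (h * y * h⁻¹) a))
    (fun h => (({i | x i = i} : Finset α) ∪
      (range m).image fun j => x⁻¹ (walk x (h * y * h⁻¹) a j)) ×ˢ {walk x (h * y * h⁻¹) a m})
    (fun h _ => card_image_le.trans (card_range _).le) (fun h => ?_) fun h b hc hb => ?_
  · rw [card_product, card_singleton, mul_one]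
    refine (card_union_le _ _).trans (add_le_add le_rfl (card_image_le.trans (card_range _).le))
  · obtain ⟨hinj, j, hj, hcol⟩ := hc
    set z := h * y * h⁻¹
    have hb' : ∀ i ≤ m, walk x z a i ≠ b := fun i hi h' =>
      hb (mem_image.2 ⟨i, mem_range.2 (by omega), h'⟩)
    obtain ⟨k, rfl⟩ : ∃ k, m = k + 1 := ⟨m - 1, by omega⟩
    have hk : ¬ Even k := by rwa [Nat.even_add_one] at hm
    have hw := walk_swap (x := x) (z := z) (a := a) (s := walk x z a (k + 1)) (b := b) (m := k)
      fun i hi => ⟨fun h' => by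
        have := hinj (by simp; omega) (by simp) h'
        omega, hb' i (by omega)⟩
    rw [conj_swap]
    rw [mem_product, mem_singleton, mem_union]
    constructor
    · rw [walk_succ_even hm] at hcol
      rcases hj.lt_or_eq with hj | rfl
      · right
        refine mem_image.2 ⟨j, mem_range.2 hj, ?_⟩
        dsimp only
        rw [hw j (by omega), ← hcol]
        simp
      · left
        simpa using hcol
    · dsimp only
      rw [walk_succ_odd hk, hw k le_rfl, Perm.mul_apply, Perm.mul_apply,
        swap_apply_of_ne_of_ne _ (hb' k (by omega)), ← walk_succ_odd hk, swap_apply_left]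
      intro h'
      have := hinj (by simp) (by simp) h'
      omega

lemma Pr_collides_odd_le (x y : Perm α) (a : α) {m : ℕ} (hm : ¬ Even m) :
    ((Fintype.card α : ℝ) - (m + 1 : ℕ)) * Pr (fun h => Collides x (h * y * h⁻¹) a m) ≤
      (fixCount y + m : ℕ) := by
  classical
  refine Pr_switch_le (fun h => walk x (h * y * h⁻¹) a m)
    (fun h => (range (m + 1)).image (walk x (h * y * h⁻¹) a))
    (fun h => {walk x (h * y * h⁻¹) a m} ×ˢ (({i | (h * y * h⁻¹) i = i} : Finset α) ∪
      (range m).image fun j => (h * y * h⁻¹)⁻¹ (walk x (h * y * h⁻¹) a j)))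
    (fun h _ => card_image_le.trans (card_range _).le) (fun h => ?_) fun h b hc hb => ?_
  · rw [card_product, card_singleton, one_mul]
    refine (card_union_le _ _).trans (add_le_add (fixCount_conj y h).le
      (card_image_le.trans (card_range _).le))
  · obtain ⟨hinj, j, hj, hcol⟩ := hc
    set z := h * y * h⁻¹
    have hb' : ∀ i ≤ m, walk x z a i ≠ b := fun i hi h' =>
      hb (mem_image.2 ⟨i, mem_range.2 (by omega), h'⟩)
    obtain ⟨k, rfl⟩ : ∃ k, m = k + 1 := by
      rcases m with _ | k
      · simp at hm
      · exact ⟨k, rfl⟩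
    have hk : Even k := by rwa [Nat.even_add_one, not_not] at hm
    have hw := walk_swap (x := x) (z := z) (a := a) (s := walk x z a (k + 1)) (b := b) (m := k)
      fun i hi => ⟨fun h' => by
        have := hinj (by simp; omega) (by simp) h'
        omega, hb' i (by omega)⟩
    rw [conj_swap]
    rw [mem_product, mem_singleton, mem_union]
    dsimp only
    rw [walk_succ_odd hm] at hcol
    have hzb : (swap (walk x z a (k + 1)) b * z * swap (walk x z a (k + 1)) b) b =
        swap (walk x z a (k + 1)) b (walk x z a j) := by
      rw [Perm.mul_apply, Perm.mul_apply, swap_apply_right, hcol]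
    constructor
    · exact (walk_succ_even hk).trans ((congrArg x (hw k le_rfl).symm).trans
        (walk_succ_even hk).symm)
    · rcases hj.lt_or_eq with hj | rfl
      · right
        refine mem_image.2 ⟨j, mem_range.2 hj, ?_⟩
        rw [hw j (by omega), Perm.inv_eq_iff_eq, hzb, swap_apply_of_ne_of_ne _ (hb' j (by omega))]
        intro h'
        have := hinj (by simp; omega) (by simp) h'
        omega
      · left
        rw [mem_filter]
        exact ⟨mem_univ _, by rw [hzb, swap_apply_left]⟩

lemma exists_collides_of_not_injOn {x z : Perm α} {a : α} {M : ℕ}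
    (h : ¬ Set.InjOn (walk x z a) (Set.Iic M)) : ∃ m < M, Collides x z a m := by
  induction M with
  | zero => exact absurd (fun i hi j hj _ => by simp at hi hj; omega) h
  | succ M ih =>
    by_cases hM : Set.InjOn (walk x z a) (Set.Iic M)
    · refine ⟨M, by omega, hM, ?_⟩
      by_contra hcon
      push Not at hcon
      refine h fun i hi j hj hij => ?_
      simp only [Set.mem_Iic] at hi hj
      rcases hi.lt_or_eq with hi | rfl <;> rcases hj.lt_or_eq with hj | rfl
      · exact hM (by simp; omega) (by simp; omega) hij
      · exact absurd hij.symm (hcon i (by omega))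
      · exact absurd hij (hcon j (by omega))
      · rfl
    · obtain ⟨m, hm, hc⟩ := ih hM
      exact ⟨m, by omega, hc⟩

open Classical in
/-- Most starting points have a long injective walk. -/
lemma Ex_card_not_injOn_walk_le (x y : Perm α) {M F : ℕ} (hM : 2 * M ≤ Fintype.card α)
    (hx : fixCount x ≤ F) (hy : fixCount y ≤ F) :
    Ex (fun h => (#{a | ¬ Set.InjOn (walk x (h * y * h⁻¹) a) (Set.Iic M)} : ℝ)) ≤
      F + 2 * M * (F + M) := by
  have h1 : ∀ h, (#{a | ¬ Set.InjOn (walk x (h * y * h⁻¹) a) (Set.Iic M)} : ℝ) ≤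
      F + ∑ m ∈ Ico 1 M, ∑ a, if Collides x (h * y * h⁻¹) a m then (1 : ℝ) else 0 := by
    intro h
    have h2 : ({a | ¬ Set.InjOn (walk x (h * y * h⁻¹) a) (Set.Iic M)} : Finset α) ⊆
        ({a | x a = a} : Finset α) ∪ (Ico 1 M).biUnion fun m => {a | Collides x (h * y * h⁻¹) a m} := by
      intro a ha
      obtain ⟨m, hm, hc⟩ := exists_collides_of_not_injOn (mem_filter.1 ha).2
      rw [mem_union]
      rcases Nat.eq_zero_or_pos m with rfl | hm0
      · left
        obtain ⟨-, j, hj, h3⟩ := hc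
        obtain rfl : j = 0 := by omega
        rw [mem_filter]
        exact ⟨mem_univ _, by simpa [walk] using h3⟩
      · right
        exact mem_biUnion.2 ⟨m, mem_Ico.2 ⟨hm0, hm⟩, mem_filter.2 ⟨mem_univ _, hc⟩⟩
    have h3 := (card_le_card h2).trans ((card_union_le _ _).trans (add_le_add hx card_biUnion_le))
    simp only [← natCast_card_filter]
    exact_mod_cast h3
  refine (Ex_mono h1).trans ?_
  rw [Ex_add, Ex_const, Ex_sum]
  refine add_le_add le_rfl ?_
  have hM' : (2 : ℝ) * M ≤ Fintype.card α := by exact_mod_cast hM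
  calc _ ≤ ∑ m ∈ Ico 1 M, (2 * (F + M) : ℝ) := by
        refine sum_le_sum fun m hm => ?_
        obtain ⟨hm1, hm2⟩ := mem_Ico.1 hm
        rw [Ex_sum]
        have hm3 : (m : ℝ) + 1 ≤ M := by exact_mod_cast hm2
        have h4 : ∀ a, (Fintype.card α / 2 : ℝ) * Pr (fun h => Collides x (h * y * h⁻¹) a m) ≤
            F + M := by
          intro a
          refine le_trans (mul_le_mul_of_nonneg_right (b := (Fintype.card α : ℝ) / 2)
            (c := (Fintype.card α : ℝ) - (m + 1 : ℕ)) ?_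
            (Pr_nonneg _)) ?_
          · push_cast; linarith
          · by_cases he : Even m
            · refine (Pr_collides_even_le x y a he hm1).trans ?_
              exact_mod_cast add_le_add hx hm2.le
            · refine (Pr_collides_odd_le x y a he).trans ?_
              exact_mod_cast add_le_add hy hm2.le
        have hn : (0 : ℝ) < Fintype.card α := by
          have : (0 : ℝ) ≤ m := Nat.cast_nonneg _
          linarith
        have h5 : (Fintype.card α / 2 : ℝ) * ∑ a,
            Pr (fun h => Collides x (h * y * h⁻¹) a m) ≤ Fintype.card α * (F + M) := by
          rw [mul_sum]
          refine (sum_le_sum fun a _ => h4 a).trans ?_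
          rw [sum_const, card_univ, nsmul_eq_mul]
        have h6 : ∑ a, Pr (fun h => Collides x (h * y * h⁻¹) a m) ≤ 2 * (F + M) := by
          refine le_of_mul_le_mul_left ?_ hn
          linarith
        exact h6
    _ ≤ _ := by
        rw [sum_const, Nat.card_Ico, nsmul_eq_mul]
        have : ((M - 1 : ℕ) : ℝ) ≤ M := by exact_mod_cast Nat.sub_le _ _
        have h7 : (0 : ℝ) ≤ 2 * (F + M) := by positivity
        calc ((M - 1 : ℕ) : ℝ) * (2 * (F + M)) ≤ M * (2 * (F + M)) :=
              mul_le_mul_of_nonneg_right this h7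
          _ = _ := by ring

end

end FixedOrder

namespace FixedOrder
open Equiv Finset
open scoped Pointwise

section
variable {α : Type*} [Fintype α] [DecidableEq α]

lemma mem_genPts_switch {x z : Perm α} {a : α} {p : ℕ} (hp : 0 < p)
    (hinj : Set.InjOn (walk x z a) (Set.Iic (2 * p + 1))) :
    a ∈ genPts x (swap a (((z * x) ^ p) a) * (z * x) *
      swap (x⁻¹ a) (x⁻¹ (((z * x) ^ p) a))) p := by
  set g := z * x with hg
  set b := (g ^ p) a with hb
  set g' := swap a b * g * swap (x⁻¹ a) (x⁻¹ b) with hg'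
  have hee : ∀ i ≤ p, ∀ j ≤ p, (g ^ i) a = (g ^ j) a → i = j := by
    intro i hi j hj h
    rw [← walk_two_mul, ← walk_two_mul] at h
    have := hinj (by simp; omega) (by simp; omega) h
    omega
  have heo : ∀ i ≤ p, ∀ j ≤ p, (g ^ i) a ≠ x ((g ^ j) a) := by
    intro i hi j hj h
    rw [← walk_two_mul, ← walk_two_mul_add_one] at h
    have := hinj (by simp; omega) (by simp; omega) h
    omega
  have hstep : ∀ i < p, g' ((g ^ i) a) = swap a b ((g ^ (i + 1)) a) := by
    intro i hi
    have h1 : (g ^ i) a ≠ x⁻¹ a := fun h => heo 0 (by omega) i (by omega) (by rw [h]; simp)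
    have h2 : (g ^ i) a ≠ x⁻¹ b := fun h => heo p le_rfl i (by omega) (by rw [h, ← hb]; simp)
    rw [hg', Perm.mul_apply, Perm.mul_apply, swap_apply_of_ne_of_ne h1 h2, pow_succ' g i]
    rfl
  have hpow : ∀ i, i < p → (g' ^ i) a = (g ^ i) a := by
    intro i
    induction i with
    | zero => intro; rfl
    | succ i ih =>
      intro hi
      rw [pow_succ', Perm.mul_apply, ih (by omega), hstep i (by omega)]
      refine swap_apply_of_ne_of_ne (fun h => ?_) (fun h => ?_)
      · have := hee (i + 1) (by omega) 0 (by omega) h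
        omega
      · have := hee (i + 1) (by omega) p le_rfl h
        omega
  have hclose : (g' ^ p) a = a := by
    obtain ⟨k, rfl⟩ : ∃ k, p = k + 1 := ⟨p - 1, by omega⟩
    rw [pow_succ', Perm.mul_apply, hpow k (by omega), hstep k (by omega), ← hb, swap_apply_right]
  have hper : per g' a = p := by
    have h1 := Nat.le_of_dvd hp (pow_apply_eq_self_iff.1 hclose)
    rcases h1.lt_or_eq with h2 | h2
    · have h3 := hpow _ h2
      rw [pow_per] at h3
      have := hee 0 (by omega) _ h1 h3
      have := per_pos g' a
      omega
    · exact h2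
  rw [genPts, mem_filter]
  refine ⟨mem_univ _, hper, ?_⟩
  rw [cyc_eq_path, hper, disjoint_left]
  intro c hc hc'
  obtain ⟨i, hi, rfl⟩ := mem_image.1 hc
  obtain ⟨d, hd, hdc⟩ := mem_smul_finset.1 hc'
  obtain ⟨j, hj, rfl⟩ := mem_image.1 hd
  rw [mem_range] at hi hj
  rw [Perm.smul_def, hpow i hi, hpow j hj] at hdc
  exact heo i hi.le j hj.le hdc.symm

lemma sum_genPts_switch_le {x g : Perm α} {a b u v : α} {Λ : Finset ℕ}
    (h0 : ∀ q ∈ Λ, genPts x g q = ∅) :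
    ∑ q ∈ Λ, (1 / q : ℝ) * #(genPts x (swap a b * g * swap u v) q) ≤ 4 := by
  classical
  set g' := swap a b * g * swap u v with hg'
  have hg : swap a b * g' * swap u v = g := by
    rw [hg']; simp [mul_assoc]
  have hsub : ∀ q ∈ Λ, genPts x g' q ⊆
      ({a, b, u, v} : Finset α).biUnion fun c => if per g' c = q then cyc g' c else ∅ := by
    intro q hq s hs
    obtain ⟨hs1, hs2⟩ := (mem_filter.1 hs).2
    by_contra hcon
    have hc : ∀ c ∈ ({a, b, u, v} : Finset α), c ∉ cyc g' s := by
      intro c hc hcs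
      refine hcon (mem_biUnion.2 ⟨c, hc, ?_⟩)
      rw [if_pos (by rw [per_eq_of_mem hcs, hs1])]
      exact (mem_cyc_comm).1 hcs
    have hcyc : cyc g s = cyc g' s := by
      rw [← hg]
      exact switch_cyc (hc a (by simp)) (hc b (by simp)) (hc u (by simp)) (hc v (by simp))
    have : s ∈ genPts x g q := by
      refine mem_filter.2 ⟨mem_univ _, ?_, ?_⟩
      · rw [← card_cyc, hcyc, card_cyc, hs1]
      · rw [hcyc]; exact hs2
    rw [h0 q hq] at this
    simp at this
  calc ∑ q ∈ Λ, (1 / q : ℝ) * #(genPts x g' q)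
      ≤ ∑ q ∈ Λ, ∑ c ∈ ({a, b, u, v} : Finset α), if per g' c = q then (1 : ℝ) else 0 := by
        refine sum_le_sum fun q hq => ?_
        have h1 := (card_le_card (hsub q hq)).trans card_biUnion_le
        have h2 : (#(genPts x g' q) : ℝ) ≤ ∑ c ∈ ({a, b, u, v} : Finset α),
            (#(if per g' c = q then cyc g' c else ∅) : ℝ) := by exact_mod_cast h1
        refine (mul_le_mul_of_nonneg_left h2 (by positivity)).trans ?_
        rw [mul_sum]
        refine sum_le_sum fun c _ => ?_
        split_ifs with h3
        · rw [card_cyc, h3]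
          rw [one_div]
          exact inv_mul_le_one
        · simp
    _ = ∑ c ∈ ({a, b, u, v} : Finset α), ∑ q ∈ Λ, if per g' c = q then (1 : ℝ) else 0 := sum_comm
    _ ≤ ∑ c ∈ ({a, b, u, v} : Finset α), (1 : ℝ) := by
        refine sum_le_sum fun c _ => ?_
        rw [sum_ite_eq]
        split_ifs <;> simp
    _ ≤ 4 := by
        rw [sum_const, nsmul_eq_mul, mul_one]
        exact_mod_cast card_le_four

open Classical in
/-- With few exceptions some cycle with length in `Λ` is generic. -/
lemma Pr_genPts_eq_empty_le (x y : Perm α) {Λ : Finset ℕ} {M F : ℕ} (hM : 2 * M ≤ Fintype.card α)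
    (hx : fixCount x ≤ F) (hy : fixCount y ≤ F) (hΛ : ∀ p ∈ Λ, 0 < p ∧ 2 * p + 1 ≤ M) :
    (∑ p ∈ Λ, (1 / p : ℝ)) * Fintype.card α *
      Pr (fun h => ∀ p ∈ Λ, genPts x (mix x y h) p = ∅) ≤
      4 * Fintype.card α + (∑ p ∈ Λ, (1 / p : ℝ)) * (F + 2 * M * (F + M)) := by
  set μ : ℝ := ∑ p ∈ Λ, (1 / p : ℝ) with hμ
  have hμ0 : 0 ≤ μ := sum_nonneg fun _ _ => by positivity
  set A : Perm α → Prop := fun h => ∀ p ∈ Λ, genPts x (mix x y h) p = ∅ with hA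
  set W : Perm α → ℕ → α → ℝ := fun h p a => if a ∈ genPts x (mix x y h) p ∧
    ∑ q ∈ Λ, (1 / q : ℝ) * #(genPts x (mix x y h) q) ≤ 4 then 1 else 0 with hW
  have hW0 : ∀ h p a, 0 ≤ W h p a := fun h p a => by simp only [hW]; positivity
  have h1 : ∀ h, μ * Fintype.card α * (if A h then 1 else 0) ≤
      ∑ a, ∑ b, ∑ p ∈ Λ, (1 / p : ℝ) * W (swap a b * h) p a +
      μ * #{a | ¬ Set.InjOn (walk x (h * y * h⁻¹) a) (Set.Iic M)} := by
    intro h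
    have hnn : 0 ≤ ∑ a, ∑ b, ∑ p ∈ Λ, (1 / p : ℝ) * W (swap a b * h) p a :=
      sum_nonneg fun a _ => sum_nonneg fun b _ => sum_nonneg fun p _ =>
        mul_nonneg (by positivity) (hW0 _ _ _)
    split_ifs with h0
    swap
    · rw [mul_zero]
      exact add_nonneg hnn (mul_nonneg hμ0 (Nat.cast_nonneg _))
    have h2 : μ * #{a | Set.InjOn (walk x (h * y * h⁻¹) a) (Set.Iic M)} ≤
        ∑ a, ∑ b, ∑ p ∈ Λ, (1 / p : ℝ) * W (swap a b * h) p a := by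
      rw [natCast_card_filter, mul_sum]
      refine sum_le_sum fun a _ => ?_
      split_ifs with hinj
      swap
      · rw [mul_zero]
        exact sum_nonneg fun b _ => sum_nonneg fun p _ =>
          mul_nonneg (by positivity) (hW0 _ _ _)
      rw [mul_one, sum_comm, hμ]
      refine sum_le_sum fun p hp => ?_
      refine le_trans ?_ (single_le_sum (f := fun b => (1 / p : ℝ) * W (swap a b * h) p a)
        (fun b _ => mul_nonneg (by positivity) (hW0 _ _ _)) (mem_univ ((mix x y h ^ p) a)))
      have h3 : W (swap a ((mix x y h ^ p) a) * h) p a = 1 := by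
        simp only [hW]
        rw [mix_swap, if_pos]
        refine ⟨?_, sum_genPts_switch_le h0⟩
        exact mem_genPts_switch (hΛ p hp).1 (hinj.mono (Set.Iic_subset_Iic.2 (hΛ p hp).2))
      simp only [h3, mul_one, le_refl]
    have h4 := card_filter_add_card_filter_not (s := (univ : Finset α))
      (fun a => Set.InjOn (walk x (h * y * h⁻¹) a) (Set.Iic M))
    rw [card_univ] at h4
    rw [mul_one, ← h4]
    push_cast
    rw [mul_add]
    exact add_le_add h2 le_rfl
  calc μ * Fintype.card α * Pr A
      = Ex (fun h => μ * Fintype.card α * (if A h then 1 else 0)) := by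
        rw [Ex_mul_left, Pr]
        congr!
    _ ≤ _ := Ex_mono h1
    _ = Ex (fun h => ∑ a, ∑ b, ∑ p ∈ Λ, (1 / p : ℝ) * W (swap a b * h) p a) +
        μ * Ex (fun h => (#{a | ¬ Set.InjOn (walk x (h * y * h⁻¹) a) (Set.Iic M)} : ℝ)) := by
        rw [Ex_add, Ex_mul_left]
    _ ≤ _ := by
        refine add_le_add ?_ (mul_le_mul_of_nonneg_left
          (Ex_card_not_injOn_walk_le x y hM hx hy) hμ0)
        calc Ex (fun h => ∑ a, ∑ b, ∑ p ∈ Λ, (1 / p : ℝ) * W (swap a b * h) p a)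
            = ∑ a, ∑ b : α, Ex (fun h => ∑ p ∈ Λ, (1 / p : ℝ) * W h p a) := by
              rw [Ex_sum univ fun (a : α) h => ∑ b, ∑ p ∈ Λ, (1 / p : ℝ) * W (swap a b * h) p a]
              refine sum_congr rfl fun a _ => ?_
              rw [Ex_sum univ fun (b : α) h => ∑ p ∈ Λ, (1 / p : ℝ) * W (swap a b * h) p a]
              exact sum_congr rfl fun b _ => Ex_comp (Equiv.mulLeft (swap a b))
                fun h => ∑ p ∈ Λ, (1 / p : ℝ) * W h p a
          _ = Fintype.card α * Ex (fun h => ∑ a, ∑ p ∈ Λ, (1 / p : ℝ) * W h p a) := by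
              rw [Ex_sum univ fun (a : α) h => ∑ p ∈ Λ, (1 / p : ℝ) * W h p a, mul_sum]
              refine sum_congr rfl fun a _ => ?_
              simp
          _ ≤ Fintype.card α * Ex (fun _ : Perm α => 4) := by
              refine mul_le_mul_of_nonneg_left (Ex_mono fun h => ?_) (Nat.cast_nonneg _)
              rw [sum_comm]
              by_cases h5 : ∑ q ∈ Λ, (1 / q : ℝ) * #(genPts x (mix x y h) q) ≤ 4
              · refine le_trans (sum_le_sum fun p _ => ?_) h5
                rw [← mul_sum]
                refine mul_le_mul_of_nonneg_left (le_of_eq ?_) (by positivity)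
                simp only [hW, h5, and_true]
                rw [← natCast_card_filter, filter_mem_eq_inter, univ_inter]
              · simp only [hW, h5, and_false, if_false, mul_zero, sum_const_zero]
                norm_num
          _ = _ := by rw [Ex_const]; ring

end

end FixedOrder

namespace FixedOrder
open Equiv Finset
open scoped Pointwise

section
variable {α : Type*} [Fintype α] [DecidableEq α]

lemma genPts_of_mem_cyc {x g : Perm α} {p : ℕ} {s t : α} (hs : s ∈ genPts x g p)
    (ht : t ∈ cyc g s) : t ∈ genPts x g p := by
  obtain ⟨h1, h2⟩ := (mem_filter.1 hs).2
  exact mem_filter.2 ⟨mem_univ _, (per_eq_of_mem ht).trans h1, by rwa [cyc_eq_of_mem ht]⟩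

lemma mul_le_pairSum_one {x g : Perm α} {p : ℕ} {s z : α} (hs : s ∈ genPts x g p)
    (hz : z ∉ cyc g s) : (p : ℝ) * per g z ≤ pairSum x g p (per g z) fun _ _ => 1 := by
  classical
  have hp := (mem_filter.1 hs).2.1
  rw [pairSum, ← Fintype.sum_prod_type', ← natCast_card_filter]
  rw [← hp, ← card_cyc g s, ← card_cyc g z, ← Nat.cast_mul, ← card_product]
  refine Nat.cast_le.2 (card_le_card fun P hP => ?_)
  obtain ⟨h1, h2⟩ := mem_product.1 hP
  rw [card_cyc]
  refine mem_filter.2 ⟨mem_univ _, hp ▸ genPts_of_mem_cyc hs h1, ?_, ?_⟩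
  · rw [card_cyc]; exact per_eq_of_mem h2
  · rw [cyc_eq_of_mem h1]
    exact fun h => disjoint_left.1 (disjoint_cyc hz) h h2

/-- Short cycles of length divisible by `p` next to a generic `p`-cycle are unlikely. -/
lemma Pr_short_dvd_le (x y : Perm α) {p ℓ₀ : ℕ} {ρ : ℝ} (hρ : 0 < ρ) (hρ1 : ρ ≤ 1) (hp : 0 < p)
    (hn : 4 * (p + ℓ₀) ≤ Fintype.card α) :
    Pr (fun h => Expands ρ x (h * y * h⁻¹) ∧ ∃ s ∈ genPts x (mix x y h) p,
      ∃ z, z ∉ cyc (mix x y h) s ∧ p ∣ per (mix x y h) z ∧ per (mix x y h) z ≤ ℓ₀) ≤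
      4 * (1 + Real.log (Fintype.card α)) / (ρ ^ 2 * p ^ 2) := by
  classical
  have hn0 : (0 : ℝ) < Fintype.card α := by
    have : 0 < Fintype.card α := by omega
    exact_mod_cast this
  have hp0 : (0 : ℝ) < p := by exact_mod_cast hp
  set K := ℓ₀ / p with hK
  have hone : ∀ S Z : Finset α, (0 : ℝ) ≤ (fun _ _ => 1 : Finset α → Finset α → ℝ) S Z :=
    fun _ _ => zero_le_one
  have h1 : Pr (fun h => Expands ρ x (h * y * h⁻¹) ∧ ∃ s ∈ genPts x (mix x y h) p,
      ∃ z, z ∉ cyc (mix x y h) s ∧ p ∣ per (mix x y h) z ∧ per (mix x y h) z ≤ ℓ₀) ≤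
      Ex (fun h => ∑ k ∈ Icc 1 K, 1 / (p * (p * k : ℕ) : ℝ) *
        if Expands ρ x (h * y * h⁻¹) then pairSum x (mix x y h) p (p * k) (fun _ _ => 1)
          else 0) := by
    have hnn : ∀ h : Perm α, ∀ k ∈ Icc 1 K, 0 ≤ 1 / (p * (p * k : ℕ) : ℝ) *
        if Expands ρ x (h * y * h⁻¹) then pairSum x (mix x y h) p (p * k) (fun _ _ => 1)
          else 0 := by
      intro h k _
      have := pairSum_nonneg (x := x) (g := mix x y h) (p := p) (ℓ := p * k) hone
      positivity
    refine Pr_le_Ex (fun h => sum_nonneg (hnn h)) ?_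
    rintro h ⟨hE, s, hs, z, hz, ⟨k, hk⟩, hle⟩
    have hk0 : 0 < k := Nat.pos_of_ne_zero fun h0 => by
      have := per_pos (mix x y h) z
      rw [hk, h0] at this
      simp at this
    have hkK : k ≤ K := by
      rw [hK, Nat.le_div_iff_mul_le hp, mul_comm, ← hk]
      exact hle
    refine le_trans ?_ (single_le_sum (hnn h) (mem_Icc.2 ⟨hk0, hkK⟩))
    rw [if_pos hE, ← hk]
    have h2 := mul_le_pairSum_one hs hz
    have h3 : (0 : ℝ) < per (mix x y h) z := by exact_mod_cast per_pos _ _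
    rw [one_div, inv_mul_eq_div, le_div_iff₀ (by positivity), one_mul]
    exact h2
  refine h1.trans ?_
  rw [Ex_sum (Icc 1 K) fun (k : ℕ) h => 1 / (p * (p * k : ℕ) : ℝ) *
        if Expands ρ x (h * y * h⁻¹) then pairSum x (mix x y h) p (p * k) (fun _ _ => 1)
          else 0]
  have h2 : ∀ k ∈ Icc 1 K, Ex (fun h => 1 / (p * (p * k : ℕ) : ℝ) *
        if Expands ρ x (h * y * h⁻¹) then pairSum x (mix x y h) p (p * k) (fun _ _ => 1)
          else 0) ≤ 4 / (ρ ^ 2 * p ^ 2) * (k : ℝ)⁻¹ := by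
    intro k hk
    obtain ⟨hk1, hk2⟩ := mem_Icc.1 hk
    have hk0 : (0 : ℝ) < k := by exact_mod_cast hk1
    rw [Ex_mul_left]
    have h3 : p * k ≤ ℓ₀ := by
      rw [mul_comm]
      exact (Nat.le_div_iff_mul_le hp).1 hk2
    have h4 := Ex_expands_pairSum_le x y (p := p) (ℓ := p * k) (q := Fintype.card α)
      hρ hρ1 hp (by positivity) (by omega) hone (fun g S _ => by simp) (fun g S _ => by simp)
    refine (mul_le_mul_of_nonneg_left h4 (by positivity)).trans (le_of_eq ?_)
    push_cast
    field_simp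
  refine (sum_le_sum h2).trans ?_
  rw [← mul_sum, div_mul_eq_mul_div, ]
  gcongr
  have h5 := harmonic_le_one_add_log K
  rw [harmonic_eq_sum_Icc] at h5
  push_cast at h5
  refine h5.trans (add_le_add le_rfl ?_)
  rcases Nat.eq_zero_or_pos K with h0 | h0
  · rw [h0]
    simp only [Nat.cast_zero, Real.log_zero]
    exact Real.log_natCast_nonneg _
  · refine Real.log_le_log (by exact_mod_cast h0) ?_
    have : K ≤ ℓ₀ := Nat.div_le_self _ _
    exact_mod_cast (by omega : K ≤ Fintype.card α)

lemma inv_apply_notMem_of_genPts {x g : Perm α} {p : ℕ} {s a : α} (hs : s ∈ genPts x g p)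
    (ha : a ∈ cyc g s) : x⁻¹ a ∉ cyc g s := fun h => by
  refine disjoint_left.1 (mem_filter.1 hs).2.2 ha ?_
  by_contra hcon
  exact inv_apply_notMem_iff.2 hcon h

lemma pairSum_inter {x g : Perm α} {p ℓ : ℕ} :
    pairSum x g p ℓ (fun S Z => (#(S ∩ x • Z) : ℝ)) =
      ℓ * ∑ s ∈ genPts x g p, (#{a ∈ cyc g s | per g (x⁻¹ a) = ℓ} : ℝ) := by
  classical
  rw [pairSum, mul_sum, ← sum_subset (subset_univ (genPts x g p))]
  swap
  · intro s _ hs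
    simp [hs]
  refine sum_congr rfl fun s hs => ?_
  have h1 : ∀ z, (if s ∈ genPts x g p ∧ per g z = ℓ ∧ z ∉ cyc g s then
      (#(cyc g s ∩ x • cyc g z) : ℝ) else 0) =
      ∑ a ∈ cyc g s, if per g (x⁻¹ a) = ℓ ∧ z ∈ cyc g (x⁻¹ a) then (1 : ℝ) else 0 := by
    intro z
    rw [← sum_filter_add_sum_filter_not (cyc g s) fun a => a ∈ x • cyc g z]
    rw [sum_eq_zero (s := filter (fun a => ¬ a ∈ x • cyc g z) _), add_zero]
    swap
    · intro a ha
      rw [if_neg]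
      rintro ⟨-, h⟩
      exact inv_apply_notMem_iff.2 (mem_filter.1 ha).2 (mem_cyc_comm.1 h)
    have h2 : ∀ a ∈ filter (fun a => a ∈ x • cyc g z) (cyc g s), x⁻¹ a ∈ cyc g z := by
      intro a ha
      by_contra h
      exact inv_apply_notMem_iff.1 h (mem_filter.1 ha).2
    rw [filter_mem_eq_inter] at h2 ⊢
    by_cases hz : per g z = ℓ
    · by_cases hzs : z ∈ cyc g s
      · rw [if_neg (by tauto), sum_eq_zero]
        intro a ha
        exact absurd ((cyc_eq_of_mem hzs) ▸ h2 a ha)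
          (inv_apply_notMem_of_genPts hs (mem_inter.1 ha).1)
      · rw [if_pos ⟨hs, hz, hzs⟩, card_eq_sum_ones, Nat.cast_sum]
        refine sum_congr rfl fun a ha => ?_
        rw [if_pos ⟨(per_eq_of_mem (h2 a ha)).trans hz, mem_cyc_comm.1 (h2 a ha)⟩, Nat.cast_one]
    · rw [if_neg (by tauto), sum_eq_zero]
      intro a ha
      rw [if_neg]
      rintro ⟨h3, -⟩
      exact hz ((per_eq_of_mem (h2 a ha)).symm.trans h3)
  rw [sum_congr rfl fun z _ => h1 z, sum_comm, natCast_card_filter, mul_sum]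
  refine sum_congr rfl fun a _ => ?_
  by_cases h2 : per g (x⁻¹ a) = ℓ
  · simp only [h2, true_and, if_true, mul_one]
    rw [← natCast_card_filter, filter_mem_eq_inter, univ_inter, card_cyc, h2]
  · simp only [h2, false_and, if_false, sum_const_zero, mul_zero]

/-- Generic `p`-cycles mostly linked to short cycles are unlikely. -/
lemma Pr_short_linked_le (x y : Perm α) {p ℓ₀ : ℕ} {ρ : ℝ} (hρ : 0 < ρ) (hρ1 : ρ ≤ 1)
    (hp : 0 < p) (hn : 4 * (p + ℓ₀) ≤ Fintype.card α) :
    Pr (fun h => Expands ρ x (h * y * h⁻¹) ∧ ∃ s ∈ genPts x (mix x y h) p,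
      p ≤ 2 * #{a ∈ cyc (mix x y h) s | per (mix x y h) (x⁻¹ a) ≤ ℓ₀}) ≤
      8 * ℓ₀ / (p * Fintype.card α * ρ ^ 2) := by
  classical
  have hn0 : (0 : ℝ) < Fintype.card α := by
    have : 0 < Fintype.card α := by omega
    exact_mod_cast this
  have hp0 : (0 : ℝ) < p := by exact_mod_cast hp
  have hQ : ∀ S Z : Finset α, (0 : ℝ) ≤ #(S ∩ x • Z) := fun _ _ => Nat.cast_nonneg _
  have h1 : Pr (fun h => Expands ρ x (h * y * h⁻¹) ∧ ∃ s ∈ genPts x (mix x y h) p,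
      p ≤ 2 * #{a ∈ cyc (mix x y h) s | per (mix x y h) (x⁻¹ a) ≤ ℓ₀}) ≤
      Ex (fun h => ∑ ℓ ∈ Icc 1 ℓ₀, 2 / (p ^ 2 * ℓ : ℝ) *
        if Expands ρ x (h * y * h⁻¹) then pairSum x (mix x y h) p ℓ (fun S Z => (#(S ∩ x • Z) : ℝ))
          else 0) := by
    refine Pr_le_Ex (fun h => sum_nonneg fun ℓ _ => ?_) ?_
    · have := pairSum_nonneg (x := x) (g := mix x y h) (p := p) (ℓ := ℓ) hQ
      positivity
    rintro h ⟨hE, s, hs, hle⟩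
    simp only [if_pos hE, pairSum_inter]
    set g := mix x y h
    have h2 : ∀ ℓ ∈ Icc 1 ℓ₀, 2 / (p ^ 2 * ℓ : ℝ) * (ℓ * ∑ s ∈ genPts x g p,
        (#{a ∈ cyc g s | per g (x⁻¹ a) = ℓ} : ℝ)) =
        2 / (p ^ 2 : ℝ) * ∑ t ∈ genPts x g p, (#{a ∈ cyc g t | per g (x⁻¹ a) = ℓ} : ℝ) := by
      intro ℓ hℓ
      have : (0 : ℝ) < ℓ := by exact_mod_cast (mem_Icc.1 hℓ).1
      field_simp
    rw [sum_congr rfl h2, ← mul_sum, sum_comm]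
    have h3 : ∀ t, ∑ ℓ ∈ Icc 1 ℓ₀, (#{a ∈ cyc g t | per g (x⁻¹ a) = ℓ} : ℝ) =
        #{a ∈ cyc g t | per g (x⁻¹ a) ≤ ℓ₀} := by
      intro t
      rw [← Nat.cast_sum]
      congr 1
      rw [card_eq_sum_card_fiberwise (f := fun a => per g (x⁻¹ a)) (t := Icc 1 ℓ₀)]
      · refine sum_congr rfl fun ℓ hℓ => ?_
        congr 1
        ext a
        simp only [mem_filter]
        have := (mem_Icc.1 hℓ).2
        constructor
        · rintro ⟨h4, h5⟩; exact ⟨⟨h4, by omega⟩, h5⟩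
        · rintro ⟨⟨h4, -⟩, h5⟩; exact ⟨h4, h5⟩
      · intro a ha
        simp only [coe_filter, Set.mem_ofPred_eq] at ha
        simp only [coe_Icc, Set.mem_Icc]
        exact ⟨per_pos _ _, ha.2⟩
    simp only [h3]
    have h4 : ∑ t ∈ cyc g s, (#{a ∈ cyc g t | per g (x⁻¹ a) ≤ ℓ₀} : ℝ) ≤
        ∑ t ∈ genPts x g p, (#{a ∈ cyc g t | per g (x⁻¹ a) ≤ ℓ₀} : ℝ) :=
      sum_le_sum_of_subset_of_nonneg (fun t ht => genPts_of_mem_cyc hs ht)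
        fun _ _ _ => Nat.cast_nonneg _
    have h5 : ∑ t ∈ cyc g s, (#{a ∈ cyc g t | per g (x⁻¹ a) ≤ ℓ₀} : ℝ) =
        p * #{a ∈ cyc g s | per g (x⁻¹ a) ≤ ℓ₀} := by
      rw [sum_congr rfl fun t ht => by rw [cyc_eq_of_mem ht], sum_const, card_cyc,
        (mem_filter.1 hs).2.1, nsmul_eq_mul]
    rw [h5] at h4
    have h6 : (p : ℝ) ≤ 2 * #{a ∈ cyc g s | per g (x⁻¹ a) ≤ ℓ₀} := by exact_mod_cast hle
    rw [div_mul_eq_mul_div, le_div_iff₀ (by positivity), one_mul]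
    nlinarith
  refine h1.trans ?_
  rw [Ex_sum (Icc 1 ℓ₀) fun (ℓ : ℕ) h => 2 / (p ^ 2 * ℓ : ℝ) *
        if Expands ρ x (h * y * h⁻¹) then pairSum x (mix x y h) p ℓ (fun S Z => (#(S ∩ x • Z) : ℝ))
          else 0]
  have h2 : ∀ ℓ ∈ Icc 1 ℓ₀, Ex (fun h => 2 / (p ^ 2 * ℓ : ℝ) *
        if Expands ρ x (h * y * h⁻¹) then pairSum x (mix x y h) p ℓ (fun S Z => (#(S ∩ x • Z) : ℝ))
          else 0) ≤ 8 / (p * Fintype.card α * ρ ^ 2) := by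
    intro ℓ hℓ
    obtain ⟨hk1, hk2⟩ := mem_Icc.1 hℓ
    have hk0 : (0 : ℝ) < ℓ := by exact_mod_cast hk1
    rw [Ex_mul_left]
    have h4 := Ex_expands_pairSum_le x y (p := p) (ℓ := ℓ) (q := p * ℓ)
      hρ hρ1 hp hk1 (by omega) hQ (fun g S hS => ?_) (fun g Z hZ => ?_)
    · refine (mul_le_mul_of_nonneg_left h4 (by positivity)).trans (le_of_eq ?_)
      field_simp
      norm_num
    · have h5 := sum_card_path_inter_le g ℓ (x⁻¹ • S)
      rw [card_smul_finset, hS] at h5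
      have h6 : ∀ a, #(S ∩ x • path g a ℓ) = #(path g a ℓ ∩ x⁻¹ • S) := by
        intro a
        rw [← card_smul_finset x⁻¹ (S ∩ _), smul_finset_inter, inv_smul_smul, inter_comm]
      simp only [h6]
      rw [mul_comm]
      exact_mod_cast h5
    · have h5 := sum_card_path_inter_le g p (x • Z)
      rw [card_smul_finset, hZ] at h5
      exact_mod_cast h5
  refine (sum_le_sum h2).trans (le_of_eq ?_)
  rw [sum_const, Nat.card_Icc, nsmul_eq_mul, add_tsub_cancel_right]
  ring

end

end FixedOrder

namespace FixedOrder
open Equiv Finset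
open scoped Pointwise

section
variable {α : Type*} [Fintype α] [DecidableEq α]

lemma per_eq_of_first_return {g : Perm α} {a : α} {ℓ : ℕ} (hℓ : 0 < ℓ) (h : (g ^ ℓ) a = a)
    (h' : ∀ j, 0 < j → j < ℓ → (g ^ j) a ≠ a) : per g a = ℓ := by
  rcases (Nat.le_of_dvd hℓ (pow_apply_eq_self_iff.1 h)).lt_or_eq with h1 | h1
  · exact absurd (pow_per g a) (h' _ (per_pos g a) h1)
  · exact h1

/-- Switching two points of a cycle splits it. -/
lemma per_mul_swap {g : Perm α} {u : α} {i : ℕ} (hi : 0 < i) (hiu : i < per g u) :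
    per (g * swap u ((g ^ i) u)) ((g ^ i) u) = i := by
  set v := (g ^ i) u with hv
  set g' := g * swap u v with hg'
  have hne : ∀ j k, j < per g u → k < per g u → (g ^ j) u = (g ^ k) u → j = k :=
    fun j k hj hk h => pow_injOn_per g u (by simpa using hj) (by simpa using hk) h
  have h1 : ∀ j, 0 < j → j ≤ i → (g' ^ j) v = (g ^ j) u := by
    intro j
    induction j with
    | zero => intro h; omega
    | succ j ih =>
      intro _ hj
      rw [pow_succ' g', Perm.mul_apply, pow_succ' g]
      rcases Nat.eq_zero_or_pos j with rfl | hj0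
      · simp [hg']
      · rw [ih hj0 (by omega), hg', Perm.mul_apply, swap_apply_of_ne_of_ne, Perm.mul_apply]
        · intro h
          have := hne j 0 (by omega) (by omega) h
          omega
        · intro h
          have := hne j i (by omega) (by omega) h
          omega
  refine per_eq_of_first_return hi (h1 i hi le_rfl) fun j hj hji h => ?_
  rw [h1 j hj hji.le] at h
  have := hne j i (by omega) (by omega) h
  omega

/-- Switching the images of points of two cycles merges them. -/
lemma per_swap_mul {g : Perm α} {a b : α} (hb : b ∉ cyc g a) :
    per (swap a b * g) a = per g a + per g b := by
  have ha : a ∉ cyc g b := fun h => hb (mem_cyc_comm.1 h)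
  set g' := swap a b * g with hg'
  have e1 : swap a b * g * swap b b = g' := by rw [swap_self]; rfl
  have e2 : swap b a * g * swap a a = g' := by rw [swap_self, swap_comm]; rfl
  have s1 := switch_path hb hb hb
  have s2 := switch_path ha ha ha
  rw [e1] at s1
  rw [e2] at s2
  have hp1 : ∀ j < per g a, (g' ^ j) a = (g ^ j) a := by
    refine pow_eq_of_agree fun i hi => ?_
    have h3 : g ((g ^ i) a) = (g ^ (i + 1)) a := by rw [pow_succ']; rfl
    rw [hg', Perm.mul_apply, h3]
    refine swap_apply_of_ne_of_ne (fun h => ?_) (fun h => ?_)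
    · have := Nat.le_of_dvd (by omega) (pow_apply_eq_self_iff.1 h)
      omega
    · exact hb (h ▸ pow_mem_cyc g a (i + 1))
  have hadd : ∀ j, (g' ^ (j + per g a)) a = (g' ^ j) b := by
    intro j
    rw [pow_add, Perm.mul_apply, s1.2]
  have h1 := per_pos g a
  refine per_eq_of_first_return (by omega) ?_ fun j hj hj' h => ?_
  · rw [add_comm, hadd, s2.2]
  · rcases lt_trichotomy j (per g a) with h2 | h2 | h2
    · rw [hp1 j h2] at h
      have := Nat.le_of_dvd hj (pow_apply_eq_self_iff.1 h)
      omega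
    · rw [h2, s1.2] at h
      exact hb (h ▸ self_mem_cyc g a)
    · obtain ⟨k, rfl⟩ : ∃ k, j = k + per g a := ⟨j - per g a, by omega⟩
      rw [hadd] at h
      have h4 : (g' ^ k) b ∈ cyc g b := by
        rw [← s2.1]
        exact mem_image.2 ⟨k, mem_range.2 (by omega), rfl⟩
      exact ha (h ▸ h4)

lemma per_swap_mul_eq_or {g : Perm α} {a b c : α} (hb : b ∉ cyc g a) (hc : c ∉ cyc g a) :
    per (swap a b * g) c = per g c ∨ per (swap a b * g) c = per g c + per g a := by
  have ha : a ∉ cyc g b := fun h => hb (mem_cyc_comm.1 h)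
  by_cases hcb : c ∈ cyc g b
  · right
    have h2 : swap a b * g = swap b a * g := by rw [swap_comm]
    have e2 : swap b a * g * swap a a = swap a b * g := by rw [swap_self, swap_comm]; rfl
    have s2 := switch_path ha ha ha
    rw [e2] at s2
    have h3 : c ∈ cyc (swap a b * g) b := by
      rw [← s2.1] at hcb
      obtain ⟨i, -, rfl⟩ := mem_image.1 hcb
      exact pow_mem_cyc _ _ _
    rw [per_eq_of_mem h3, per_eq_of_mem hcb, h2, per_swap_mul ha]
  · left
    have h1 : a ∉ cyc g c := fun h => hc (mem_cyc_comm.1 h)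
    have h2 : b ∉ cyc g c := fun h => hcb (mem_cyc_comm.1 h)
    have h3 := switch_cyc h1 h2 h1 h1
    have e1 : swap a b * g * swap a a = swap a b * g := by rw [swap_self]; rfl
    rw [e1] at h3
    rw [← card_cyc, h3, card_cyc]

/-- Two (possibly equal) cycles of length at least `k` have lengths summing to a multiple of
`p`. -/
def DvdSum (k p : ℕ) (g : Perm α) : Prop :=
  ∃ c d, k ≤ per g c ∧ k ≤ per g d ∧ p ∣ per g c + per g d

lemma dvdSum_switch {g : Perm α} {a b u z : α} {k p i : ℕ} (ha : per g a = p) (hu : u ∉ cyc g a)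
    (hb : b ∉ cyc g a) (hz : z ∉ cyc g a) (hzp : p ∣ per g z) (hzk : k ≤ per g z)
    (hi : 0 < i) (hiu : i < per g u) (hik : k ≤ i) (hik' : k ≤ per g u - i) :
    DvdSum k p (swap a b * g * swap u ((g ^ i) u)) := by
  set v := (g ^ i) u with hv
  have hvu : v ∈ cyc g u := pow_mem_cyc g u i
  have hva : v ∉ cyc g a := fun h => hu (by
    rw [← cyc_eq_of_mem h, cyc_eq_of_mem hvu]
    exact self_mem_cyc g u)
  set g' := g * swap u v with hg'
  have hag : ∀ w, u ∉ cyc g w → v ∉ cyc g w → ∀ t ∈ cyc g w, g' t = g t := by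
    intro w h1 h2 t ht
    rw [hg', Perm.mul_apply, swap_apply_of_ne_of_ne]
    · rintro rfl; exact h1 ht
    · rintro rfl; exact h2 ht
  have hca : cyc g' a = cyc g a := cyc_eq_of_agree (hag a hu hva)
  have hpa : per g' a = p := by rw [← card_cyc, hca, card_cyc, ha]
  have hkey : ∀ c, c ∉ cyc g a → k ≤ per g' c → k ≤ per (swap a b * g') c ∧
      (p : ℤ) ∣ (per (swap a b * g') c : ℤ) - per g' c := by
    intro c hc hk
    rcases per_swap_mul_eq_or (g := g') (a := a) (b := b) (by rwa [hca]) (by rwa [hca] : c ∉ cyc g' a) with h | h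
    · rw [h]; simp [hk]
    · rw [h, hpa]; exact ⟨by omega, by simp⟩
  have hfin : ∀ c d, c ∉ cyc g a → d ∉ cyc g a → k ≤ per g' c → k ≤ per g' d →
      p ∣ per g' c + per g' d → DvdSum k p (swap a b * g') := by
    intro c d hc hd hkc hkd hdvd
    obtain ⟨h1, h2⟩ := hkey c hc hkc
    obtain ⟨h3, h4⟩ := hkey d hd hkd
    refine ⟨c, d, h1, h3, ?_⟩
    have h5 : (p : ℤ) ∣ (per g' c + per g' d : ℕ) := by exact_mod_cast hdvd
    have h6 := dvd_add (dvd_add h2 h4) h5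
    rw [← Int.natCast_dvd_natCast]
    have h7 : ((per (swap a b * g') c + per (swap a b * g') d : ℕ) : ℤ) =
        ((per (swap a b * g') c : ℤ) - per g' c) + ((per (swap a b * g') d : ℤ) - per g' d) +
        ((per g' c + per g' d : ℕ) : ℤ) := by push_cast; ring
    rwa [h7]
  rw [mul_assoc]
  by_cases hzu : z ∈ cyc g u
  · have h1 : per g' v = i := per_mul_swap hi hiu
    have h2 : per g' u = per g u - i := by
      have h3 : (g ^ (per g u - i)) v = u := by
        rw [hv, ← Perm.mul_apply, ← pow_add, Nat.sub_add_cancel hiu.le, pow_per]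
      have h4 := per_mul_swap (g := g) (u := v) (i := per g u - i) (by omega)
        (by rw [per_eq_of_mem hvu]; omega)
      rw [h3, swap_comm] at h4
      exact h4
    refine hfin u v hu hva (by omega) (by omega) ?_
    rw [h1, h2, Nat.sub_add_cancel hiu.le, ← per_eq_of_mem hzu]
    exact hzp
  · have h1 : u ∉ cyc g z := fun h => hzu (mem_cyc_comm.1 h)
    have h2 : v ∉ cyc g z := fun h => h1 (by
      rw [← cyc_eq_of_mem h, cyc_eq_of_mem hvu]
      exact self_mem_cyc g u)
    have h3 : per g' z = per g z := per_eq_of_agree (hag z h1 h2)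
    refine hfin z z hz hz (by omega) (by omega) ?_
    rw [h3]
    exact dvd_add hzp hzp

/-- Generic `p`-cycles mostly linked to long cycles, in the presence of a long cycle of length
divisible by `p`. -/
lemma mul_Pr_long_linked_le (x y : Perm α) {p k : ℕ} (hp : 0 < p) (hk : 2 * p ≤ k) :
    (k * p : ℝ) * Pr (fun h => ∃ s ∈ genPts x (mix x y h) p,
      (∃ z, z ∉ cyc (mix x y h) s ∧ p ∣ per (mix x y h) z ∧ 4 * k < per (mix x y h) z) ∧
      p ≤ 2 * #{a ∈ cyc (mix x y h) s | 4 * k < per (mix x y h) (x⁻¹ a)}) ≤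
      4 * Fintype.card α * Pr (fun h => DvdSum k p (mix x y h)) := by
  classical
  set f : Perm α → α → ℝ := fun h a => if a ∈ genPts x (mix x y h) p ∧
    4 * k < per (mix x y h) (x⁻¹ a) ∧
    ∃ z, z ∉ cyc (mix x y h) a ∧ p ∣ per (mix x y h) z ∧ 4 * k < per (mix x y h) z then 1 else 0
    with hf
  have hf0 : ∀ h a, 0 ≤ f h a := fun h a => by simp only [hf]; positivity
  have h1 := sum_switch_le (x := x) (y := y) (ℓ := p) (f := f)
    (W := fun h _ => if DvdSum k p (mix x y h) then 1 else 0) (m := (k : ℝ) / 2)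
    (fun h a => ((Ico k (2 * k)).image fun i => x ((mix x y h ^ i) (x⁻¹ a))) \ cyc (mix x y h) a)
    hf0 (fun _ _ => by positivity) ?_ ?_
  · have h2 : Ex (fun h => ∑ _a : α, if DvdSum k p (mix x y h) then (1 : ℝ) else 0) =
        Fintype.card α * Pr (fun h => DvdSum k p (mix x y h)) := by
      rw [Pr, ← Ex_mul_left]
      congr! 2 with h
      rw [sum_const, card_univ, nsmul_eq_mul]
    have h3 : Pr (fun h => ∃ s ∈ genPts x (mix x y h) p,
        (∃ z, z ∉ cyc (mix x y h) s ∧ p ∣ per (mix x y h) z ∧ 4 * k < per (mix x y h) z) ∧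
        p ≤ 2 * #{a ∈ cyc (mix x y h) s | 4 * k < per (mix x y h) (x⁻¹ a)}) ≤
        Ex (fun h => 2 / p * ∑ a, f h a) := by
      refine Pr_le_Ex (fun h => mul_nonneg (by positivity) (sum_nonneg fun a _ => hf0 h a)) ?_
      rintro h ⟨s, hs, ⟨z, hz1, hz2, hz3⟩, hle⟩
      have hp0 : (0 : ℝ) < p := by exact_mod_cast hp
      have h4 : (p : ℝ) ≤ 2 * #{a ∈ cyc (mix x y h) s | 4 * k < per (mix x y h) (x⁻¹ a)} := by
        exact_mod_cast hle
      have h5 : (#{a ∈ cyc (mix x y h) s | 4 * k < per (mix x y h) (x⁻¹ a)} : ℝ) ≤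
          ∑ a, f h a := by
        simp only [hf]
        rw [← natCast_card_filter]
        refine Nat.cast_le.2 (card_le_card fun a ha => ?_)
        obtain ⟨ha1, ha2⟩ := mem_filter.1 ha
        refine mem_filter.2 ⟨mem_univ _, genPts_of_mem_cyc hs ha1, ha2, z, ?_, hz2, hz3⟩
        rwa [cyc_eq_of_mem ha1]
      rw [div_mul_eq_mul_div, le_div_iff₀ hp0]
      linarith
    rw [h2] at h1
    rw [Ex_mul_left] at h3
    have hp0 : (0 : ℝ) < p := by exact_mod_cast hp
    refine (mul_le_mul_of_nonneg_left h3 (by positivity)).trans ?_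
    have h6 : (k * p : ℝ) * (2 / p * Ex fun h => ∑ a, f h a) =
        4 * (k / 2 * Ex fun h => ∑ a, f h a) := by
      field_simp
      ring
    rw [h6]
    linarith
  · intro h a hfa
    obtain ⟨ha, hu, -⟩ := (ite_ne_right_iff.1 hfa).1
    have hc := le_card_sdiff (cyc (mix x y h) a)
      ((Ico k (2 * k)).image fun i => x ((mix x y h ^ i) (x⁻¹ a)))
    rw [card_image_of_injOn, Nat.card_Ico, card_cyc, (mem_filter.1 ha).2.1] at hc
    · have : k ≤ 2 * #(((Ico k (2 * k)).image fun i => x ((mix x y h ^ i) (x⁻¹ a))) \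
        cyc (mix x y h) a) := by omega
      have : (k : ℝ) ≤ 2 * #(((Ico k (2 * k)).image fun i => x ((mix x y h ^ i) (x⁻¹ a))) \
        cyc (mix x y h) a) := by exact_mod_cast this
      linarith
    · intro i hi j hj hij
      simp only [coe_Ico, Set.mem_Ico] at hi hj
      exact pow_injOn_per (mix x y h) (x⁻¹ a) (Set.mem_Iio.2 (by omega))
        (Set.mem_Iio.2 (by omega))
        (x.injective hij)
  · intro h a b hfa hb
    have hc := (ite_ne_right_iff.1 hfa).1
    rw [show f h a = 1 from if_pos hc]
    obtain ⟨ha, hu, z, hz1, hz2, hz3⟩ := hc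
    obtain ⟨hb1, hb2⟩ := Finset.mem_sdiff.1 hb
    obtain ⟨i, hi, hib⟩ := mem_image.1 hb1
    rw [mem_Ico] at hi
    have hv : x⁻¹ b = (mix x y h ^ i) (x⁻¹ a) := by rw [← hib]; exact Perm.inv_eq_iff_eq.2 rfl
    have hua : x⁻¹ a ∉ cyc (mix x y h) a := inv_apply_notMem_of_genPts ha (self_mem_cyc _ _)
    have hva : (mix x y h ^ i) (x⁻¹ a) ∉ cyc (mix x y h) a := fun h' => hua (by
      rw [← cyc_eq_of_mem h', cyc_eq_of_mem (pow_mem_cyc _ _ i)]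
      exact self_mem_cyc _ _)
    have hper := (mem_filter.1 ha).2.1
    rw [mix_swap, hv]
    constructor
    · have := (switch_path hb2 hua hva).2
      rwa [hper] at this
    · rw [if_pos]
      exact dvdSum_switch hper hua hb2 hz1 hz2 (by omega) (by omega) (by omega) (by omega)
        (by omega)

lemma card_long_lengths_mul_le (g : Perm α) (k : ℕ) :
    #((univ.image (per g)).filter (k ≤ ·)) * k ≤ Fintype.card α := by
  set V := (univ.image (per g)).filter (k ≤ ·) with hV
  have h1 : ∀ v ∈ V, k ≤ #{z | per g z = v} := by
    intro v hv
    obtain ⟨hv1, hv2⟩ := mem_filter.1 hv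
    obtain ⟨z, -, rfl⟩ := mem_image.1 hv1
    refine hv2.trans ?_
    refine (card_cyc g z).symm.le.trans ?_
    exact card_le_card fun t ht => mem_filter.2 ⟨mem_univ _, per_eq_of_mem ht⟩
  calc #V * k = ∑ v ∈ V, k := by simp
    _ ≤ ∑ v ∈ V, #{z | per g z = v} := sum_le_sum h1
    _ = #(V.biUnion fun v => ({z | per g z = v} : Finset α)) := by
        refine (card_biUnion fun v _ w _ hvw => disjoint_left.2 fun z hz hz' => hvw ?_).symm
        rw [← (mem_filter.1 hz).2, ← (mem_filter.1 hz').2]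
    _ ≤ _ := card_le_univ _

lemma card_primeFactors_le_log {n : ℕ} (hn : n ≠ 0) : #n.primeFactors ≤ Nat.log 2 n := by
  refine Nat.le_log_of_pow_le (by norm_num) ?_
  calc 2 ^ #n.primeFactors = ∏ p ∈ n.primeFactors, 2 := by simp
    _ ≤ ∏ p ∈ n.primeFactors, p :=
        prod_le_prod' fun p hp => (Nat.prime_of_mem_primeFactors hp).two_le
    _ ≤ n := Nat.le_of_dvd (Nat.pos_of_ne_zero hn) (Nat.prod_primeFactors_dvd n)

open Classical in
lemma card_dvdSum_le (g : Perm α) {Λ : Finset ℕ} (hΛ : ∀ p ∈ Λ, p.Prime) {k : ℕ} :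
    #{p ∈ Λ | DvdSum k p g} * (k * k) ≤
      Fintype.card α * Fintype.card α * Nat.log 2 (2 * Fintype.card α) := by
  set V := (univ.image (per g)).filter (k ≤ ·) with hV
  have h1 : ({p ∈ Λ | DvdSum k p g} : Finset ℕ) ⊆
      (V ×ˢ V).biUnion fun w => (w.1 + w.2).primeFactors := by
    intro p hp
    obtain ⟨hp1, c, d, hc, hd, hcd⟩ := mem_filter.1 hp
    refine mem_biUnion.2 ⟨(per g c, per g d), ?_, ?_⟩
    · simp [hV, hc, hd]
    · have := per_pos g c
      exact Nat.mem_primeFactors.2 ⟨hΛ p hp1, hcd, by simp; omega⟩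
  have h2 : #{p ∈ Λ | DvdSum k p g} ≤ #V * #V * Nat.log 2 (2 * Fintype.card α) := by
    refine (card_le_card h1).trans ((card_biUnion_le_card_mul _ _
      (Nat.log 2 (2 * Fintype.card α)) fun w hw => ?_).trans ?_)
    · obtain ⟨hw1, hw2⟩ := mem_product.1 hw
      obtain ⟨c, -, hc⟩ := mem_image.1 (mem_filter.1 hw1).1
      obtain ⟨d, -, hd⟩ := mem_image.1 (mem_filter.1 hw2).1
      have h3 := per_pos g c
      have h4 := per_le_card g c
      have h5 := per_le_card g d
      exact (card_primeFactors_le_log (by omega)).trans (Nat.log_mono_right (by omega))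
    · rw [card_product]
  have h3 := card_long_lengths_mul_le g k
  calc _ ≤ #V * #V * Nat.log 2 (2 * Fintype.card α) * (k * k) := Nat.mul_le_mul_right _ h2
    _ = (#V * k) * (#V * k) * Nat.log 2 (2 * Fintype.card α) := by ring
    _ ≤ _ := Nat.mul_le_mul_right _ (Nat.mul_le_mul h3 h3)

end

end FixedOrder

namespace FixedOrder
open Equiv Finset
open scoped Pointwise

/-- The primes in `(4 ^ a, 4 ^ b]`. -/
def primesBetween (a b : ℕ) : Finset ℕ := {p ∈ Ioc (4 ^ a) (4 ^ b) | p.Prime}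

lemma eventually_theta_gap :
    ∀ᶠ j : ℕ in atTop, (4 : ℝ) ^ j ≤ ∑ p ∈ primesBetween j (j + 1), Real.log p := by
  have hlog : ∀ᶠ x : ℝ in atTop,
      Real.log (4 * x + 1) + 2 * Real.sqrt (4 * x) * Real.log (4 * x) ≤ x / 4 := by
    have h1 : ∀ᶠ y : ℝ in atTop, ‖Real.log y‖ ≤ 1 / 400 * ‖y ^ (1 / 2 : ℝ)‖ :=
      (isLittleO_log_rpow_atTop (by norm_num)).def (by norm_num)
    have h2 := (tendsto_id.const_mul_atTop (by norm_num : (0 : ℝ) < 4)).eventually h1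
    have h3 := (tendsto_atTop_add_const_right atTop (1 : ℝ)
      (tendsto_id.const_mul_atTop (by norm_num : (0 : ℝ) < 4))).eventually h1
    filter_upwards [h2, h3, eventually_ge_atTop 1] with x h2 h3 hx
    simp only [id] at h2 h3
    rw [← Real.sqrt_eq_rpow, Real.norm_eq_abs, Real.norm_of_nonneg (Real.sqrt_nonneg _)] at h2 h3
    have h4 := (le_abs_self _).trans h2
    have h5 := (le_abs_self _).trans h3
    have h6 : Real.sqrt (4 * x) * Real.sqrt (4 * x) = 4 * x := Real.mul_self_sqrt (by linarith)
    have h7 : Real.sqrt (4 * x + 1) ≤ 5 * x := by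
      rw [Real.sqrt_le_left (by linarith)]
      nlinarith
    have h8 : Real.sqrt (4 * x) * Real.log (4 * x) ≤
        Real.sqrt (4 * x) * (1 / 400 * Real.sqrt (4 * x)) :=
      mul_le_mul_of_nonneg_left h4 (Real.sqrt_nonneg _)
    nlinarith
  have h4 : Tendsto (fun j : ℕ => (4 : ℝ) ^ j) atTop atTop :=
    tendsto_pow_atTop_atTop_of_one_lt (by norm_num)
  filter_upwards [h4.eventually hlog] with j hj
  have h1 := Chebyshev.theta_ge (4 ^ (j + 1))
  have h2 := Chebyshev.theta_le_log4_mul_x (x := ((4 ^ j : ℕ) : ℝ)) (by positivity)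
  have h3 : Chebyshev.theta ((4 ^ (j + 1) : ℕ) : ℝ) = Chebyshev.theta ((4 ^ j : ℕ) : ℝ) +
      ∑ p ∈ primesBetween j (j + 1), Real.log p := by
    unfold Chebyshev.theta primesBetween
    rw [Nat.floor_natCast, Nat.floor_natCast, ← sum_union]
    · rw [← filter_union, Ioc_union_Ioc_eq_Ioc (by positivity)
        (Nat.pow_le_pow_right (by norm_num) (by omega))]
    · exact disjoint_filter_filter (Ioc_disjoint_Ioc_of_le le_rfl)
  have hl2 := Real.log_two_gt_d9
  have hl4 : Real.log 4 = 2 * Real.log 2 := by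
    rw [show (4 : ℝ) = 2 ^ 2 by norm_num, Real.log_pow]; norm_num
  have h5 : ((4 ^ (j + 1) : ℕ) : ℝ) = 4 * 4 ^ j := by push_cast; ring
  rw [h5] at h1 h3
  rw [h3] at h1
  push_cast at h1 h2
  have h6 : (0 : ℝ) < 4 ^ j := by positivity
  rw [hl4] at h2
  nlinarith

lemma eventually_primesBetween_succ : ∀ᶠ j : ℕ in atTop,
    1 / (4 * Real.log 4 * (j + 1)) ≤ ∑ p ∈ primesBetween j (j + 1), (1 / p : ℝ) := by
  filter_upwards [eventually_theta_gap] with j hj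
  have hl : 0 < Real.log 4 := Real.log_pos (by norm_num)
  have h1 : ∀ p ∈ primesBetween j (j + 1),
      Real.log p / (4 ^ (j + 1) * ((j + 1) * Real.log 4)) ≤ 1 / p := by
    intro p hp
    have hp1 := (mem_Ioc.1 (mem_filter.1 hp).1)
    have hp0 : 0 < p := lt_of_le_of_lt (Nat.zero_le _) hp1.1
    have hp0' : (0 : ℝ) < p := by exact_mod_cast hp0
    have hp2 : (p : ℝ) ≤ 4 ^ (j + 1) := by exact_mod_cast hp1.2
    have h2 : Real.log p ≤ (j + 1) * Real.log 4 := by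
      have := Real.log_le_log hp0' hp2
      rw [Real.log_pow] at this
      exact_mod_cast this
    rw [div_le_div_iff₀ (by positivity) hp0']
    have h3 : 0 ≤ Real.log p := Real.log_nonneg (by exact_mod_cast hp0)
    calc Real.log p * p ≤ ((j + 1) * Real.log 4) * 4 ^ (j + 1) :=
          mul_le_mul h2 hp2 hp0'.le (by positivity)
      _ = _ := by ring
  refine le_trans ?_ (sum_le_sum h1)
  rw [← sum_div, div_le_div_iff₀ (by positivity) (by positivity)]
  calc (1 : ℝ) * (4 ^ (j + 1) * ((j + 1) * Real.log 4))
      = 4 ^ j * (4 * Real.log 4 * (j + 1)) := by ring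
    _ ≤ _ := mul_le_mul_of_nonneg_right hj (by positivity)

lemma primesBetween_union {a b c : ℕ} (hab : a ≤ b) (hbc : b ≤ c) (f : ℕ → ℝ) :
    ∑ p ∈ primesBetween a c, f p =
      ∑ p ∈ primesBetween a b, f p + ∑ p ∈ primesBetween b c, f p := by
  unfold primesBetween
  rw [← sum_union (disjoint_filter_filter (Ioc_disjoint_Ioc_of_le le_rfl)), ← filter_union,
    Ioc_union_Ioc_eq_Ioc (Nat.pow_le_pow_right (by norm_num) hab)
      (Nat.pow_le_pow_right (by norm_num) hbc)]

/-- The reciprocals of the primes in a window of bounded logarithmic ratio have a large sum. -/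
lemma eventually_sum_primesBetween_ge (t : ℕ) : ∀ᶠ J : ℕ in atTop,
    t * (1 / (8 * Real.log 4)) ≤ ∑ p ∈ primesBetween J (2 ^ t * J), (1 / p : ℝ) := by
  have hl : 0 < Real.log 4 := Real.log_pos (by norm_num)
  obtain ⟨j₀, hj₀⟩ := eventually_atTop.1 eventually_primesBetween_succ
  have h1 : ∀ N, max j₀ 1 ≤ N → ∀ b, N ≤ b → b ≤ 2 * N →
      ((b : ℝ) - N) * (1 / (8 * Real.log 4 * N)) ≤ ∑ p ∈ primesBetween N b, (1 / p : ℝ) := by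
    intro N hN b hb
    induction b, hb using Nat.le_induction with
    | base => intro; rw [sub_self, zero_mul]; exact sum_nonneg fun _ _ => by positivity
    | succ b hb ih =>
      intro hb2
      have h2 := ih (by omega)
      rw [primesBetween_union hb (Nat.le_succ b)]
      have h3 := hj₀ b (by omega)
      have hN0 : (0 : ℝ) < N := by
        have : 0 < N := by omega
        exact_mod_cast this
      have hb3 : ((b : ℝ) + 1) ≤ 2 * N := by exact_mod_cast hb2
      have h4 : 1 / (8 * Real.log 4 * N) ≤ 1 / (4 * Real.log 4 * (b + 1)) := by
        apply one_div_le_one_div_of_le (by positivity)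
        nlinarith
      push_cast
      linarith
  filter_upwards [eventually_ge_atTop (max j₀ 1)] with J hJ
  induction t with
  | zero => simp; exact sum_nonneg fun _ _ => by positivity
  | succ t ih =>
    have hpow : 1 ≤ 2 ^ t := Nat.one_le_two_pow
    have h2 : J ≤ 2 ^ t * J := Nat.le_mul_of_pos_left _ hpow
    have h3 : 2 ^ (t + 1) * J = 2 * (2 ^ t * J) := by ring
    rw [h3, primesBetween_union h2 (by omega)]
    have h4 := h1 (2 ^ t * J) (by omega) (2 * (2 ^ t * J)) (by omega) le_rfl
    have hN0 : (0 : ℝ) < (2 ^ t * J : ℕ) := by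
      have : 0 < 2 ^ t * J := by omega
      exact_mod_cast this
    have h5 : (((2 * (2 ^ t * J) : ℕ) : ℝ) - (2 ^ t * J : ℕ)) *
        (1 / (8 * Real.log 4 * (2 ^ t * J : ℕ))) = 1 / (8 * Real.log 4) := by
      rw [Nat.cast_mul 2 (2 ^ t * J)]
      generalize ((2 ^ t * J : ℕ) : ℝ) = N at hN0
      field_simp
      push_cast
      ring
    rw [h5] at h4
    push_cast
    linarith

end FixedOrder

namespace FixedOrder
open Equiv Finset MulAction
open scoped Pointwise

section
variable {α : Type*} [Fintype α] [DecidableEq α]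

lemma Expands.isPretransitive {ρ : ℝ} {x z : Perm α} (hρ : 0 < ρ) (hE : Expands ρ x z) :
    IsPretransitive (Subgroup.closure {x, z}) α := by
  classical
  have hx : x ∈ Subgroup.closure {x, z} := Subgroup.subset_closure (by simp)
  have hz : z ∈ Subgroup.closure {x, z} := Subgroup.subset_closure (by simp)
  have hno : ∀ Z : Finset α, x • Z = Z → z • Z = Z → Z.Nonempty → Fintype.card α < 2 * #Z := by
    intro Z h1 h2 hne
    by_contra h
    have h3 := hE Z hne (by omega)
    rw [h1, h2, _root_.sdiff_self, Finset.bot_eq_empty, card_empty] at h3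
    have : (0 : ℝ) < #Z := by exact_mod_cast hne.card_pos
    have : 0 < ρ * #Z := by positivity
    rcases h3 with h3 | h3 <;> · push_cast at h3; linarith
  have hinv : ∀ a : α, ∀ g ∈ Subgroup.closure {x, z},
      ∀ b ∈ ({b | b ∈ orbit (Subgroup.closure {x, z}) a} : Finset α),
        g b ∈ ({b | b ∈ orbit (Subgroup.closure {x, z}) a} : Finset α) := by
    intro a g hg b hb
    simp only [mem_filter, mem_univ, true_and] at hb ⊢
    obtain ⟨k, rfl⟩ := hb
    exact ⟨⟨g, hg⟩ * k, mul_smul (⟨g, hg⟩ : Subgroup.closure {x, z}) k a⟩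
  refine ⟨fun a b => ?_⟩
  by_contra hcon
  have hbig : ∀ a, Fintype.card α < 2 * #{b | b ∈ orbit (Subgroup.closure {x, z}) a} := fun a =>
    hno _ (smul_eq_self_of_forall_mem (hinv a x hx)) (smul_eq_self_of_forall_mem (hinv a z hz))
      ⟨a, mem_filter.2 ⟨mem_univ _, mem_orbit_self a⟩⟩
  have hd : Disjoint ({c | c ∈ orbit (Subgroup.closure {x, z}) a} : Finset α)
      ({c | c ∈ orbit (Subgroup.closure {x, z}) b} : Finset α) := by
    rw [disjoint_left]
    intro c hc hc'
    simp only [mem_filter, mem_univ, true_and] at hc hc'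
    have := (orbit_eq_iff.2 hc).symm.trans (orbit_eq_iff.2 hc')
    obtain ⟨k, hk⟩ : b ∈ orbit (Subgroup.closure {x, z}) a := by
      rw [this]; exact mem_orbit_self b
    exact hcon ⟨k, hk⟩
  have h1 := card_le_univ (({c | c ∈ orbit (Subgroup.closure {x, z}) a} : Finset α) ∪
    ({c | c ∈ orbit (Subgroup.closure {x, z}) b} : Finset α))
  rw [card_union_of_disjoint hd] at h1
  have := hbig a
  have := hbig b
  omega

lemma alternatingGroup_le_closure {ρ : ℝ} {x z : Perm α} (hρ : 0 < ρ) (hE : Expands ρ x z)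
    {p : ℕ} (hp : p.Prime) {a : α} (ha : per (z * x) a = p)
    (hgood : ∀ b, b ∉ cyc (z * x) a → ¬ p ∣ per (z * x) b) (hlt : 3 * p < Fintype.card α)
    (hL : ∀ r d, 2 ≤ r → p ≤ d → r * d = Fintype.card α → ¬ Labelled r d x z) :
    alternatingGroup α ≤ Subgroup.closure {x, z} := by
  have hx : x ∈ Subgroup.closure {x, z} := Subgroup.subset_closure (by simp)
  have hz : z ∈ Subgroup.closure {x, z} := Subgroup.subset_closure (by simp)
  have := hE.isPretransitive hρ
  obtain ⟨k, hk1, hk2⟩ := exists_pow_isCycle hp ha hgood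
  have hk : (z * x) ^ k ∈ Subgroup.closure {x, z} := pow_mem (mul_mem hz hx) k
  refine alternatingGroup_le_of_isPreprimitive_of_prime_cycle ?_ hp hk hk1 hk2 hlt
  refine { isTrivialBlock_of_isBlock := fun {B} hB => ?_ }
  by_contra hcon
  rw [IsTrivialBlock, not_or, Set.not_subsingleton_iff] at hcon
  have hpB := le_ncard_of_isBlock_of_prime_cycle hp hk hk1 hk2 hB hcon.1
  obtain ⟨r, φ, h1, h2, h3⟩ := exists_labelling_of_isBlock hB hcon.1.nonempty
  have hr : 2 ≤ r := by
    by_contra hr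
    have : r = 0 ∨ r = 1 := by omega
    rcases this with rfl | rfl
    · omega
    · refine hcon.2 ?_
      rw [Set.eq_univ_iff_ncard, Nat.card_eq_fintype_card]
      omega
  exact hL r _ hr hpB h1 ⟨φ, h2, h3 x hx, h3 z hz⟩

end
end FixedOrder

namespace FixedOrder
open Equiv Finset
open scoped Pointwise

section
variable {α : Type*} [Fintype α] [DecidableEq α]

lemma sum_one_div_le_log {Λ : Finset ℕ} {n : ℕ} (hΛ : ∀ p ∈ Λ, 0 < p ∧ p ≤ n) :
    ∑ p ∈ Λ, (1 / p : ℝ) ≤ 1 + Real.log n := by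
  refine le_trans ?_ (harmonic_le_one_add_log n)
  rw [harmonic_eq_sum_Icc]
  push_cast
  simp only [one_div]
  exact sum_le_sum_of_subset_of_nonneg (fun p hp => mem_Icc.2 (hΛ p hp))
    fun _ _ _ => by positivity

lemma natLog_two_mul_le {n : ℕ} (hn : 0 < n) :
    (Nat.log 2 (2 * n) : ℝ) ≤ 2 * (1 + Real.log n) := by
  have hn0 : (1 : ℝ) ≤ n := by exact_mod_cast hn
  have h1 : (2 : ℝ) ^ Nat.log 2 (2 * n) ≤ 2 * n := by
    exact_mod_cast Nat.pow_log_le_self 2 (by omega : 2 * n ≠ 0)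
  have h2 := Real.log_le_log (by positivity) h1
  rw [Real.log_pow, Real.log_mul (by norm_num) (by positivity)] at h2
  have h3 := Real.log_two_gt_d9
  have h4 := Real.log_nonneg hn0
  nlinarith [Nat.cast_nonneg (α := ℝ) (Nat.log 2 (2 * n))]

/-- The cycle of some point has length in `Λ`, dividing no other cycle length. -/
def HasIsolated (Λ : Finset ℕ) (g : Perm α) : Prop :=
  ∃ p ∈ Λ, ∃ a, per g a = p ∧ ∀ b, b ∉ cyc g a → ¬ p ∣ per g b

/-- Under expansion, isolated prime cycles are likely to exist. -/
lemma Pr_not_hasIsolated_le (x y : Perm α) {Λ : Finset ℕ} {P M F k : ℕ} {ρ : ℝ} (hρ : 0 < ρ)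
    (hρ1 : ρ ≤ 1) (hΛ : ∀ p ∈ Λ, p.Prime ∧ P ≤ p ∧ 2 * p + 1 ≤ M ∧ 2 * p ≤ k) (hP : 0 < P)
    (hM : 2 * M ≤ Fintype.card α) (hk0 : 0 < k) (hk : 20 * k ≤ Fintype.card α)
    (hx : fixCount x ≤ F) (hy : fixCount y ≤ F) {N μ H : ℝ} (hN : N = Fintype.card α)
    (hH : H = 1 + Real.log N) (hμ0 : 0 < μ) (hμ : μ ≤ ∑ p ∈ Λ, (1 / p : ℝ)) :
    Pr (fun h => Expands ρ x (h * y * h⁻¹) ∧ ¬ HasIsolated Λ (mix x y h)) ≤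
      (4 / μ + (F + 2 * M * (F + M)) / N) + (4 * H ^ 2 / (ρ ^ 2 * P) + 32 * k * H / (N * ρ ^ 2) +
        8 * N ^ 3 * H / (k ^ 3 * P)) := by
  classical
  have hcard : 0 < Fintype.card α := by omega
  have hN0 : 0 < N := by rw [hN]; exact_mod_cast hcard
  have hN1 : 1 ≤ N := by rw [hN]; exact_mod_cast hcard
  have hH1 : 1 ≤ H := by rw [hH]; have := Real.log_nonneg hN1; linarith
  have hP0 : (0 : ℝ) < P := by exact_mod_cast hP
  have hk0' : (0 : ℝ) < k := by exact_mod_cast hk0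
  have hp0 : ∀ p ∈ Λ, (0 : ℝ) < p := fun p hp => by exact_mod_cast (hΛ p hp).1.pos
  have hpP : ∀ p ∈ Λ, (P : ℝ) ≤ p := fun p hp => by exact_mod_cast (hΛ p hp).2.1
  set S : ℝ := ∑ p ∈ Λ, (1 / p : ℝ) with hS
  have hSH : S ≤ H := by
    rw [hH, hN]
    refine sum_one_div_le_log fun p hp => ?_
    obtain ⟨h1, h2, h3, h4⟩ := hΛ p hp
    exact ⟨h1.pos, by omega⟩
  have hS0 : 0 < S := hμ0.trans_le hμ
  set E : Perm α → Prop := fun h => ∀ p ∈ Λ, genPts x (mix x y h) p = ∅ with hE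
  set B₁ : ℕ → Perm α → Prop := fun p h => Expands ρ x (h * y * h⁻¹) ∧
    ∃ s ∈ genPts x (mix x y h) p, ∃ z, z ∉ cyc (mix x y h) s ∧ p ∣ per (mix x y h) z ∧
      per (mix x y h) z ≤ 4 * k with hB₁
  set B₂ : ℕ → Perm α → Prop := fun p h => Expands ρ x (h * y * h⁻¹) ∧
    ∃ s ∈ genPts x (mix x y h) p,
      p ≤ 2 * #{a ∈ cyc (mix x y h) s | per (mix x y h) (x⁻¹ a) ≤ 4 * k} with hB₂
  set B₃ : ℕ → Perm α → Prop := fun p h => ∃ s ∈ genPts x (mix x y h) p,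
      (∃ z, z ∉ cyc (mix x y h) s ∧ p ∣ per (mix x y h) z ∧ 4 * k < per (mix x y h) z) ∧
      p ≤ 2 * #{a ∈ cyc (mix x y h) s | 4 * k < per (mix x y h) (x⁻¹ a)} with hB₃
  have hsub : ∀ h, Expands ρ x (h * y * h⁻¹) ∧ ¬ HasIsolated Λ (mix x y h) →
      E h ∨ ∃ p ∈ Λ, B₁ p h ∨ B₂ p h ∨ B₃ p h := by
    rintro h ⟨hexp, hiso⟩
    by_cases hEh : E h
    · exact Or.inl hEh
    right
    simp only [hE] at hEh
    push Not at hEh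
    obtain ⟨p, hp, hne⟩ := hEh
    obtain ⟨s, hs⟩ := hne
    have hper := (mem_filter.1 hs).2.1
    refine ⟨p, hp, ?_⟩
    obtain ⟨z, hz1, hz2⟩ : ∃ z, z ∉ cyc (mix x y h) s ∧ p ∣ per (mix x y h) z := by
      by_contra hcon
      push Not at hcon
      exact hiso ⟨p, hp, s, hper, hcon⟩
    by_cases hz3 : per (mix x y h) z ≤ 4 * k
    · exact Or.inl ⟨hexp, s, hs, z, hz1, hz2, hz3⟩
    right
    by_cases hc : p ≤ 2 * #{a ∈ cyc (mix x y h) s | per (mix x y h) (x⁻¹ a) ≤ 4 * k}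
    · exact Or.inl ⟨hexp, s, hs, hc⟩
    · refine Or.inr ⟨s, hs, ⟨z, hz1, hz2, by omega⟩, ?_⟩
      have h1 := card_filter_add_card_filter_not (s := cyc (mix x y h) s)
        (fun a => per (mix x y h) (x⁻¹ a) ≤ 4 * k)
      rw [card_cyc, hper] at h1
      simp only [not_le] at h1
      omega
  have e₀ : Pr E ≤ 4 / μ + (F + 2 * M * (F + M)) / N := by
    have h1 := Pr_genPts_eq_empty_le x y hM hx hy
      (fun p hp => ⟨(hΛ p hp).1.pos, (hΛ p hp).2.2.1⟩ : ∀ p ∈ Λ, 0 < p ∧ 2 * p + 1 ≤ M)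
    rw [← hS, ← hN] at h1
    have h2 : Pr E ≤ 4 / S + (F + 2 * M * (F + M)) / N := by
      rw [div_add_div _ _ hS0.ne' hN0.ne', le_div_iff₀ (by positivity)]
      linarith
    have h3 : 4 / S ≤ 4 / μ := div_le_div_of_nonneg_left (by norm_num) hμ0 hμ
    linarith
  have hlog : Real.log (Fintype.card α) = H - 1 := by rw [hH, hN]; ring
  have e₁ : ∀ p ∈ Λ, Pr (B₁ p) ≤ 4 * H / (ρ ^ 2 * P) * (1 / p) := by
    intro p hp
    have h1 := Pr_short_dvd_le x y (p := p) (ℓ₀ := 4 * k) hρ hρ1 (hΛ p hp).1.pos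
      (by have := (hΛ p hp).2.2.2; omega)
    refine h1.trans ?_
    have := hp0 p hp
    rw [hlog, div_mul_div_comm, mul_one, add_sub_cancel]
    apply div_le_div_of_nonneg_left (by positivity) (by positivity)
    have h2 := hpP p hp
    rw [sq (p : ℝ), mul_assoc]
    gcongr
  have e₂ : ∀ p ∈ Λ, Pr (B₂ p) ≤ 32 * k / (N * ρ ^ 2) * (1 / p) := by
    intro p hp
    have h1 := Pr_short_linked_le x y (p := p) (ℓ₀ := 4 * k) hρ hρ1 (hΛ p hp).1.pos
      (by have := (hΛ p hp).2.2.2; omega)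
    refine h1.trans (le_of_eq ?_)
    have := hp0 p hp
    rw [← hN]
    push_cast
    field_simp
    norm_num
  have e₃ : ∀ p ∈ Λ, Pr (B₃ p) ≤ 4 * N / (k * P) * Pr (fun h => DvdSum k p (mix x y h)) := by
    intro p hp
    have h1 := mul_Pr_long_linked_le x y (hΛ p hp).1.pos (hΛ p hp).2.2.2
    have := hp0 p hp
    have h2 : (k * P : ℝ) * Pr (B₃ p) ≤ k * p * Pr (B₃ p) :=
      mul_le_mul_of_nonneg_right (mul_le_mul_of_nonneg_left (hpP p hp) hk0'.le) (Pr_nonneg _)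
    rw [div_mul_eq_mul_div, le_div_iff₀ (by positivity)]
    rw [← hN] at h1
    linarith
  have e₄ : ∑ p ∈ Λ, Pr (fun h => DvdSum k p (mix x y h)) ≤ 2 * N ^ 2 * H / k ^ 2 := by
    have h1 : ∑ p ∈ Λ, Pr (fun h => DvdSum k p (mix x y h)) =
        Ex (fun h => ∑ p ∈ Λ, if DvdSum k p (mix x y h) then (1 : ℝ) else 0) := by
      rw [Ex_sum Λ fun p h => if DvdSum k p (mix x y h) then (1 : ℝ) else 0]
      unfold Pr
      congr! 2
    rw [h1, ← Ex_const (α := α) (2 * N ^ 2 * H / k ^ 2)]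
    refine Ex_mono fun h => ?_
    rw [← natCast_card_filter, le_div_iff₀ (by positivity)]
    have h2 := card_dvdSum_le (mix x y h) (fun p hp => (hΛ p hp).1) (k := k)
    have h3 : (#{p ∈ Λ | DvdSum k p (mix x y h)} : ℝ) * (k * k) ≤
        N * N * Nat.log 2 (2 * Fintype.card α) := by
      rw [hN]; exact_mod_cast h2
    have h4 := natLog_two_mul_le hcard
    rw [← hN, ← hH] at h4
    calc _ ≤ N * N * Nat.log 2 (2 * Fintype.card α) := by rw [sq]; exact h3
      _ ≤ N * N * (2 * H) := mul_le_mul_of_nonneg_left h4 (by positivity)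
      _ = _ := by ring
  refine (Pr_mono hsub).trans ((Pr_or_le _ _).trans (add_le_add e₀ ?_))
  refine (Pr_exists_le Λ fun p h => B₁ p h ∨ B₂ p h ∨ B₃ p h).trans ?_
  calc ∑ p ∈ Λ, Pr (fun h => B₁ p h ∨ B₂ p h ∨ B₃ p h)
      ≤ ∑ p ∈ Λ, (4 * H / (ρ ^ 2 * P) * (1 / p) + 32 * k / (N * ρ ^ 2) * (1 / p) +
        4 * N / (k * P) * Pr (fun h => DvdSum k p (mix x y h))) := by
        refine sum_le_sum fun p hp => ?_
        have h1 := Pr_or_le (B₁ p) fun h => B₂ p h ∨ B₃ p h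
        have h2 := Pr_or_le (B₂ p) (B₃ p)
        have := e₁ p hp
        have := e₂ p hp
        have := e₃ p hp
        linarith
    _ = 4 * H / (ρ ^ 2 * P) * S + 32 * k / (N * ρ ^ 2) * S +
        4 * N / (k * P) * ∑ p ∈ Λ, Pr (fun h => DvdSum k p (mix x y h)) := by
        rw [sum_add_distrib, sum_add_distrib, ← mul_sum, ← mul_sum, ← mul_sum]
    _ ≤ 4 * H / (ρ ^ 2 * P) * H + 32 * k / (N * ρ ^ 2) * H +
        4 * N / (k * P) * (2 * N ^ 2 * H / k ^ 2) := by
        gcongr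
    _ = _ := by
        congr 1
        · ring
        · field_simp
          norm_num

end
end FixedOrder

namespace FixedOrder
open Equiv Finset
open scoped Pointwise

/-- The exponent scale of the window of primes used for permutations of `n` points. -/
def windowExp (t n : ℕ) : ℕ := Nat.log 4 n / (4 * 2 ^ t)

lemma four_pow_windowExp_le {t n : ℕ} (hn : 0 < n) : (4 ^ (2 ^ t * windowExp t n)) ^ 4 ≤ n := by
  rw [← pow_mul]
  refine le_trans (Nat.pow_le_pow_right (by norm_num) ?_) (Nat.pow_log_le_self 4 hn.ne')
  have := Nat.div_mul_le_self (Nat.log 4 n) (4 * 2 ^ t)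
  unfold windowExp
  calc _ = Nat.log 4 n / (4 * 2 ^ t) * (4 * 2 ^ t) := by ring
    _ ≤ _ := this

lemma tendsto_windowExp (t : ℕ) : Tendsto (windowExp t) atTop atTop := by
  refine (Nat.tendsto_div_const_atTop (by positivity)).comp ?_
  refine tendsto_atTop_atTop.2 fun b => ⟨4 ^ b, fun n hn => ?_⟩
  exact (Nat.le_log_iff_pow_le (by norm_num)
    ((pow_pos (by norm_num) b).trans_le hn).ne').2 hn

lemma rpow_le_four_pow_windowExp {t n : ℕ} (hJ : 1 ≤ windowExp t n) :
    (n : ℝ) ^ (1 / (8 * 2 ^ t) : ℝ) ≤ (4 ^ windowExp t n : ℕ) := by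
  have h1 : n < 4 ^ (Nat.log 4 n + 1) := Nat.lt_pow_succ_log_self (by norm_num) n
  have h2 : Nat.log 4 n + 1 ≤ windowExp t n * (8 * 2 ^ t) := by
    have : Nat.log 4 n < (windowExp t n + 1) * (4 * 2 ^ t) := by
      unfold windowExp
      rw [mul_comm]
      exact Nat.lt_mul_div_succ _ (by positivity)
    have h3 : (windowExp t n + 1) * (4 * 2 ^ t) ≤ windowExp t n * (8 * 2 ^ t) := by
      calc _ ≤ (windowExp t n + windowExp t n) * (4 * 2 ^ t) := by gcongr
        _ = _ := by ring
    omega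
  have h4 : (n : ℝ) ≤ ((4 ^ windowExp t n : ℕ) : ℝ) ^ (8 * 2 ^ t) := by
    rw [← Nat.cast_pow, ← pow_mul]
    exact_mod_cast h1.le.trans (Nat.pow_le_pow_right (by norm_num) h2)
  calc (n : ℝ) ^ (1 / (8 * 2 ^ t) : ℝ)
      ≤ (((4 ^ windowExp t n : ℕ) : ℝ) ^ (8 * 2 ^ t)) ^ (1 / (8 * 2 ^ t) : ℝ) := by gcongr
    _ = _ := by
        rw [← Real.rpow_natCast, ← Real.rpow_mul (by positivity)]
        push_cast
        rw [mul_one_div_cancel (by positivity), Real.rpow_one]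

lemma eventually_mul_log_pow_le (A : ℝ) (k : ℕ) {ε : ℝ} (hε : 0 < ε) :
    ∀ᶠ n : ℕ in atTop, A * Real.log n ^ k ≤ (n : ℝ) ^ ε := by
  have h := ((isLittleO_log_rpow_rpow_atTop (k : ℝ) hε).def
    (show (0 : ℝ) < 1 / (|A| + 1) by positivity))
  filter_upwards [(tendsto_natCast_atTop_atTop (R := ℝ)).eventually h, eventually_ge_atTop 1]
    with n hn hn1
  have hl : 0 ≤ Real.log n := Real.log_nonneg (by exact_mod_cast hn1)
  rw [Real.rpow_natCast, Real.norm_of_nonneg (by positivity),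
    Real.norm_of_nonneg (by positivity), one_div, inv_mul_eq_div, le_div_iff₀ (by positivity)] at hn
  have : 0 ≤ Real.log n ^ k := by positivity
  nlinarith [le_abs_self A]

lemma eventually_le_log (A : ℝ) : ∀ᶠ n : ℕ in atTop, A ≤ Real.log n :=
  (Real.tendsto_log_atTop.comp (tendsto_natCast_atTop_atTop (R := ℝ))).eventually_ge_atTop A

lemma error_terms_le {A B δ η L P N k : ℝ} (hδ : 0 < δ) (hη : 0 < η) (hL : 1 ≤ L) (hLA : A ≤ L)
    (hP : 0 < P) (hPA : A * L ^ 17 ≤ P) (hN : 0 < N) (hk1 : N / (2 * L ^ 5) ≤ k)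
    (hk2 : k ≤ N / L ^ 5) (hA : B ≤ η / 8 * A) (hB1 : 640000 / δ ^ 2 ≤ B)
    (hB2 : 2560000 / δ ^ 2 ≤ B) (hB3 : 128 ≤ B) :
    4 * (1 + L) ^ 2 / ((δ / (200 * L)) ^ 2 * P) ≤ η / 8 ∧
    32 * k * (1 + L) / (N * (δ / (200 * L)) ^ 2) ≤ η / 8 ∧
    8 * N ^ 3 * (1 + L) / (k ^ 3 * P) ≤ η / 8 := by
  have hL0 : 0 < L := by linarith
  have hAP : A / P ≤ 1 / L ^ 17 := by
    rw [div_le_div_iff₀ hP (by positivity)]; linarith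
  have hH2 : 1 + L ≤ 2 * L := by linarith
  have hpow : ∀ j ≤ 17, η / 8 * (A / P * L ^ j) ≤ η / 8 := by
    intro j hj
    have h1 : L ^ j ≤ L ^ 17 := pow_le_pow_right₀ hL hj
    calc η / 8 * (A / P * L ^ j) ≤ η / 8 * (1 / L ^ 17 * L ^ 17) := by gcongr
      _ = η / 8 := by field_simp
  refine ⟨?_, ?_, ?_⟩
  · calc 4 * (1 + L) ^ 2 / ((δ / (200 * L)) ^ 2 * P)
        ≤ 4 * (2 * L) ^ 2 / ((δ / (200 * L)) ^ 2 * P) := by gcongr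
      _ = (640000 / δ ^ 2) * L ^ 4 / P := by field_simp; norm_num
      _ ≤ (η / 8 * A) * L ^ 4 / P := by gcongr; linarith
      _ = η / 8 * (A / P * L ^ 4) := by ring
      _ ≤ η / 8 := hpow 4 (by norm_num)
  · calc 32 * k * (1 + L) / (N * (δ / (200 * L)) ^ 2)
        ≤ 32 * (N / L ^ 5) * (2 * L) / (N * (δ / (200 * L)) ^ 2) := by gcongr
      _ = (2560000 / δ ^ 2) / L ^ 2 := by field_simp; norm_num
      _ ≤ (η / 8 * A) / L ^ 2 := by gcongr; linarith
      _ ≤ (η / 8 * L) / L ^ 2 := by gcongr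
      _ = η / 8 / L := by field_simp
      _ ≤ η / 8 := div_le_self (by positivity) hL
  · calc 8 * N ^ 3 * (1 + L) / (k ^ 3 * P)
        ≤ 8 * N ^ 3 * (2 * L) / ((N / (2 * L ^ 5)) ^ 3 * P) := by gcongr
      _ = 128 * L ^ 16 / P := by field_simp; norm_num
      _ ≤ (η / 8 * A) * L ^ 16 / P := by gcongr; linarith
      _ = η / 8 * (A / P * L ^ 16) := by ring
      _ ≤ η / 8 := hpow 16 (by norm_num)

set_option maxHeartbeats 1000000 in
theorem eventually_Pr_not_hasIsolated_le {K δ η : ℝ} (hK : 0 < K) (hδ : 0 < δ) (hη : 0 < η) :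
    ∃ ε : ℝ, 0 < ε ∧ ∀ᶠ n : ℕ in atTop, ∃ Λ : Finset ℕ,
      (∀ p ∈ Λ, p.Prime ∧ (n : ℝ) ^ ε ≤ p ∧ 3 * p < n) ∧
      ∀ x y : Perm (Fin n), Good K δ x y →
        Pr (fun h => Expands (rho δ n) x (h * y * h⁻¹) ∧ ¬ HasIsolated Λ (mix x y h)) ≤ η := by
  obtain ⟨t, ht⟩ := exists_nat_gt (8 * Real.log 4 * (8 / η))
  have hl4 : 0 < Real.log 4 := Real.log_pos (by norm_num)
  set μ : ℝ := t * (1 / (8 * Real.log 4)) with hμ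
  have hμ1 : 8 / η < μ := by
    rw [hμ, mul_one_div, lt_div_iff₀ (by positivity)]
    linarith
  have hμ0 : 0 < μ := lt_trans (by positivity) hμ1
  have hμη : 4 / μ ≤ η / 2 := by
    rw [div_lt_iff₀ hη] at hμ1
    rw [div_le_div_iff₀ hμ0 (by norm_num)]
    nlinarith
  set ε : ℝ := 1 / (8 * 2 ^ t) with hε
  have hε0 : 0 < ε := by positivity
  refine ⟨ε, hε0, ?_⟩
  obtain ⟨B, hB⟩ : ∃ B : ℝ, B = 640000 / δ ^ 2 + 2560000 / δ ^ 2 + 1024 + 7 * K + 18 := ⟨_, rfl⟩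
  have hB0 : 0 < B := by rw [hB]; positivity
  obtain ⟨A, hA⟩ : ∃ A : ℝ, A = 8 * B / η + δ + 100 := ⟨_, rfl⟩
  have hBA : 0 < 8 * B / η := by positivity
  have hA0 : 100 ≤ A := by linarith
  have hAB : B ≤ η / 8 * A := by
    have h1 : η / 8 * (8 * B / η) ≤ η / 8 * A := by gcongr; linarith
    have h2 : η / 8 * (8 * B / η) = B := by field_simp
    linarith
  filter_upwards [(tendsto_windowExp t).eventually (eventually_sum_primesBetween_ge t),
    (tendsto_windowExp t).eventually_ge_atTop 1, eventually_mul_log_pow_le A 17 hε0,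
    eventually_mul_log_pow_le A 6 (show (0 : ℝ) < 1 / 4 by norm_num), eventually_le_log A,
    eventually_gt_atTop 0] with n hsum hJ hn1 hn2 hL hn0
  have hJP := rpow_le_four_pow_windowExp hJ
  have hQ4 := four_pow_windowExp_le (t := t) hn0
  have hΛ : ∀ p ∈ primesBetween (windowExp t n) (2 ^ t * windowExp t n),
      p.Prime ∧ 4 ^ windowExp t n ≤ p ∧ p ≤ 4 ^ (2 ^ t * windowExp t n) := by
    intro p hp
    obtain ⟨h1, h2⟩ := mem_filter.1 hp
    obtain ⟨h3, h4⟩ := mem_Ioc.1 h1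
    exact ⟨h2, h3.le, h4⟩
  have hQ1 : 1 ≤ 4 ^ (2 ^ t * windowExp t n) := Nat.one_le_pow _ _ (by norm_num)
  have hP1 : 1 ≤ 4 ^ windowExp t n := Nat.one_le_pow _ _ (by norm_num)
  generalize primesBetween (windowExp t n) (2 ^ t * windowExp t n) = Λ at hsum hΛ
  generalize 4 ^ (2 ^ t * windowExp t n) = Q at hQ1 hQ4 hΛ
  generalize 4 ^ windowExp t n = P at hP1 hJP hΛ
  set L := Real.log n with hLdef
  have hnR : (0 : ℝ) < n := by exact_mod_cast hn0
  set w : ℝ := (n : ℝ) ^ (1 / 4 : ℝ) with hw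
  have hw4 : w ^ 4 = n := by
    rw [hw, ← Real.rpow_natCast, ← Real.rpow_mul hnR.le]; norm_num
  have hL1 : 1 ≤ L := by linarith
  have hwA : A ≤ w := by
    have : (1 : ℝ) ≤ L ^ 6 := one_le_pow₀ hL1
    nlinarith
  have hw0 : 0 < w := by linarith
  have hQw : (Q : ℝ) ≤ w := by
    refine le_of_pow_le_pow_left₀ (n := 4) (by norm_num) hw0.le ?_
    rw [hw4]; exact_mod_cast hQ4
  have hPA : A * L ^ 17 ≤ P := hn1.trans hJP
  have hsq : Real.sqrt n = w ^ 2 := by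
    rw [← hw4, show w ^ 4 = (w ^ 2) ^ 2 by ring, Real.sqrt_sq (by positivity)]
  have hkw : 2 * w ≤ (n : ℝ) / L ^ 5 - 1 := by
    rw [le_sub_iff_add_le, le_div_iff₀ (by positivity), ← hw4]
    have h5 : L ^ 5 ≤ w / 100 := by
      have : L ^ 5 ≤ L ^ 6 := pow_le_pow_right₀ hL1 (by norm_num)
      have : 0 ≤ L ^ 6 := by positivity
      nlinarith
    calc (2 * w + 1) * L ^ 5 ≤ (3 * w) * (w / 100) := by gcongr; linarith
      _ ≤ w ^ 4 := by nlinarith [pow_le_pow_right₀ (show 1 ≤ w by linarith) (show 2 ≤ 4 by norm_num), sq_nonneg w]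
  set k := ⌊(n : ℝ) / L ^ 5⌋₊ with hk
  have hk1 : (n : ℝ) / L ^ 5 - 1 < k := Nat.sub_one_lt_floor _
  have hk2 : (k : ℝ) ≤ n / L ^ 5 := Nat.floor_le (by positivity)
  have hQk : 2 * Q ≤ k := by
    have : ((2 * Q : ℕ) : ℝ) ≤ k := by push_cast; linarith
    exact_mod_cast this
  have hk0 : 0 < k := by omega
  have hk20 : 20 * k ≤ n := by
    have : (20 * k : ℝ) ≤ n := by
      have h5 : (20 : ℝ) ≤ L ^ 5 := le_trans (by linarith) (le_self_pow₀ hL1 (by norm_num))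
      rw [le_div_iff₀ (by positivity)] at hk2
      nlinarith
    exact_mod_cast this
  have hQn : 100 * Q ≤ n := by
    have : (100 * Q : ℝ) ≤ n := by
      rw [← hw4]
      have : (100 : ℝ) ≤ w ^ 3 := le_trans (by linarith) (le_self_pow₀ (by linarith) (by norm_num))
      calc (100 * Q : ℝ) ≤ w ^ 3 * w := by gcongr
        _ = _ := by ring
    exact_mod_cast this
  refine ⟨Λ, fun p hp => ?_, fun x y hG => ?_⟩
  · obtain ⟨h1, h2, h3⟩ := hΛ p hp
    exact ⟨h1, hJP.trans (Nat.cast_le.2 h2), by omega⟩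
  have hρ : 0 < rho δ n := by unfold rho; positivity
  have hρ1 : rho δ n ≤ 1 := by
    unfold rho
    rw [div_le_one (by positivity)]
    have : δ ≤ A := by linarith
    change δ ≤ 200 * L
    linarith
  set F := ⌊K * Real.sqrt n⌋₊ with hF
  have hFle : (F : ℝ) ≤ K * w ^ 2 := by rw [← hsq]; exact Nat.floor_le (by positivity)
  have hfx : fixCount x ≤ F := Nat.le_floor (by simpa using hG.1)
  have hfy : fixCount y ≤ F := Nat.le_floor (by simpa using hG.2.1)
  have key := Pr_not_hasIsolated_le x y (Λ := Λ) (P := P) (M := 2 * Q + 1)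
    (F := F) (k := k) hρ hρ1 (fun p hp => by
      obtain ⟨h1, h2, h3⟩ := hΛ p hp
      exact ⟨h1, h2, by omega, by omega⟩) (by omega) (by rw [Fintype.card_fin]; omega) hk0
    (by rw [Fintype.card_fin]; omega) hfx hfy (N := n) (μ := μ) (H := 1 + L)
    (by rw [Fintype.card_fin]) rfl hμ0 hsum
  refine key.trans ?_
  have hd1 : 0 ≤ 640000 / δ ^ 2 := by positivity
  have hd2 : 0 ≤ 2560000 / δ ^ 2 := by positivity
  have hP0 : (0 : ℝ) < P := by exact_mod_cast hP1
  have hkhalf : (n : ℝ) / (2 * L ^ 5) ≤ k := by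
    have : (n : ℝ) / (2 * L ^ 5) = (n / L ^ 5) / 2 := by field_simp
    rw [this]; linarith
  obtain ⟨e1, e2, e3⟩ := error_terms_le (B := B) hδ hη hL1 hL hP0 hPA hnR
    hkhalf hk2 hAB (by rw [hB]; linarith)
    (by rw [hB]; linarith) (by rw [hB]; linarith)
  have hρdef : rho δ n = δ / (200 * L) := rfl
  rw [← hρdef] at e1 e2
  have e4 : (F + 2 * ((2 * Q + 1 : ℕ) : ℝ) * (F + (2 * Q + 1 : ℕ))) / n ≤ η / 8 := by
    have hM : ((2 * Q + 1 : ℕ) : ℝ) ≤ 3 * w := by push_cast; linarith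
    rw [div_le_iff₀ hnR, ← hw4]
    calc F + 2 * ((2 * Q + 1 : ℕ) : ℝ) * (F + (2 * Q + 1 : ℕ))
        ≤ K * w ^ 2 + 2 * (3 * w) * (K * w ^ 2 + 3 * w) := by gcongr
      _ ≤ (7 * K + 18) * w ^ 3 := by
          have h23 : w ^ 2 ≤ w ^ 3 := pow_le_pow_right₀ (by linarith) (by norm_num)
          nlinarith
      _ ≤ (η / 8 * A) * w ^ 3 := by gcongr; linarith
      _ ≤ (η / 8 * w) * w ^ 3 := by gcongr
      _ = _ := by ring
  linarith

/-- Two elements with few fixed points, one of which moves a positive proportion of the points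
in cycles of length at least three, generate a group containing the alternating group with
probability bounded below after a random conjugation. -/
theorem eventually_Pr_alternatingGroup_le_closure_ge {K δ : ℝ} (hK : 0 < K) (hδ : 0 < δ) :
    ∃ c > 0, ∀ᶠ n : ℕ in atTop, ∀ x y : Perm (Fin n), Good K δ x y →
      c ≤ Pr (fun h => alternatingGroup (Fin n) ≤ Subgroup.closure {x, h * y * h⁻¹}) := by
  obtain ⟨c, hc, hE⟩ := eventually_Pr_expands_ge hK hδ
  obtain ⟨ε, hε, hI⟩ := eventually_Pr_not_hasIsolated_le hK hδ (show 0 < c / 4 by positivity)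
  refine ⟨c / 2, by positivity, ?_⟩
  filter_upwards [hE, hI, eventually_Pr_labelled_le (K := K) hδ hε (show 0 < c / 4 by positivity),
    eventually_le_log 1] with n h1 h2 h3 hL x y hG
  obtain ⟨Λ, hΛ, h2⟩ := h2
  have hρ : 0 < rho δ n := by unfold rho; positivity
  have hsub : Pr (fun h => Expands (rho δ n) x (h * y * h⁻¹)) ≤
      Pr (fun h => (alternatingGroup (Fin n) ≤ Subgroup.closure {x, h * y * h⁻¹} ∨
        (Expands (rho δ n) x (h * y * h⁻¹) ∧ ¬ HasIsolated Λ (mix x y h))) ∨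
        ∃ r d : ℕ, 2 ≤ r ∧ (n : ℝ) ^ ε ≤ d ∧ r * d = n ∧ Labelled r d x (h * y * h⁻¹)) := by
    refine Pr_mono fun h hEx => ?_
    by_cases hI : HasIsolated Λ (mix x y h)
    · by_cases hLab : ∃ r d : ℕ, 2 ≤ r ∧ (n : ℝ) ^ ε ≤ d ∧ r * d = n ∧ Labelled r d x (h * y * h⁻¹)
      · exact Or.inr hLab
      obtain ⟨p, hp, a, ha, hgood⟩ := hI
      obtain ⟨hpp, hpε, hpn⟩ := hΛ p hp
      refine Or.inl (Or.inl (alternatingGroup_le_closure hρ hEx hpp ha hgood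
        (by rwa [Fintype.card_fin]) fun r d hr hpd hrd hLa => hLab ⟨r, d, hr, ?_, ?_, hLa⟩))
      · exact hpε.trans (by exact_mod_cast hpd)
      · rwa [Fintype.card_fin] at hrd
    · exact Or.inl (Or.inr ⟨hEx, hI⟩)
  have h4 := Pr_or_le (fun h => alternatingGroup (Fin n) ≤ Subgroup.closure {x, h * y * h⁻¹} ∨
        (Expands (rho δ n) x (h * y * h⁻¹) ∧ ¬ HasIsolated Λ (mix x y h)))
        (fun h => ∃ r d : ℕ, 2 ≤ r ∧ (n : ℝ) ^ ε ≤ d ∧ r * d = n ∧ Labelled r d x (h * y * h⁻¹))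
  have h5 := Pr_or_le (fun h => alternatingGroup (Fin n) ≤ Subgroup.closure {x, h * y * h⁻¹})
        (fun h => Expands (rho δ n) x (h * y * h⁻¹) ∧ ¬ HasIsolated Λ (mix x y h))
  have := h1 x y hG
  have := h2 x y hG
  have := h3 x y hG
  linarith

end FixedOrder

namespace FixedOrder
open Equiv Finset
open scoped Pointwise Nat

/-- The order of the centralizer of a permutation of cycle type `t`, up to the contribution of the
fixed points. -/
def typeWeight (t : Multiset ℕ) : ℕ := t.prod * ∏ n ∈ t.toFinset, (t.count n)!

lemma typeWeight_cons (q : ℕ) (t : Multiset ℕ) :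
    typeWeight (q ::ₘ t) = q * (t.count q + 1) * typeWeight t := by
  have h1 : ∏ n ∈ t.toFinset, (t.count n)! = ∏ n ∈ insert q t.toFinset, (t.count n)! := by
    refine prod_subset (subset_insert _ _) fun n _ hn => ?_
    rw [Multiset.count_eq_zero_of_notMem (by simpa using hn), Nat.factorial_zero]
  rw [typeWeight, typeWeight, h1, Multiset.toFinset_cons, Multiset.prod_cons,
    ← mul_prod_erase _ _ (mem_insert_self q t.toFinset),
    ← mul_prod_erase _ (fun n => (t.count n)!) (mem_insert_self q t.toFinset),
    Multiset.count_cons_self, Nat.factorial_succ]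
  rw [prod_congr rfl fun n hn => by
    rw [Multiset.count_cons_of_ne (ne_of_mem_erase hn)]]
  ring

lemma mul_count_le_sum (q : ℕ) (t : Multiset ℕ) : q * t.count q ≤ t.sum := by
  induction t using Multiset.induction with
  | empty => simp
  | cons a t ih =>
    rw [Multiset.sum_cons, Multiset.count_cons]
    split_ifs with h
    · subst h; rw [mul_add]; omega
    · rw [add_zero]; omega

lemma typeWeight_le_pow {t : Multiset ℕ} {n : ℕ} (h : t.sum ≤ n) : typeWeight t ≤ n ^ t.card := by
  induction t using Multiset.induction with
  | empty => simp [typeWeight]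
  | cons a t ih =>
    have h1 := mul_count_le_sum a (a ::ₘ t)
    rw [Multiset.count_cons_self] at h1
    rw [Multiset.sum_cons] at h h1
    rw [typeWeight_cons, Multiset.card_cons, pow_succ']
    exact Nat.mul_le_mul (h1.trans h) (ih (by omega))

lemma typeWeight_pos {t : Multiset ℕ} (h : ∀ a ∈ t, 2 ≤ a) : 0 < typeWeight t := by
  refine Nat.mul_pos (Multiset.prod_pos fun a ha => ?_) (prod_pos fun _ _ => Nat.factorial_pos _)
  have := h a ha; omega

lemma typeWeight_le_replicate (s : ℕ) (t : Multiset ℕ) :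
    typeWeight t ≤ typeWeight (Multiset.replicate s 2 + t) := by
  induction s with
  | zero => simp
  | succ s ih =>
    rw [Multiset.replicate_succ, Multiset.cons_add, typeWeight_cons]
    exact ih.trans (Nat.le_mul_of_pos_left _ (by positivity))

lemma mul_typeWeight_le_replicate {s : ℕ} (hs : 2 ≤ s) (t : Multiset ℕ) :
    4 * ((s + t.count 2) * (s + t.count 2 - 1)) * typeWeight t ≤
      typeWeight (Multiset.replicate s 2 + t) := by
  obtain ⟨r, rfl⟩ := Nat.exists_eq_add_of_le' hs
  rw [Multiset.replicate_add, show Multiset.replicate 2 2 = {2, 2} from rfl]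
  have h : Multiset.replicate r 2 + ({2, 2} : Multiset ℕ) + t =
      2 ::ₘ 2 ::ₘ (Multiset.replicate r 2 + t) := by
    rw [add_right_comm, add_comm, Multiset.insert_eq_cons, Multiset.cons_add,
      Multiset.singleton_add]
  rw [h, typeWeight_cons, typeWeight_cons, Multiset.count_cons_self, Multiset.count_add,
    Multiset.count_replicate_self]
  have h2 : r + 2 + t.count 2 - 1 = r + t.count 2 + 1 := by omega
  rw [h2]
  calc 4 * ((r + 2 + t.count 2) * (r + t.count 2 + 1)) * typeWeight t
      = 2 * (r + t.count 2 + 1 + 1) * (2 * (r + t.count 2 + 1) * typeWeight t) := by ring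
    _ ≤ _ := by gcongr; exact typeWeight_le_replicate r t

section
variable {α : Type*} [Fintype α] [DecidableEq α]

/-- The number of permutations of cycle type `t`. -/
def typeCount (α : Type*) [Fintype α] [DecidableEq α] (t : Multiset ℕ) : ℕ :=
  #{g : Perm α | g.cycleType = t}

lemma typeCount_mul {t : Multiset ℕ} (h1 : t.sum ≤ Fintype.card α) (h2 : ∀ a ∈ t, 2 ≤ a) :
    typeCount α t * ((Fintype.card α - t.sum)! * typeWeight t) = (Fintype.card α)! := by
  have := Perm.card_of_cycleType_mul_eq α t
  rw [if_pos ⟨h1, h2⟩, mul_assoc _ t.prod] at this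
  exact this

lemma typeCount_mul_le_cons {t : Multiset ℕ} {q f : ℕ} (hf : t.sum + f = Fintype.card α)
    (h2 : ∀ a ∈ t, 2 ≤ a) (hq : 2 ≤ q) (hqf : q ≤ f) :
    typeCount α t * (f * (f - 1)) ≤ typeCount α (q ::ₘ t) * Fintype.card α := by
  have e1 := typeCount_mul (α := α) (t := t) (by omega) h2
  have e2 := typeCount_mul (α := α) (t := q ::ₘ t) (by rw [Multiset.sum_cons]; omega)
    (by simpa using ⟨hq, h2⟩)
  rw [Multiset.sum_cons, show Fintype.card α - (q + t.sum) = f - q by omega, typeWeight_cons] at e2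
  rw [show Fintype.card α - t.sum = f by omega] at e1
  have hc : q * (t.count q + 1) ≤ Fintype.card α := by
    have := mul_count_le_sum q (q ::ₘ t)
    rw [Multiset.count_cons_self, Multiset.sum_cons] at this
    omega
  have hfac : (f - q)! * (f * (f - 1)) ≤ f ! := by
    obtain ⟨e, rfl⟩ := Nat.exists_eq_add_of_le' (hq.trans hqf)
    rw [show e + 2 - 1 = e + 1 by omega, Nat.factorial_succ, Nat.factorial_succ]
    calc (e + 2 - q)! * ((e + 2) * (e + 1)) ≤ e ! * ((e + 2) * (e + 1)) := by
          gcongr; omega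
      _ = _ := by ring
  have hW := typeWeight_pos h2
  refine Nat.le_of_mul_le_mul_right (c := (f - q)! * typeWeight t) ?_ (by positivity)
  calc typeCount α t * (f * (f - 1)) * ((f - q)! * typeWeight t)
      = typeCount α t * (((f - q)! * (f * (f - 1))) * typeWeight t) := by ring
    _ ≤ typeCount α t * (f ! * typeWeight t) := by gcongr
    _ = typeCount α (q ::ₘ t) * ((f - q)! * (q * (t.count q + 1) * typeWeight t)) := by
        rw [e1, e2]
    _ = typeCount α (q ::ₘ t) * (q * (t.count q + 1)) * ((f - q)! * typeWeight t) := by ring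
    _ ≤ _ := by gcongr

lemma typeCount_replicate_mul_le {t : Multiset ℕ} {s : ℕ} (hs : 2 ≤ s)
    (ht : 2 * s + t.sum ≤ Fintype.card α) (h2 : ∀ a ∈ t, 2 ≤ a) :
    typeCount α (Multiset.replicate s 2 + t) * (4 * ((s + t.count 2) * (s + t.count 2 - 1))) ≤
      typeCount α ((2 * s) ::ₘ t) * Fintype.card α := by
  have hsum : (Multiset.replicate s 2 + t).sum = 2 * s + t.sum := by
    rw [Multiset.sum_add, Multiset.sum_replicate, smul_eq_mul, mul_comm]
  have e1 := typeCount_mul (α := α) (t := Multiset.replicate s 2 + t) (by omega) (by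
    intro a ha
    rcases Multiset.mem_add.1 ha with h | h
    · exact (Multiset.eq_of_mem_replicate h).ge
    · exact h2 a h)
  have e2 := typeCount_mul (α := α) (t := (2 * s) ::ₘ t) (by rw [Multiset.sum_cons]; omega)
    (by intro a ha
        rcases Multiset.mem_cons.1 ha with h | h
        · omega
        · exact h2 a h)
  rw [Multiset.sum_cons, typeWeight_cons] at e2
  rw [hsum] at e1
  have hc : 2 * s * (t.count (2 * s) + 1) ≤ Fintype.card α := by
    have := mul_count_le_sum (2 * s) ((2 * s) ::ₘ t)
    rw [Multiset.count_cons_self, Multiset.sum_cons] at this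
    omega
  have hW := typeWeight_pos h2
  refine Nat.le_of_mul_le_mul_right
    (c := (Fintype.card α - (2 * s + t.sum))! * typeWeight t) ?_ (by positivity)
  have hm := mul_typeWeight_le_replicate hs t
  generalize 4 * ((s + t.count 2) * (s + t.count 2 - 1)) = A at *
  calc typeCount α (Multiset.replicate s 2 + t) * A *
        ((Fintype.card α - (2 * s + t.sum))! * typeWeight t)
      = typeCount α (Multiset.replicate s 2 + t) *
        ((Fintype.card α - (2 * s + t.sum))! * (A * typeWeight t)) := by ring
    _ ≤ typeCount α (Multiset.replicate s 2 + t) *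
        ((Fintype.card α - (2 * s + t.sum))! * typeWeight (Multiset.replicate s 2 + t)) := by
        gcongr
    _ = typeCount α ((2 * s) ::ₘ t) * ((Fintype.card α - (2 * s + t.sum))! *
        (2 * s * (t.count (2 * s) + 1) * typeWeight t)) := by rw [e1, e2]
    _ = typeCount α ((2 * s) ::ₘ t) * (2 * s * (t.count (2 * s) + 1)) *
        ((Fintype.card α - (2 * s + t.sum))! * typeWeight t) := by ring
    _ ≤ _ := by gcongr

/-- An injective map between cycle types transfers a bound on class sizes to sets of
permutations. -/
lemma card_mul_le_of_cycleType (A B : Finset (Perm α)) (ψ : Multiset ℕ → Multiset ℕ) {a b : ℕ}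
    (hinj : ∀ σ ∈ A, ∀ τ ∈ A, ψ σ.cycleType = ψ τ.cycleType → σ.cycleType = τ.cycleType)
    (hcount : ∀ σ ∈ A, typeCount α σ.cycleType * a ≤ typeCount α (ψ σ.cycleType) * b)
    (hB : ∀ σ ∈ A, ∀ τ : Perm α, τ.cycleType = ψ σ.cycleType → τ ∈ B) :
    #A * a ≤ #B * b := by
  set T := A.image Perm.cycleType with hT
  have h1 : #A ≤ ∑ t ∈ T, typeCount α t := by
    refine (card_le_card (t := T.biUnion fun t => ({g : Perm α | g.cycleType = t} : Finset _))
      fun σ hσ => ?_).trans card_biUnion_le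
    exact mem_biUnion.2 ⟨_, mem_image_of_mem _ hσ, by simp⟩
  have h2 : ∑ t ∈ T, typeCount α (ψ t) ≤ #B := by
    have hd : #(T.biUnion fun t => ({g : Perm α | g.cycleType = ψ t} : Finset _)) =
        ∑ t ∈ T, typeCount α (ψ t) := by
      refine card_biUnion fun t ht t' ht' hne => ?_
      obtain ⟨σ, hσ, rfl⟩ := mem_image.1 ht
      obtain ⟨τ, hτ, rfl⟩ := mem_image.1 ht'
      refine disjoint_left.2 fun g hg hg' => hne (hinj σ hσ τ hτ ?_)
      rw [← (mem_filter.1 hg).2, ← (mem_filter.1 hg').2]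
    rw [← hd]
    refine card_le_card fun τ hτ => ?_
    obtain ⟨t, ht, hτ⟩ := mem_biUnion.1 hτ
    obtain ⟨σ, hσ, rfl⟩ := mem_image.1 ht
    exact hB σ hσ τ (mem_filter.1 hτ).2
  calc #A * a ≤ (∑ t ∈ T, typeCount α t) * a := by gcongr
    _ = ∑ t ∈ T, typeCount α t * a := sum_mul _ _ _
    _ ≤ ∑ t ∈ T, typeCount α (ψ t) * b := by
        refine sum_le_sum fun t ht => ?_
        obtain ⟨σ, hσ, rfl⟩ := mem_image.1 ht
        exact hcount σ hσ
    _ = (∑ t ∈ T, typeCount α (ψ t)) * b := (sum_mul _ _ _).symm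
    _ ≤ #B * b := by gcongr

end
end FixedOrder

namespace FixedOrder
open Equiv Finset
open scoped Pointwise Nat

section
variable {α : Type*} [Fintype α] [DecidableEq α]

lemma sum_cycleType_add_fixCount (σ : Perm α) :
    σ.cycleType.sum + fixCount σ = Fintype.card α := by
  rw [Perm.sum_cycleType, Perm.support, fixCount, add_comm]
  exact card_filter_add_card_filter_not _

/-- The permutations of order `m`. -/
noncomputable def ofOrder (α : Type*) [Fintype α] [DecidableEq α] (m : ℕ) : Finset (Perm α) :=
  {σ | orderOf σ = m}

lemma mem_ofOrder {m : ℕ} {σ : Perm α} : σ ∈ ofOrder α m ↔ orderOf σ = m := by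
  simp [ofOrder]

lemma two_le_of_mem {σ : Perm α} : ∀ a ∈ σ.cycleType, 2 ≤ a :=
  fun _ h => Perm.two_le_of_mem_cycleType h

lemma card_many_fixed_le {m q j : ℕ} (hq : 2 ≤ q) (hqm : q ∣ m) (hqj : q ≤ j) :
    #{σ ∈ ofOrder α m | j ≤ fixCount σ} * (j * (j - 1)) ≤
      #(ofOrder α m) * Fintype.card α := by
  refine card_mul_le_of_cycleType _ _ (fun t => q ::ₘ t)
    (fun σ _ τ _ h => (Multiset.cons_inj_right q).1 h) (fun σ hσ => ?_) (fun σ hσ τ hτ => ?_)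
  · obtain ⟨-, h⟩ := mem_filter.1 hσ
    refine le_trans ?_ (typeCount_mul_le_cons (sum_cycleType_add_fixCount σ) two_le_of_mem hq
      (hqj.trans h))
    gcongr
  · obtain ⟨h, -⟩ := mem_filter.1 hσ
    rw [mem_ofOrder] at h ⊢
    rw [← Perm.lcm_cycleType, hτ, Multiset.lcm_cons, Perm.lcm_cycleType, h, lcm_eq_nat_lcm]
    exact Nat.lcm_eq_right hqm

lemma card_many_two_le {m s j : ℕ} (hs : 2 ≤ s) (hsm : 2 * s ∣ m) (hsj : s ≤ j) :
    #{σ ∈ ofOrder α m | j ≤ σ.cycleType.count 2} * (4 * (j * (j - 1))) ≤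
      #(ofOrder α m) * Fintype.card α := by
  have hrep : ∀ {σ : Perm α}, σ ∈ ({σ ∈ ofOrder α m | j ≤ σ.cycleType.count 2} : Finset _) →
      ∃ t, σ.cycleType = Multiset.replicate s 2 + t ∧
        σ.cycleType - Multiset.replicate s 2 = t := by
    intro σ hσ
    obtain ⟨-, h⟩ := mem_filter.1 hσ
    obtain ⟨t, ht⟩ := Multiset.le_iff_exists_add.1
      (Multiset.le_count_iff_replicate_le.1 (hsj.trans h))
    exact ⟨t, ht, by rw [ht, add_tsub_cancel_left]⟩
  refine card_mul_le_of_cycleType _ _ (fun t => (2 * s) ::ₘ (t - Multiset.replicate s 2))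
    (fun σ hσ τ hτ h => ?_) (fun σ hσ => ?_) (fun σ hσ τ hτ => ?_)
  · obtain ⟨t, h1, h2⟩ := hrep hσ
    obtain ⟨t', h1', h2'⟩ := hrep hτ
    simp only [h2, h2', Multiset.cons_inj_right] at h
    rw [h1, h1', h]
  · obtain ⟨t, h1, h2⟩ := hrep hσ
    obtain ⟨-, h⟩ := mem_filter.1 hσ
    have h3 := sum_cycleType_add_fixCount σ
    rw [h2]
    rw [h1] at h h3 ⊢
    rw [Multiset.count_add, Multiset.count_replicate_self] at h
    rw [Multiset.sum_add, Multiset.sum_replicate, smul_eq_mul] at h3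
    refine le_trans ?_ (typeCount_replicate_mul_le hs (by omega) fun a ha =>
      two_le_of_mem (σ := σ) a (by rw [h1]; exact Multiset.mem_add.2 (Or.inr ha)))
    gcongr
  · obtain ⟨t, h1, h2⟩ := hrep hσ
    obtain ⟨h, -⟩ := mem_filter.1 hσ
    simp only [h2] at hτ
    rw [mem_ofOrder] at h ⊢
    rw [← Perm.lcm_cycleType] at h ⊢
    rw [hτ, Multiset.lcm_cons]
    rw [h1, Multiset.lcm_add] at h
    have hr : (Multiset.replicate s 2).lcm = 2 := by
      refine Nat.dvd_antisymm (Multiset.lcm_dvd.2 fun b hb => ?_) (Multiset.dvd_lcm ?_)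
      · rw [Multiset.eq_of_mem_replicate hb]
      · exact Multiset.mem_replicate.2 ⟨by omega, rfl⟩
    rw [hr] at h
    refine Nat.dvd_antisymm (lcm_dvd hsm ?_) ?_
    · rw [← h]; exact dvd_lcm_right _ _
    · rw [← h]; exact lcm_dvd ((Dvd.intro _ rfl).trans (dvd_lcm_left _ _)) (dvd_lcm_right _ _)

lemma card_perm_fixing (S : Finset α) :
    #{σ : Perm α | ∀ a ∈ S, σ a = a} = (Fintype.card α - #S)! := by
  classical
  have e := (Perm.subtypeEquivSubtypePerm (fun a => a ∉ S))
  have h := Fintype.card_congr e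
  rw [Fintype.card_perm, Fintype.card_subtype_compl, Fintype.card_coe] at h
  rw [h, Fintype.card_subtype]
  simp

lemma card_many_fixed_mul_le (j : ℕ) :
    #{σ : Perm α | j ≤ fixCount σ} * j ! ≤ (Fintype.card α)! := by
  rcases lt_or_ge (Fintype.card α) j with hj | hj
  · rw [filter_false_of_mem]
    · simp
    · intro σ _ h
      have := sum_cycleType_add_fixCount σ
      omega
  have h1 : #{σ : Perm α | j ≤ fixCount σ} ≤
      ∑ S ∈ powersetCard j (univ : Finset α), #{σ : Perm α | ∀ a ∈ S, σ a = a} := by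
    refine (card_le_card (t := (powersetCard j (univ : Finset α)).biUnion fun S =>
      ({σ : Perm α | ∀ a ∈ S, σ a = a} : Finset _)) fun σ hσ => ?_).trans card_biUnion_le
    obtain ⟨S, hS, hSj⟩ := exists_subset_card_eq (mem_filter.1 hσ).2
    exact mem_biUnion.2 ⟨S, mem_powersetCard.2 ⟨subset_univ _, hSj⟩,
      mem_filter.2 ⟨mem_univ _, fun a ha => (mem_filter.1 (hS ha)).2⟩⟩
  have h2 : ∑ S ∈ powersetCard j (univ : Finset α), #{σ : Perm α | ∀ a ∈ S, σ a = a} =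
      (Fintype.card α).choose j * (Fintype.card α - j)! := by
    rw [sum_congr rfl fun S hS => by rw [card_perm_fixing, (mem_powersetCard.1 hS).2], sum_const,
      card_powersetCard, card_univ, smul_eq_mul]
  rw [h2] at h1
  calc _ ≤ (Fintype.card α).choose j * (Fintype.card α - j)! * j ! := by gcongr
    _ = (Fintype.card α).choose j * j ! * (Fintype.card α - j)! := by ring
    _ = _ := Nat.choose_mul_factorial_mul_factorial hj

lemma card_per_eq_two_le (σ : Perm α) : #{i | per σ i = 2} ≤ 2 * σ.cycleType.count 2 := by
  classical
  have h1 : ({i | per σ i = 2} : Finset α) ⊆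
      ({c ∈ σ.cycleFactorsFinset | #c.support = 2} : Finset _).biUnion Perm.support := by
    intro i hi
    have hi := (mem_filter.1 hi).2
    have hmem : i ∈ σ.support := by
      rw [Perm.mem_support]
      intro h
      rw [← per_eq_one_iff] at h
      omega
    have hsupp : (σ.cycleOf i).support = cyc σ i := by
      ext b
      rw [Perm.mem_support_cycleOf_iff' (Perm.mem_support.1 hmem)]
      simp [cyc]
    refine mem_biUnion.2 ⟨σ.cycleOf i, mem_filter.2
      ⟨Perm.cycleOf_mem_cycleFactorsFinset_iff.2 hmem, ?_⟩, ?_⟩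
    · rw [hsupp, card_cyc, hi]
    · rw [hsupp]; exact self_mem_cyc _ _
  have h2 : σ.cycleType.count 2 = #{c ∈ σ.cycleFactorsFinset | #c.support = 2} := by
    rw [Perm.cycleType_def, Multiset.count_map]
    simp only [Function.comp, eq_comm (a := 2)]
    rfl
  calc _ ≤ _ := card_le_card h1
    _ ≤ ∑ c ∈ ({c ∈ σ.cycleFactorsFinset | #c.support = 2} : Finset _), #c.support :=
        card_biUnion_le
    _ = _ := by
        rw [sum_congr rfl fun c hc => (mem_filter.1 hc).2, sum_const, smul_eq_mul, h2, mul_comm]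

lemma card_le_fix_add_two_add_long (σ : Perm α) :
    Fintype.card α ≤ fixCount σ + 2 * σ.cycleType.count 2 + longCount σ := by
  have h := card_per_eq_two_le σ
  have hu : (univ : Finset α) ⊆
      (({i | σ i = i} : Finset α) ∪ ({i | per σ i = 2} : Finset α)) ∪ ({i | 3 ≤ per σ i} : Finset α) := by
    intro i _
    simp only [mem_union, mem_filter, mem_univ, true_and]
    have := per_pos σ i
    rw [← per_eq_one_iff]
    omega
  have := card_le_card hu
  have h1 := card_union_le (({i | σ i = i} : Finset α) ∪ ({i | per σ i = 2} : Finset α)) {i | 3 ≤ per σ i}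
  have h2 := card_union_le ({i | σ i = i} : Finset α) {i | per σ i = 2}
  rw [card_univ] at this
  unfold fixCount longCount
  omega

lemma exists_dvd_per {σ : Perm α} {p : ℕ} (hp : p.Prime) (h : p ∣ orderOf σ) :
    ∃ i, p ∣ per σ i := by
  by_contra! hno
  obtain ⟨r, hr⟩ := h
  have hpos := orderOf_pos σ
  have h1 : σ ^ r = 1 := by
    ext i
    have h2 : per σ i ∣ p * r := by
      rw [← hr, ← pow_apply_eq_self_iff, pow_orderOf_eq_one]; rfl
    have h3 : (σ ^ r) i = i := pow_apply_eq_self_iff.2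
      (((Nat.Prime.coprime_iff_not_dvd hp).2 (hno i)).symm.dvd_of_dvd_mul_left h2)
    rw [h3]; rfl
  have h4 := Nat.le_of_dvd (by rcases Nat.eq_zero_or_pos r with h | h
                               · rw [h] at hr; omega
                               · exact h) (orderOf_dvd_of_pow_eq_one h1)
  have := hp.two_le
  nlinarith

lemma le_longCount_of_dvd {σ : Perm α} {p : ℕ} (hp : p.Prime) (hp3 : 3 ≤ p) (h : p ∣ orderOf σ) :
    p ≤ longCount σ := by
  obtain ⟨i, hi⟩ := exists_dvd_per hp h
  have h1 := Nat.le_of_dvd (per_pos σ i) hi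
  refine h1.trans ?_
  rw [← card_cyc, longCount]
  refine card_le_card fun b hb => mem_filter.2 ⟨mem_univ _, ?_⟩
  rw [per_eq_of_mem hb]
  omega

lemma longCount_of_odd {σ : Perm α} (h : Odd (orderOf σ)) :
    Fintype.card α ≤ fixCount σ + longCount σ := by
  have h1 := card_le_fix_add_two_add_long σ
  have h2 : σ.cycleType.count 2 = 0 := by
    rw [Multiset.count_eq_zero]
    intro h2
    have := Perm.dvd_of_mem_cycleType h2
    exact (Nat.not_even_iff_odd.2 h) (even_iff_two_dvd.2 this)
  omega

end
end FixedOrder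

namespace FixedOrder
open Equiv Finset
open scoped Pointwise Nat

lemma eight_mul_card_le_of_sq_le {n m q : ℕ} {K : ℝ} (hn : 0 < n) (hK : 6 ≤ K) (hq : 2 ≤ q)
    (hqm : q ∣ m) (hqn : q * q ≤ n) :
    8 * #{σ ∈ ofOrder (Fin n) m | K * √n < fixCount σ} ≤ #(ofOrder (Fin n) m) := by
  have hs1 : (1 : ℝ) ≤ √n := Real.one_le_sqrt.2 (by exact_mod_cast hn)
  have hsq : √(n : ℝ) * √n = n := Real.mul_self_sqrt (Nat.cast_nonneg _)
  have hj := Nat.le_ceil (K * √(n : ℝ))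
  have hj6 : 6 * √(n : ℝ) ≤ ⌈K * √(n : ℝ)⌉₊ := le_trans (by gcongr) hj
  have hqj : q ≤ ⌈K * √(n : ℝ)⌉₊ := by
    have : (q : ℝ) ≤ √n := Real.le_sqrt_of_sq_le (by rw [sq]; exact_mod_cast hqn)
    have : (q : ℝ) ≤ ⌈K * √(n : ℝ)⌉₊ := by linarith
    exact_mod_cast this
  have h := card_many_fixed_le (α := Fin n) hq hqm hqj
  have hsub : #{σ ∈ ofOrder (Fin n) m | K * √n < fixCount σ} ≤
      #{σ ∈ ofOrder (Fin n) m | ⌈K * √(n : ℝ)⌉₊ ≤ fixCount σ} :=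
    card_le_card (monotone_filter_right _ fun σ _ h => Nat.ceil_le.2 h.le)
  rw [Fintype.card_fin] at h
  generalize ⌈K * √(n : ℝ)⌉₊ = j at *
  have hj8 : 8 * n ≤ j * (j - 1) := by
    have hj1 : 1 ≤ j := by omega
    zify [hj1]
    have : (8 * n : ℝ) ≤ j * (j - 1) := by nlinarith
    exact_mod_cast this
  refine (Nat.mul_le_mul_left 8 hsub).trans (Nat.le_of_mul_le_mul_right (c := n) ?_ hn)
  calc _ = #{σ ∈ ofOrder (Fin n) m | j ≤ fixCount σ} * (8 * n) := by ring
    _ ≤ _ := by gcongr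
    _ ≤ _ := h

lemma eight_mul_card_le_of_lt_sq {n m q : ℕ} {K : ℝ} (hn : 4 ≤ n) (hK : 0 < K)
    (hqm : ∀ a, a ∣ m → a ≠ 1 → q ≤ a) (hqn : n < q * q) {σ₀ : Perm (Fin n)}
    (hσ₀ : orderOf σ₀ = m) (hf : fixCount σ₀ ≤ K * √n) :
    8 * #{σ ∈ ofOrder (Fin n) m | (4 * (K + 1) + 2) * √n < fixCount σ} ≤
      #(ofOrder (Fin n) m) := by
  have hs2 : (2 : ℝ) ≤ √n := Real.le_sqrt_of_sq_le (by norm_num; exact_mod_cast hn)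
  have hsq : √(n : ℝ) * √n = n := Real.mul_self_sqrt (Nat.cast_nonneg _)
  have hsum := sum_cycleType_add_fixCount σ₀
  rw [Fintype.card_fin] at hsum
  set k := σ₀.cycleType.card with hk
  set f := fixCount σ₀
  have hkq : k * q ≤ n := by
    have : k • q ≤ σ₀.cycleType.sum := Multiset.card_nsmul_le_sum fun a ha => by
      have := two_le_of_mem a ha
      exact hqm a (hσ₀ ▸ Perm.dvd_of_mem_cycleType ha) (by omega)
    rw [smul_eq_mul] at this
    omega
  have hkk : k * k ≤ n := by
    have : k ≤ q := by by_contra! h; nlinarith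
    nlinarith
  have hks : (k : ℝ) ≤ √n := Real.le_sqrt_of_sq_le (by rw [sq]; exact_mod_cast hkk)
  have hi := Nat.le_ceil (2 * (K + 1) * √(n : ℝ))
  have hi' := Nat.ceil_lt_add_one (show 0 ≤ 2 * (K + 1) * √(n : ℝ) by positivity)
  have hsub : #{σ ∈ ofOrder (Fin n) m | (4 * (K + 1) + 2) * √n < fixCount σ} ≤
      #{σ : Perm (Fin n) | 2 * ⌈2 * (K + 1) * √(n : ℝ)⌉₊ ≤ fixCount σ} := by
    refine card_le_card fun σ hσ => mem_filter.2 ⟨mem_univ _, ?_⟩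
    have h := (mem_filter.1 hσ).2
    have : (2 * ⌈2 * (K + 1) * √(n : ℝ)⌉₊ : ℝ) ≤ fixCount σ := by nlinarith
    exact_mod_cast this
  generalize ⌈2 * (K + 1) * √(n : ℝ)⌉₊ = i at *
  have hfk : 2 * (f + k) ≤ i := by
    have : (2 * (f + k) : ℝ) ≤ i := by nlinarith
    exact_mod_cast this
  have hni : n ≤ i ^ 2 := by
    have : (n : ℝ) ≤ i ^ 2 := by
      have : √(n : ℝ) ≤ i := by nlinarith
      nlinarith
    exact_mod_cast this
  have hi4 : 4 ≤ i := by
    have : (4 : ℝ) ≤ i := by nlinarith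
    exact_mod_cast this
  have hW : f ! * typeWeight σ₀.cycleType ≤ i ^ i := by
    calc f ! * typeWeight σ₀.cycleType ≤ n ^ f * n ^ k := by
          refine Nat.mul_le_mul ((Nat.factorial_le_pow f).trans (Nat.pow_le_pow_left (by omega) f))
            (typeWeight_le_pow (by omega))
      _ = n ^ (f + k) := (pow_add _ _ _).symm
      _ ≤ (i ^ 2) ^ (f + k) := Nat.pow_le_pow_left hni _
      _ = i ^ (2 * (f + k)) := (pow_mul _ _ _).symm
      _ ≤ i ^ i := Nat.pow_le_pow_right (by omega) hfk
  have hcl := typeCount_mul (α := Fin n) (t := σ₀.cycleType) (by rw [Fintype.card_fin]; omega)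
    two_le_of_mem
  rw [Fintype.card_fin, show n - σ₀.cycleType.sum = f by omega] at hcl
  have hT : typeCount (Fin n) σ₀.cycleType ≤ #(ofOrder (Fin n) m) := by
    refine card_le_card fun τ hτ => mem_ofOrder.2 ?_
    rw [← Perm.lcm_cycleType, (mem_filter.1 hτ).2, Perm.lcm_cycleType, hσ₀]
  have hmany := card_many_fixed_mul_le (α := Fin n) (2 * i)
  rw [Fintype.card_fin] at hmany
  have h8 : 8 * i ^ i ≤ (2 * i)! := by
    have h1 : i ! * i ^ (2 * i - i) ≤ (2 * i)! :=
      Nat.factorial_mul_pow_sub_le_factorial (by omega)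
    rw [show 2 * i - i = i by omega] at h1
    have h2 : 8 ≤ i ! := le_trans (by decide) (Nat.factorial_le hi4)
    exact le_trans (by gcongr) h1
  refine (Nat.mul_le_mul_left 8 hsub).trans
    (Nat.le_of_mul_le_mul_right (c := i ^ i) ?_ (by positivity))
  calc _ = #{σ : Perm (Fin n) | 2 * i ≤ fixCount σ} * (8 * i ^ i) := by ring
    _ ≤ #{σ : Perm (Fin n) | 2 * i ≤ fixCount σ} * (2 * i)! := by gcongr
    _ ≤ n ! := hmany
    _ = typeCount (Fin n) σ₀.cycleType * (f ! * typeWeight σ₀.cycleType) := hcl.symm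
    _ ≤ _ := by gcongr

lemma eight_mul_card_short_le {n m : ℕ} {K : ℝ} (hn : 100 ≤ n) (hKn : K * √n ≤ n / 12)
    (hm : Even m) (hm2 : m ≠ 2) :
    8 * #{σ ∈ ofOrder (Fin n) m | fixCount σ ≤ K * √n ∧ (longCount σ : ℝ) < 1 / 12 * n} ≤
      #(ofOrder (Fin n) m) := by
  obtain ⟨r, hr⟩ := hm
  have hp : (Nat.minFac r).Prime := Nat.minFac_prime (by omega)
  have hpr := Nat.minFac_dvd r
  set p := Nat.minFac r
  have hpm : 2 * p ∣ m := by
    rw [hr, ← two_mul]; exact Nat.mul_dvd_mul_left 2 hpr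
  have hpm' : p ∣ m := (Dvd.intro_left _ rfl).trans hpm
  have hnR : (100 : ℝ) ≤ n := by exact_mod_cast hn
  have hj := Nat.le_ceil ((n : ℝ) / 3)
  have hj' := Nat.ceil_lt_add_one (show 0 ≤ (n : ℝ) / 3 by positivity)
  generalize ⌈(n : ℝ) / 3⌉₊ = j at *
  have hj3 : 3 ≤ j := by
    have : (3 : ℝ) ≤ j := by linarith
    exact_mod_cast this
  rcases le_or_gt p j with hpj | hpj
  · have h := card_many_two_le (α := Fin n) hp.two_le hpm hpj
    rw [Fintype.card_fin] at h
    have hsub : #{σ ∈ ofOrder (Fin n) m | fixCount σ ≤ K * √n ∧ (longCount σ : ℝ) < 1 / 12 * n} ≤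
        #{σ ∈ ofOrder (Fin n) m | j ≤ σ.cycleType.count 2} := by
      refine card_le_card (monotone_filter_right _ fun σ _ h => ?_)
      have h1 := card_le_fix_add_two_add_long σ
      rw [Fintype.card_fin] at h1
      have h2 : (n : ℝ) ≤ fixCount σ + 2 * σ.cycleType.count 2 + longCount σ := by
        exact_mod_cast h1
      have : (j : ℝ) ≤ σ.cycleType.count 2 := by linarith [h.1, h.2]
      exact_mod_cast this
    have hj8 : 8 * n ≤ 4 * (j * (j - 1)) := by
      zify [show 1 ≤ j by omega]
      have : (8 * n : ℝ) ≤ 4 * (j * (j - 1)) := by nlinarith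
      exact_mod_cast this
    refine (Nat.mul_le_mul_left 8 hsub).trans
      (Nat.le_of_mul_le_mul_right (c := n) ?_ (by omega))
    calc _ = #{σ ∈ ofOrder (Fin n) m | j ≤ σ.cycleType.count 2} * (8 * n) := by ring
      _ ≤ _ := by gcongr
      _ ≤ _ := h
  · rw [filter_false_of_mem]
    · simp
    · rintro σ hσ ⟨-, h2⟩
      have h1 := le_longCount_of_dvd (σ := σ) hp (by omega) (by rwa [mem_ofOrder.1 hσ])
      have h3 : (j : ℝ) ≤ longCount σ := by exact_mod_cast hpj.le.trans h1
      linarith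

/-- At least half of the elements of order `m` have few fixed points and many points in cycles of
length at least three. -/
theorem eventually_card_ofOrder_le {K : ℝ} (hK : 0 < K) : ∃ K' > 0, ∀ᶠ n : ℕ in atTop, ∀ m : ℕ,
    0 < m → (Odd m ∧ ∃ σ : Perm (Fin n), orderOf σ = m ∧ fixCount σ ≤ K * √n) ∨
      (Even m ∧ m ≠ 2) →
    #(ofOrder (Fin n) m) ≤ 2 * #{σ ∈ ofOrder (Fin n) m |
      fixCount σ ≤ K' * √n ∧ 1 / 12 * n ≤ (longCount σ : ℝ)} := by
  refine ⟨4 * (K + 1) + 2, by positivity, ?_⟩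
  set K' := 4 * (K + 1) + 2 with hK'
  have hlim : ∀ᶠ n : ℕ in atTop, 12 * K' ≤ √(n : ℝ) :=
    (Real.tendsto_sqrt_atTop.comp
      (tendsto_natCast_atTop_atTop (R := ℝ))).eventually_ge_atTop _
  filter_upwards [hlim, eventually_ge_atTop 100] with n hn hn100 m hm0 hm
  have hsq : √(n : ℝ) * √n = n := Real.mul_self_sqrt (Nat.cast_nonneg _)
  have hs0 : 0 < √(n : ℝ) := by linarith
  have hnR : (100 : ℝ) ≤ n := by exact_mod_cast hn100
  have hK'n : K' * √n ≤ n / 12 := by nlinarith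
  set G := #{σ ∈ ofOrder (Fin n) m | fixCount σ ≤ K' * √n ∧ 1 / 12 * n ≤ (longCount σ : ℝ)}
    with hG
  have hsplit : #(ofOrder (Fin n) m) ≤ G +
      #{σ ∈ ofOrder (Fin n) m | K' * √n < fixCount σ} +
      #{σ ∈ ofOrder (Fin n) m | fixCount σ ≤ K' * √n ∧ (longCount σ : ℝ) < 1 / 12 * n} := by
    rw [hG]
    refine le_trans (card_le_card fun σ hσ => ?_) ((card_union_le _ _).trans
      (Nat.add_le_add_right (card_union_le _ _) _))
    simp only [mem_union, mem_filter, hσ, true_and]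
    rcases lt_or_ge (K' * √(n : ℝ)) (fixCount σ) with h1 | h1
    · exact Or.inl (Or.inr h1)
    · rcases lt_or_ge (longCount σ : ℝ) (1 / 12 * n) with h2 | h2
      · exact Or.inr ⟨h1, h2⟩
      · exact Or.inl (Or.inl ⟨h1, h2⟩)
  rcases hm with ⟨hodd, σ₀, hσ₀, hf⟩ | ⟨heven, hm2⟩
  · have hm1 : m ≠ 1 := by
      rintro rfl
      rw [orderOf_eq_one_iff] at hσ₀
      have : fixCount σ₀ = n := by simp [fixCount, hσ₀]
      rw [this] at hf
      nlinarith
    have hB1 : 8 * #{σ ∈ ofOrder (Fin n) m | K' * √n < fixCount σ} ≤ #(ofOrder (Fin n) m) := by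
      rcases le_or_gt (m.minFac * m.minFac) n with h | h
      · exact eight_mul_card_le_of_sq_le (by omega) (by linarith) (Nat.minFac_prime hm1).two_le
          (Nat.minFac_dvd m) h
      · refine eight_mul_card_le_of_lt_sq (q := m.minFac) (by omega) hK (fun a ha ha1 => ?_) h hσ₀ hf
        refine Nat.minFac_le_of_dvd ?_ ha
        have := Nat.pos_of_dvd_of_pos ha hm0
        omega
    have hB2 : #{σ ∈ ofOrder (Fin n) m | fixCount σ ≤ K' * √n ∧
        (longCount σ : ℝ) < 1 / 12 * n} = 0 := by
      rw [card_eq_zero, filter_false_of_mem]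
      rintro σ hσ ⟨h1, h2⟩
      have h3 := longCount_of_odd (σ := σ) (by rwa [mem_ofOrder.1 hσ])
      rw [Fintype.card_fin] at h3
      have h4 : (n : ℝ) ≤ fixCount σ + longCount σ := by exact_mod_cast h3
      linarith
    omega
  · have hB1 : 8 * #{σ ∈ ofOrder (Fin n) m | K' * √n < fixCount σ} ≤ #(ofOrder (Fin n) m) :=
      eight_mul_card_le_of_sq_le (by omega) (by linarith) le_rfl (even_iff_two_dvd.1 heven)
        (by omega)
    have hB2 := eight_mul_card_short_le hn100 hK'n heven hm2
    omega

end FixedOrder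

namespace FixedOrder
open Equiv Finset
open scoped Pointwise

lemma fixedPointCount_eq {n : ℕ} (σ : Perm (Fin n)) : fixedPointCount σ = fixCount σ := by
  rw [fixedPointCount, Nat.card_eq_card_toFinset, fixCount]
  congr 1
  ext i
  simp [Function.IsFixedPt]

open Classical in
/-- The pairs of elements of order `m` generating at least the alternating group. -/
noncomputable def genPairs (n m : ℕ) : Finset (Perm (Fin n) × Perm (Fin n)) :=
  {p ∈ ofOrder (Fin n) m ×ˢ ofOrder (Fin n) m |
    alternatingGroup (Fin n) ≤ Subgroup.closure {p.1, p.2}}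

lemma ordProb_eq (n m : ℕ) :
    ordProb n m = (#(genPairs n m) : ℝ) / (#(ofOrder (Fin n) m) : ℝ) ^ 2 := by
  have h1 : Nat.card {p : Perm (Fin n) × Perm (Fin n) // orderOf p.1 = m ∧ orderOf p.2 = m ∧
      alternatingGroup (Fin n) ≤ Subgroup.closure {p.1, p.2}} = #(genPairs n m) :=
    Nat.subtype_card _ fun p => by
      simp only [genPairs, mem_filter, mem_product, mem_ofOrder, and_assoc]
  have h2 : Nat.card {σ : Perm (Fin n) // orderOf σ = m} = #(ofOrder (Fin n) m) :=
    Nat.subtype_card _ fun σ => mem_ofOrder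
  rw [ordProb, h1, h2]

lemma ordProb_nonneg (n m : ℕ) : 0 ≤ ordProb n m := by
  rw [ordProb_eq]; positivity

lemma ordProb_le_one (n m : ℕ) : ordProb n m ≤ 1 := by
  classical
  rw [ordProb_eq]
  refine div_le_one_of_le₀ ?_ (by positivity)
  have : #(genPairs n m) ≤ #(ofOrder (Fin n) m) ^ 2 := by
    rw [sq, ← card_product]
    exact card_le_card (filter_subset _ _)
  exact_mod_cast this

lemma orderOf_conj {α : Type*} (h y : Perm α) : orderOf (h * y * h⁻¹) = orderOf y := by
  have := orderOf_injective (MulAut.conj h).toMonoidHom (MulAut.conj h).injective y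
  simpa using this

/-- The number of generating pairs is the sum over all pairs of the probability of generation
after a random conjugation. -/
lemma card_genPairs (n m : ℕ) :
    (#(genPairs n m) : ℝ) = ∑ x ∈ ofOrder (Fin n) m, ∑ y ∈ ofOrder (Fin n) m,
      Pr (fun h => alternatingGroup (Fin n) ≤ Subgroup.closure {x, h * y * h⁻¹}) := by
  classical
  have hfac : (0 : ℝ) < (Fintype.card (Fin n)).factorial := by positivity
  have hpair : ∀ h : Perm (Fin n), #(genPairs n m) =
      #{p ∈ ofOrder (Fin n) m ×ˢ ofOrder (Fin n) m |
        alternatingGroup (Fin n) ≤ Subgroup.closure {p.1, h * p.2 * h⁻¹}} := by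
    intro h
    refine (card_bij (fun p _ => (p.1, h * p.2 * h⁻¹)) ?_ ?_ ?_).symm
    · rintro ⟨x, y⟩ hp
      simp only [genPairs, mem_filter, mem_product, mem_ofOrder, orderOf_conj] at hp ⊢
      exact hp
    · rintro ⟨x, y⟩ - ⟨x', y'⟩ - heq
      simpa using heq
    · rintro ⟨x, y⟩ hp
      refine ⟨(x, h⁻¹ * y * h), ?_, ?_⟩
      · have hc := orderOf_conj h⁻¹ y
        rw [inv_inv] at hc
        have e : h * (h⁻¹ * y * h) * h⁻¹ = y := by group
        simp only [genPairs, mem_filter, mem_product, mem_ofOrder] at hp ⊢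
        rw [e, hc]
        exact hp
      · simp only [Prod.mk.injEq, true_and]
        group
  have hsum : (#(genPairs n m) : ℝ) * (Fintype.card (Fin n)).factorial =
      ∑ x ∈ ofOrder (Fin n) m, ∑ y ∈ ofOrder (Fin n) m, ∑ h : Perm (Fin n),
        if alternatingGroup (Fin n) ≤ Subgroup.closure {x, h * y * h⁻¹} then (1 : ℝ) else 0 := by
    calc (#(genPairs n m) : ℝ) * (Fintype.card (Fin n)).factorial
        = ∑ _h : Perm (Fin n), (#(genPairs n m) : ℝ) := by
          rw [sum_const, card_univ, Fintype.card_perm, nsmul_eq_mul, mul_comm]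
      _ = ∑ h : Perm (Fin n), ∑ x ∈ ofOrder (Fin n) m, ∑ y ∈ ofOrder (Fin n) m,
          if alternatingGroup (Fin n) ≤ Subgroup.closure {x, h * y * h⁻¹} then (1 : ℝ) else 0 := by
          refine sum_congr rfl fun h _ => ?_
          rw [hpair h, natCast_card_filter, sum_product]
      _ = _ := by
          rw [sum_comm]
          exact sum_congr rfl fun x _ => sum_comm
  rw [← mul_right_cancel_iff_of_pos hfac, hsum, sum_mul]
  refine sum_congr rfl fun x _ => ?_
  rw [sum_mul]
  refine sum_congr rfl fun y _ => ?_
  rw [Pr_eq_card, div_mul_cancel₀ _ hfac.ne', natCast_card_filter]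

lemma le_ordProb {n m : ℕ} {K δ c : ℝ} (hc : 0 ≤ c)
    (hM : ∀ x y : Perm (Fin n), Good K δ x y →
      c ≤ Pr (fun h => alternatingGroup (Fin n) ≤ Subgroup.closure {x, h * y * h⁻¹}))
    (hhalf : #(ofOrder (Fin n) m) ≤ 2 * #{σ ∈ ofOrder (Fin n) m |
      fixCount σ ≤ K * √n ∧ δ * n ≤ (longCount σ : ℝ)})
    (hne : 0 < #(ofOrder (Fin n) m)) : c / 4 ≤ ordProb n m := by
  rw [ordProb_eq, le_div_iff₀ (by positivity), card_genPairs]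
  set G := ({σ ∈ ofOrder (Fin n) m | fixCount σ ≤ K * √n ∧ δ * n ≤ (longCount σ : ℝ)} :
    Finset (Perm (Fin n))) with hG
  have hGT : G ⊆ ofOrder (Fin n) m := filter_subset _ _
  have hhalf' : (#(ofOrder (Fin n) m) : ℝ) ≤ 2 * #G := by exact_mod_cast hhalf
  calc c / 4 * (#(ofOrder (Fin n) m) : ℝ) ^ 2 ≤ c / 4 * (2 * #G) ^ 2 := by gcongr
    _ = ∑ x ∈ G, ∑ y ∈ G, c := by simp only [sum_const, nsmul_eq_mul]; ring
    _ ≤ ∑ x ∈ G, ∑ y ∈ G,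
        Pr (fun h => alternatingGroup (Fin n) ≤ Subgroup.closure {x, h * y * h⁻¹}) := by
        refine sum_le_sum fun x hx => sum_le_sum fun y hy => hM x y ?_
        have h1 := (mem_filter.1 hx).2
        have h2 := (mem_filter.1 hy).2
        refine ⟨?_, ?_, ?_⟩
        · rw [Fintype.card_fin]; exact h1.1
        · rw [Fintype.card_fin]; exact h2.1
        · rw [Fintype.card_fin]; exact h2.2
    _ ≤ _ := by
        refine (sum_le_sum fun x _ => sum_le_sum_of_subset_of_nonneg hGT fun _ _ _ =>
          Pr_nonneg _).trans (sum_le_sum_of_subset_of_nonneg hGT fun _ _ _ =>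
          sum_nonneg fun _ _ => Pr_nonneg _)

lemma ordProb_le {n m : ℕ} {c : ℝ} (hc : 0 ≤ c)
    (hM : ∀ x ∈ ofOrder (Fin n) m, ∀ y ∈ ofOrder (Fin n) m,
      Pr (fun h => alternatingGroup (Fin n) ≤ Subgroup.closure {x, h * y * h⁻¹}) ≤ c) :
    ordProb n m ≤ c := by
  rw [ordProb_eq, card_genPairs]
  refine div_le_of_le_mul₀ (by positivity) hc ?_
  calc _ ≤ ∑ x ∈ ofOrder (Fin n) m, ∑ y ∈ ofOrder (Fin n) m, c :=
        sum_le_sum fun x hx => sum_le_sum fun y hy => hM x hx y hy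
    _ = _ := by simp only [sum_const, nsmul_eq_mul]; ring

lemma sub_choose_mul_pow_le (n a b : ℕ) :
    (n - a).choose b * n ^ b ≤ n.choose b * (n - a) ^ b := by
  have h : (n - a).descFactorial b * n ^ b ≤ n.descFactorial b * (n - a) ^ b := by
    induction b with
    | zero => simp
    | succ k ih =>
      rw [Nat.descFactorial_succ, Nat.descFactorial_succ, pow_succ, pow_succ]
      have h1 : (n - a - k) * n ≤ (n - k) * (n - a) := by
        rcases le_or_gt (n - a) k with h | h
        · rw [Nat.sub_eq_zero_of_le h]; simp
        · have h2 : a ≤ n := by omega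
          zify [h.le, h2, show k ≤ n by omega]
          nlinarith [Int.natCast_nonneg a, Int.natCast_nonneg k,
            mul_nonneg (Int.natCast_nonneg a) (Int.natCast_nonneg k)]
      calc (n - a - k) * (n - a).descFactorial k * (n ^ k * n)
          = ((n - a - k) * n) * ((n - a).descFactorial k * n ^ k) := by ring
        _ ≤ ((n - k) * (n - a)) * (n.descFactorial k * (n - a) ^ k) := by gcongr
        _ = _ := by ring
  rw [Nat.descFactorial_eq_factorial_mul_choose, Nat.descFactorial_eq_factorial_mul_choose,
    mul_assoc, mul_assoc] at h
  exact Nat.le_of_mul_le_mul_left h (Nat.factorial_pos b)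

section
variable {α : Type*} [Fintype α] [DecidableEq α]

lemma Pr_disjoint_le (S U : Finset α) (hα : 0 < Fintype.card α) :
    Pr (fun h : Perm α => Disjoint S (h • U)) ≤
      Real.exp (-(#S * #U / Fintype.card α)) := by
  have hn : (0 : ℝ) < Fintype.card α := by exact_mod_cast hα
  have hU := card_le_univ U
  have hS := card_le_univ S
  have hch : (0 : ℝ) < (Fintype.card α).choose #U := by exact_mod_cast Nat.choose_pos hU
  have h1 : Pr (fun h : Perm α => Disjoint S (h • U)) ≤
      ∑ B ∈ powersetCard #U Sᶜ, Pr (fun h : Perm α => h • U = B) := by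
    refine (Pr_mono fun h hd => ?_).trans (Pr_exists_le _ _)
    refine ⟨h • U, mem_powersetCard.2 ⟨fun a ha => ?_, card_smul_finset h U⟩, rfl⟩
    exact mem_compl.2 fun haS => (disjoint_left.1 hd) haS ha
  have h2 : ∑ B ∈ powersetCard #U Sᶜ, Pr (fun h : Perm α => h • U = B) ≤
      (Fintype.card α - #S).choose #U * (1 / (Fintype.card α).choose #U) := by
    refine (sum_le_card_nsmul _ _ _ fun B _ => Pr_smul_eq_le U B).trans ?_
    rw [card_powersetCard, card_compl, nsmul_eq_mul]
  have h3 : ((Fintype.card α - #S).choose #U : ℝ) * (Fintype.card α : ℝ) ^ #U ≤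
      (Fintype.card α).choose #U * ((Fintype.card α : ℝ) - #S) ^ #U := by
    rw [← Nat.cast_sub hS]
    exact_mod_cast sub_choose_mul_pow_le (Fintype.card α) #S #U
  have h4 : 1 - (#S : ℝ) / Fintype.card α ≤ Real.exp (-(#S / Fintype.card α)) := by
    have := Real.add_one_le_exp (-(#S / Fintype.card α : ℝ))
    linarith
  have h5 : 0 ≤ 1 - (#S : ℝ) / Fintype.card α := by
    rw [sub_nonneg, div_le_one hn]; exact_mod_cast hS
  calc _ ≤ (Fintype.card α - #S).choose #U * (1 / ((Fintype.card α).choose #U : ℝ)) :=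
        h1.trans h2
    _ ≤ (1 - (#S : ℝ) / Fintype.card α) ^ #U := by
        rw [mul_one_div, div_le_iff₀ hch, one_sub_div hn.ne', div_pow, div_mul_eq_mul_div,
          le_div_iff₀ (by positivity)]
        linarith
    _ ≤ Real.exp (-(#S / Fintype.card α)) ^ #U := by gcongr
    _ = _ := by
        rw [← Real.exp_nat_mul]
        congr 1
        ring

lemma exists_threeCycle (a : α) (h : 3 ≤ Fintype.card α) :
    ∃ g ∈ alternatingGroup α, g a ≠ a := by
  obtain ⟨b, hb⟩ := exists_mem_notMem_of_card_lt_card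
    (s := {a}) (t := (univ : Finset α)) (by rw [card_singleton, card_univ]; omega)
  obtain ⟨e, he⟩ := exists_mem_notMem_of_card_lt_card
    (s := {a, b}) (t := (univ : Finset α)) (by
      rw [card_univ]; exact lt_of_le_of_lt card_le_two (by omega))
  simp only [mem_univ, mem_singleton, mem_insert, true_and, not_or] at hb he
  refine ⟨swap a b * swap a e,
    (Perm.isThreeCycle_swap_mul_swap_same (Ne.symm hb) (Ne.symm he.1) (Ne.symm he.2)).mem_alternatingGroup, ?_⟩
  rw [Perm.mul_apply, swap_apply_left, swap_apply_of_ne_of_ne he.1 he.2]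
  exact he.1

lemma not_common_fixed (h3 : 3 ≤ Fintype.card α) {x y : Perm α}
    (h : alternatingGroup α ≤ Subgroup.closure {x, y}) (a : α) (hx : x a = a) : y a ≠ a := by
  intro hy
  obtain ⟨g, hg, hga⟩ := exists_threeCycle a h3
  refine hga ?_
  have hle : Subgroup.closure {x, y} ≤ MulAction.stabilizer (Perm α) a := by
    rw [Subgroup.closure_le]
    rintro z (rfl | rfl)
    · exact hx
    · exact hy
  exact hle (h hg)

lemma Pr_alternatingGroup_le_closure_le (h3 : 3 ≤ Fintype.card α) (x y : Perm α) :
    Pr (fun h => alternatingGroup α ≤ Subgroup.closure {x, h * y * h⁻¹}) ≤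
      Real.exp (-(fixCount x * fixCount y / Fintype.card α)) := by
  refine (Pr_mono fun h hh => ?_).trans
    (Pr_disjoint_le ({i | x i = i} : Finset α) ({i | y i = i} : Finset α) (by omega))
  refine disjoint_left.2 fun a ha ha' => ?_
  obtain ⟨b, hb, rfl⟩ := mem_smul_finset.1 ha'
  refine not_common_fixed h3 hh (h b) (mem_filter.1 ha).2 ?_
  rw [Perm.mul_apply, Perm.mul_apply, Perm.inv_eq_iff_eq.2 rfl, (mem_filter.1 hb).2]

lemma dihedral_mem {G : Type*} [Group G] {x y u : G} (hx : x * x = 1) (hy : y * y = 1)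
    (hu : u ∈ Subgroup.closure {x, y}) : u ∈ Subgroup.zpowers (x * y) ∨ u * u = 1 := by
  have hxi : x⁻¹ = x := inv_eq_of_mul_eq_one_left hx
  have hyi : y⁻¹ = y := inv_eq_of_mul_eq_one_left hy
  have hconj : ∀ z ∈ Subgroup.zpowers (x * y), x * z * x = z⁻¹ := by
    rintro z ⟨k, rfl⟩
    have h1 : x * (x * y) * x⁻¹ = (x * y)⁻¹ := by
      rw [← mul_assoc, hx, one_mul, mul_inv_rev, hxi, hyi]
    have h2 := conj_zpow (i := k) (a := x) (b := x * y)
    rw [h1] at h2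
    simp only
    rw [← inv_zpow, h2, hxi]
  have hconj' : ∀ z ∈ Subgroup.zpowers (x * y), x * z * x ∈ Subgroup.zpowers (x * y) :=
    fun z hz => by rw [hconj z hz]; exact inv_mem hz
  have key : u ∈ Subgroup.zpowers (x * y) ∨ u * x ∈ Subgroup.zpowers (x * y) := by
    induction hu using Subgroup.closure_induction with
    | mem v hv =>
      rcases hv with rfl | rfl
      · right; rw [hx]; exact one_mem _
      · right
        have : v * x = (x * v)⁻¹ := by rw [mul_inv_rev, hxi, hyi]
        rw [this]
        exact inv_mem (Subgroup.mem_zpowers _)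
    | one => exact Or.inl (one_mem _)
    | mul v w _ _ hv hw =>
      rcases hv with hv | hv <;> rcases hw with hw | hw
      · exact Or.inl (mul_mem hv hw)
      · right; rw [mul_assoc]; exact mul_mem hv hw
      · right
        have := mul_mem hv (hconj' w hw)
        have e : v * x * (x * w * x) = v * w * x := by
          rw [← mul_assoc, ← mul_assoc, mul_assoc v x x, hx, mul_one]
        rwa [e] at this
      · left
        have := mul_mem hv (hconj' _ hw)
        have e : v * x * (x * (w * x) * x) = v * w := by
          calc v * x * (x * (w * x) * x) = v * (x * x) * w * (x * x) := by group
            _ = _ := by rw [hx]; group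
        rwa [e] at this
    | inv v _ hv =>
      rcases hv with hv | hv
      · exact Or.inl (inv_mem hv)
      · right
        have := inv_mem (hconj' _ hv)
        have e : (x * (v * x) * x)⁻¹ = v⁻¹ * x := by
          rw [mul_assoc, mul_assoc, hx, mul_one, mul_inv_rev, hxi]
        rwa [e] at this
  rcases key with h | h
  · exact Or.inl h
  · right
    have h1 := hconj _ h
    have h2 : x * (u * x) * x = x * u := by rw [mul_assoc, mul_assoc, hx, mul_one]
    rw [h2, mul_inv_rev, hxi] at h1
    have h3 := mul_left_cancel h1
    rw [eq_inv_iff_mul_eq_one] at h3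
    exact h3

lemma not_alternatingGroup_le_closure_involutions (h4 : 4 ≤ Fintype.card α) {x y : Perm α}
    (hx : x * x = 1) (hy : y * y = 1) : ¬ alternatingGroup α ≤ Subgroup.closure {x, y} := by
  intro h
  have hmem : ∀ a b e : α, a ≠ b → a ≠ e → b ≠ e →
      swap a b * swap a e ∈ Subgroup.zpowers (x * y) := by
    intro a b e hab hae hbe
    have hc := Perm.isThreeCycle_swap_mul_swap_same hab hae hbe
    rcases dihedral_mem hx hy (h hc.mem_alternatingGroup) with h1 | h1
    · exact h1
    · exfalso
      have h2 := hc.orderOf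
      have h3 : orderOf (swap a b * swap a e) ∣ 2 :=
        orderOf_dvd_of_pow_eq_one (by rw [sq]; exact h1)
      rw [h2] at h3
      omega
  obtain ⟨S, hS⟩ := exists_subset_card_eq (s := (univ : Finset α)) (n := 4)
    (by rw [card_univ]; exact h4)
  obtain ⟨a, b, e, f, hab, hae, haf, hbe, hbf, hef, -⟩ := card_eq_four.1 hS.2
  obtain ⟨i, hi⟩ := Subgroup.mem_zpowers_iff.1 (hmem a b e hab hae hbe)
  obtain ⟨j, hj⟩ := Subgroup.mem_zpowers_iff.1 (hmem a b f hab haf hbf)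
  have h1 : (swap a b * swap a e) * (swap a b * swap a f) =
    (swap a b * swap a f) * (swap a b * swap a e) := by
    rw [← hi, ← hj, ← zpow_add, ← zpow_add, add_comm]
  have h2 := Perm.ext_iff.1 h1 f
  simp only [Perm.mul_apply, swap_apply_right, swap_apply_left,
    swap_apply_of_ne_of_ne haf.symm hef.symm, swap_apply_of_ne_of_ne haf.symm hbf.symm,
    swap_apply_of_ne_of_ne hab.symm hbe] at h2
  exact hab h2

end

lemma ordProb_two {n : ℕ} (hn : 4 ≤ n) : ordProb n 2 = 0 := by
  classical
  rw [ordProb_eq, div_eq_zero_iff]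
  left
  rw [Nat.cast_eq_zero, card_eq_zero, genPairs, filter_eq_empty_iff]
  rintro ⟨x, y⟩ hp
  obtain ⟨h1, h2⟩ := mem_product.1 hp
  refine not_alternatingGroup_le_closure_involutions (by rwa [Fintype.card_fin]) ?_ ?_
  · rw [← sq, ← mem_ofOrder.1 h1]; exact pow_orderOf_eq_one x
  · rw [← sq, ← mem_ofOrder.1 h2]; exact pow_orderOf_eq_one y

lemma ordProb_le_exp {n m : ℕ} {K : ℝ} (hK : 0 ≤ K) (hn : 3 ≤ n)
    (h : ∀ σ : Perm (Fin n), orderOf σ = m → K * √n < fixCount σ) :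
    ordProb n m ≤ Real.exp (-K ^ 2) := by
  refine ordProb_le (Real.exp_pos _).le fun x hx y hy =>
    (Pr_alternatingGroup_le_closure_le (by rwa [Fintype.card_fin]) x y).trans ?_
  have hn0 : (0 : ℝ) < n := by exact_mod_cast (by omega : 0 < n)
  rw [Real.exp_le_exp, neg_le_neg_iff, Fintype.card_fin, le_div_iff₀ hn0]
  have h1 := (h x (mem_ofOrder.1 hx)).le
  have h2 := (h y (mem_ofOrder.1 hy)).le
  calc K ^ 2 * n = (K * √n) * (K * √n) := by
        rw [mul_mul_mul_comm, Real.mul_self_sqrt hn0.le, sq]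
    _ ≤ _ := by gcongr

end FixedOrder

/-- Two random elements of `Sₙ` of order `mₙ` generate at least `Aₙ` with probability bounded
away from zero if and only if there is `K > 0` such that for all large `n` either `mₙ` is odd
and some element of order `mₙ` has at most `K √n` fixed points, or `mₙ` is even and `mₙ ≠ 2`. -/
theorem fixed_order_positive_probability_generation
    (m : ℕ → ℕ) (hpos : ∀ n, 0 < m n)
    (hord : ∀ n, ∃ σ : Equiv.Perm (Fin n), orderOf σ = m n) :
    0 < liminf (fun n => ordProb n (m n)) atTop ↔
      ∃ K : ℝ, 0 < K ∧ ∀ᶠ n in atTop,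
        (Odd (m n) ∧ ∃ σ : Equiv.Perm (Fin n), orderOf σ = m n ∧
          (fixedPointCount σ : ℝ) ≤ K * Real.sqrt n) ∨
        (Even (m n) ∧ m n ≠ 2) := by
  have hbelow : IsBoundedUnder (· ≥ ·) atTop fun n => ordProb n (m n) :=
    isBoundedUnder_of ⟨0, fun n => FixedOrder.ordProb_nonneg _ _⟩
  have habove : IsBoundedUnder (· ≤ ·) atTop fun n => ordProb n (m n) :=
    isBoundedUnder_of ⟨1, fun n => FixedOrder.ordProb_le_one _ _⟩
  constructor
  · intro h
    obtain ⟨c, hc0, hc⟩ := exists_between h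
    have hev := eventually_lt_of_lt_liminf hc hbelow
    have hKlim : Tendsto (fun K : ℝ => Real.exp (-K ^ 2)) atTop (nhds 0) :=
      Real.tendsto_exp_neg_atTop_nhds_zero.comp (tendsto_pow_atTop two_ne_zero)
    obtain ⟨K, hKc, hK0⟩ := ((hKlim.eventually_lt_const hc0).and (eventually_gt_atTop 0)).exists
    refine ⟨K, hK0, ?_⟩
    filter_upwards [hev, eventually_ge_atTop 4] with n hn hn4
    rcases Nat.even_or_odd (m n) with he | ho
    · refine Or.inr ⟨he, fun h2 => ?_⟩
      rw [h2, FixedOrder.ordProb_two hn4] at hn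
      linarith
    · refine Or.inl ⟨ho, ?_⟩
      by_contra! hno
      have := FixedOrder.ordProb_le_exp (m := m n) hK0.le (by omega : 3 ≤ n) fun σ hσ => by
        rw [← FixedOrder.fixedPointCount_eq]; exact hno σ hσ
      linarith
  · rintro ⟨K, hK, hev⟩
    obtain ⟨K', hK', hhalf⟩ := FixedOrder.eventually_card_ofOrder_le hK
    obtain ⟨c, hc, hM⟩ := FixedOrder.eventually_Pr_alternatingGroup_le_closure_ge hK'
      (show (0 : ℝ) < 1 / 12 by norm_num)
    refine lt_of_lt_of_le (show 0 < c / 4 by positivity) (le_liminf_of_le habove.isCoboundedUnder_flip ?_)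
    filter_upwards [hev, hhalf, hM] with n h1 h2 h3
    obtain ⟨σ, hσ⟩ := hord n
    refine FixedOrder.le_ordProb hc.le h3 (h2 (m n) (hpos n) ?_) (Finset.card_pos.2 ⟨σ, FixedOrder.mem_ofOrder.2 hσ⟩)
    rcases h1 with ⟨ho, τ, hτ, hf⟩ | h1
    · exact Or.inl ⟨ho, τ, hτ, by rwa [← FixedOrder.fixedPointCount_eq]⟩
    · exact Or.inr h1
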